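/- arXiv:2211.01590 — 2 statements merged into one kernel-verified Lean document; each statement's English description precedes it below -/
import Mathlib

section
/- Let T be a C_{2,ϖ} orientation-preserving circle diffeomorphism with irrational rotation number ρ = [k₁,k₂,…], let λ = 1/√(1 + e^{−𝒞}) with 𝒞 = ∫₀¹ |F″(x)/F′(x)| dx, and fix b with 0 < b < 1. Set a = λ^{−b} (so 1 < a < λ^{−1}). If there is c > 0 with k_{n+1} ≤ c·aⁿ for all n, and ∫₀¹ ϖ(y)/y^{1+b} dy < +∞, then T admits a C¹ conjugacy to the rigid rotation R_ρ. -/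
/-- A modulus of continuity. -/
structure IsModulus (w : ℝ → ℝ) : Prop where
  pos : ∀ x : ℝ, 0 < x → 0 < w x
  strictMono : StrictMonoOn w (Set.Ioi 0)
  continuous : ContinuousOn w (Set.Ioi 0)
  subadd : ∀ x y : ℝ, 0 < x → 0 < y → w (x + y) ≤ w x + w y
  tendsto : Filter.Tendsto w (nhdsWithin 0 (Set.Ioi 0)) (nhds 0)

namespace CircleConjugacy

open Set Filter Topology

/-- The lift `F` of a circle diffeomorphism, with derivatives `F'` and `F''` and modulus of
continuity `w` for `F''`. -/
structure SmoothLift (w F F' F'' : ℝ → ℝ) : Prop where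
  modulus : IsModulus w
  strictMono : StrictMono F
  add_one : ∀ x, F (x + 1) = F x + 1
  hasDerivAt : ∀ x, HasDerivAt F (F' x) x
  hasDerivAt' : ∀ x, HasDerivAt F' (F'' x) x
  deriv_pos : ∀ x, 0 < F' x
  abs_sub_le_modulus : ∀ x y : ℝ, x ≠ y → |F'' x - F'' y| ≤ w |x - y|

/-- The logarithm of the derivative of the `n`-th iterate. -/
noncomputable def logDer (F F' : ℝ → ℝ) (n : ℕ) (x : ℝ) : ℝ :=
  birkhoffSum F (fun y => Real.log (F' y)) n x

theorem IsModulus.mono {w : ℝ → ℝ} (hw : IsModulus w) {x y : ℝ} (hx : 0 < x) (hxy : x ≤ y) :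
    w x ≤ w y :=
  hw.strictMono.monotoneOn hx (hx.trans_le hxy) hxy

theorem IsModulus.nat_mul_le {w : ℝ → ℝ} (hw : IsModulus w) {x : ℝ} (hx : 0 < x) (n : ℕ) :
    w ((n + 1 : ℕ) * x) ≤ (n + 1 : ℕ) * w x := by
  induction n with
  | zero => simp
  | succ n ih =>
    have h := hw.subadd ((n + 1 : ℕ) * x) x (by positivity) hx
    have e : ((n + 1 + 1 : ℕ) : ℝ) * x = (n + 1 : ℕ) * x + x := by push_cast; ring
    rw [e]
    push_cast at *
    linarith

theorem IsModulus.mul_le {w : ℝ → ℝ} (hw : IsModulus w) {x B : ℝ} (hx : 0 < x) (hB : 0 < B) :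
    w (B * x) ≤ (B + 1) * w x := by
  have h1 : B ≤ (⌊B⌋₊ + 1 : ℕ) := by exact_mod_cast (Nat.lt_floor_add_one B).le
  have h2 : ((⌊B⌋₊ + 1 : ℕ) : ℝ) ≤ B + 1 := by
    push_cast; linarith [Nat.floor_le hB.le]
  calc w (B * x) ≤ w ((⌊B⌋₊ + 1 : ℕ) * x) :=
        IsModulus.mono hw (by positivity) (mul_le_mul_of_nonneg_right h1 hx.le)
    _ ≤ (⌊B⌋₊ + 1 : ℕ) * w x := IsModulus.nat_mul_le hw hx _
    _ ≤ _ := mul_le_mul_of_nonneg_right h2 (hw.pos x hx).le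

theorem IsModulus.le_mul {w : ℝ → ℝ} (hw : IsModulus w) {x : ℝ} (hx : 0 < x) (hx1 : x ≤ 1) :
    x ≤ 2 / w 1 * w x := by
  have h1 := hw.pos 1 one_pos
  have hwx := hw.pos x hx
  have h := IsModulus.mul_le hw hx (inv_pos.2 hx)
  rw [inv_mul_cancel₀ hx.ne'] at h
  have h2 : x * w 1 ≤ x * ((x⁻¹ + 1) * w x) := mul_le_mul_of_nonneg_left h hx.le
  have h3 : x * ((x⁻¹ + 1) * w x) = (1 + x) * w x := by field_simp
  have h4 : (1 + x) * w x ≤ 2 * w x := by nlinarith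
  rw [div_mul_eq_mul_div, le_div_iff₀ h1]
  linarith

theorem abs_log_sub_log_le {m a b : ℝ} (hm : 0 < m) (ha : m ≤ a) (hb : m ≤ b) :
    |Real.log a - Real.log b| ≤ |a - b| / m := by
  have key : ∀ a b : ℝ, m ≤ a → m ≤ b → Real.log a - Real.log b ≤ |a - b| / m := by
    intro a b ha hb
    have ha0 := hm.trans_le ha
    have hb0 := hm.trans_le hb
    rw [← Real.log_div ha0.ne' hb0.ne']
    calc Real.log (a / b) ≤ a / b - 1 := Real.log_le_sub_one_of_pos (by positivity)
      _ = (a - b) / b := by field_simp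
      _ ≤ |a - b| / b := by gcongr; exact le_abs_self _
      _ ≤ |a - b| / m := by gcongr
  rw [abs_le]
  constructor
  · have := key b a hb ha
    rw [abs_sub_comm] at this
    linarith
  · exact key a b ha hb

theorem abs_log_midpoint_sub_le {m a b : ℝ} (hm : 0 < m) (ha : m ≤ a) (hb : m ≤ b) :
    |Real.log ((a + b) / 2) - (Real.log a + Real.log b) / 2| ≤ (a - b) ^ 2 / m ^ 2 := by
  have ha0 := hm.trans_le ha
  have hb0 := hm.trans_le hb
  have e : Real.log ((a + b) / 2) - (Real.log a + Real.log b) / 2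
      = Real.log (((a + b) / 2) ^ 2 / (a * b)) / 2 := by
    rw [Real.log_div (x := ((a + b) / 2) ^ 2) (by positivity) (by positivity), Real.log_pow,
      Real.log_mul ha0.ne' hb0.ne']
    push_cast; ring
  have h1 : 1 ≤ ((a + b) / 2) ^ 2 / (a * b) := by
    rw [le_div_iff₀ (by positivity)]; nlinarith [sq_nonneg (a - b)]
  rw [e, abs_of_nonneg (div_nonneg (Real.log_nonneg h1) (by norm_num))]
  have h2 := Real.log_le_sub_one_of_pos (lt_of_lt_of_le one_pos h1)
  have h3 : ((a + b) / 2) ^ 2 / (a * b) - 1 = (a - b) ^ 2 / 4 / (a * b) := by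
    field_simp; ring
  have h4 : (a - b) ^ 2 / 4 / (a * b) ≤ (a - b) ^ 2 / 4 / m ^ 2 := by
    gcongr; nlinarith
  have h5 : (a - b) ^ 2 / 4 / m ^ 2 = (a - b) ^ 2 / m ^ 2 / 4 := by ring
  have h6 : 0 ≤ (a - b) ^ 2 / m ^ 2 := by positivity
  linarith

theorem abs_exp_sub_one_le_of_abs_le {x c : ℝ} (hx : |x| ≤ c) :
    |Real.exp x - 1| ≤ Real.exp c * |x| := by
  have hc := (abs_nonneg x).trans hx
  rcases le_total 0 x with h | h
  · rw [abs_of_nonneg h] at *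
    rw [abs_of_nonneg (by linarith [Real.add_one_le_exp x])]
    have h1 := Real.add_one_le_exp (-x)
    have h2 : Real.exp x * Real.exp (-x) = 1 := by rw [← Real.exp_add]; simp
    have h3 : Real.exp x ≤ Real.exp c := Real.exp_le_exp.2 hx
    nlinarith [Real.exp_pos x]
  · rw [abs_of_nonpos h] at *
    have h0 : Real.exp x ≤ 1 := Real.exp_le_one_iff.2 h
    rw [abs_of_nonpos (by linarith)]
    nlinarith [Real.add_one_le_exp x, Real.one_le_exp hc]

theorem abs_le_exp_mul_abs_exp_sub_one {x c : ℝ} (hx : |x| ≤ c) :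
    |x| ≤ Real.exp c * |Real.exp x - 1| := by
  have hc := (abs_nonneg x).trans hx
  have h1 := Real.one_le_exp hc
  rcases le_total 0 x with h | h
  · have h2 := Real.add_one_le_exp x
    rw [abs_of_nonneg h, abs_of_nonneg (by linarith)]
    nlinarith
  · have h2 := Real.add_one_le_exp (-x)
    have h0 : Real.exp x ≤ 1 := Real.exp_le_one_iff.2 h
    rw [abs_of_nonpos h] at *
    rw [abs_of_nonpos (by linarith)]
    have h3 : Real.exp x * Real.exp (-x) = 1 := by rw [← Real.exp_add]; simp
    have h4 : Real.exp (-x) ≤ Real.exp c := Real.exp_le_exp.2 hx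
    nlinarith [Real.exp_pos x]

namespace SmoothLift

variable {w F F' F'' : ℝ → ℝ}

theorem continuous (H : SmoothLift w F F' F'') : Continuous F :=
  continuous_iff_continuousAt.2 fun x => (H.hasDerivAt x).continuousAt

theorem continuous_deriv (H : SmoothLift w F F' F'') : Continuous F' :=
  continuous_iff_continuousAt.2 fun x => (H.hasDerivAt' x).continuousAt

theorem deriv_add_one (H : SmoothLift w F F' F'') (x : ℝ) : F' (x + 1) = F' x := by
  have h1 : HasDerivAt (fun y => F (y + 1)) (F' (x + 1)) x :=
    (H.hasDerivAt (x + 1)).comp_add_const x 1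
  have h2 : HasDerivAt (fun y => F (y + 1)) (F' x) x := by
    simpa [H.add_one] using (H.hasDerivAt x).add_const 1
  exact h1.unique h2

theorem deriv2_add_one (H : SmoothLift w F F' F'') (x : ℝ) : F'' (x + 1) = F'' x := by
  have h1 : HasDerivAt (fun y => F' (y + 1)) (F'' (x + 1)) x :=
    (H.hasDerivAt' (x + 1)).comp_add_const x 1
  have h2 : HasDerivAt (fun y => F' (y + 1)) (F'' x) x := by
    simpa [H.deriv_add_one] using H.hasDerivAt' x
  exact h1.unique h2

theorem continuous_deriv2 (H : SmoothLift w F F' F'') : Continuous F'' := by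
  rw [Metric.continuous_iff]
  intro x ε hε
  obtain ⟨d, hd, h⟩ := Metric.tendsto_nhdsWithin_nhds.1 H.modulus.tendsto ε hε
  refine ⟨d, hd, fun y hy => ?_⟩
  rcases eq_or_ne y x with rfl | hne
  · simpa using hε
  have h0 : 0 < |y - x| := abs_pos.2 (sub_ne_zero.2 hne)
  have h1 := h (x := |y - x|) h0 (by simpa [Real.dist_eq] using hy)
  rw [Real.dist_eq, sub_zero] at h1
  rw [Real.dist_eq]
  exact (H.abs_sub_le_modulus y x hne).trans_lt ((le_abs_self _).trans_lt h1)

theorem exists_bounds (H : SmoothLift w F F' F'') :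
    ∃ m M : ℝ, 0 < m ∧ 0 < M ∧ (∀ x, m ≤ F' x) ∧ ∀ x, |F'' x| ≤ M := by
  obtain ⟨u, -, hu⟩ := isCompact_Icc.exists_isMinOn (nonempty_Icc.2 zero_le_one)
    (H.continuous_deriv.continuousOn (s := Icc (0 : ℝ) 1))
  obtain ⟨v, -, hv⟩ := isCompact_Icc.exists_isMaxOn (nonempty_Icc.2 zero_le_one)
    (H.continuous_deriv2.abs.continuousOn (s := Icc (0 : ℝ) 1))
  refine ⟨F' u, |F'' v| + 1, H.deriv_pos u, by positivity, fun x => ?_, fun x => ?_⟩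
  · obtain ⟨y, hy, e⟩ := Function.Periodic.exists_mem_Ico₀ H.deriv_add_one one_pos x
    rw [e]; exact hu (Ico_subset_Icc_self hy)
  · obtain ⟨y, hy, e⟩ := Function.Periodic.exists_mem_Ico₀ H.deriv2_add_one one_pos x
    rw [e]
    have : |F'' y| ≤ |F'' v| := hv (Ico_subset_Icc_self hy)
    linarith

theorem deriv_sub_le (H : SmoothLift w F F' F'') {M : ℝ} (hM : ∀ x, |F'' x| ≤ M) (x y : ℝ) :
    |F' x - F' y| ≤ M * |x - y| := by
  have := convex_univ.norm_image_sub_le_of_norm_hasDerivWithin_le (f := F') (f' := F'')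
    (C := M) (s := univ) (x := y) (y := x) (fun z _ => (H.hasDerivAt' z).hasDerivWithinAt)
    (fun z _ => hM z) (mem_univ _) (mem_univ _)
  simpa using this

theorem exists_log_lipschitz (H : SmoothLift w F F' F'') :
    ∃ K : ℝ, 0 < K ∧ ∀ x y, |Real.log (F' x) - Real.log (F' y)| ≤ K * |x - y| := by
  obtain ⟨m, M, hm, hM, h1, h2⟩ := H.exists_bounds
  refine ⟨M / m, by positivity, fun x y => ?_⟩
  calc _ ≤ |F' x - F' y| / m := abs_log_sub_log_le hm (h1 x) (h1 y)
    _ ≤ M * |x - y| / m := by gcongr; exact H.deriv_sub_le h2 x y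
    _ = _ := by ring

theorem trapezoid (H : SmoothLift w F F' F'') {u v : ℝ} (huv : u < v) :
    |F v - F u - (v - u) * ((F' u + F' v) / 2)| ≤ (v - u) * w (v - u) * (v - u) := by
  set φ : ℝ → ℝ := fun s => F s - F u - (s - u) * ((F' u + F' s) / 2) with hφ
  have hd : ∀ s, HasDerivAt φ (F' s - (1 * ((F' u + F' s) / 2) + (s - u) * (F'' s / 2))) s := by
    intro s
    refine ((H.hasDerivAt s).sub_const _).sub (HasDerivAt.mul ?_ ?_)
    · exact (hasDerivAt_id s).sub_const u
    · exact ((H.hasDerivAt' s).const_add _).div_const 2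
  have hw0 := H.modulus.pos (v - u) (sub_pos.2 huv)
  have hb : ∀ s ∈ Icc u v,
      ‖F' s - (1 * ((F' u + F' s) / 2) + (s - u) * (F'' s / 2))‖ ≤ (v - u) * w (v - u) := by
    intro s hs
    rcases hs.1.eq_or_lt with rfl | hus
    · have : F' u - (1 * ((F' u + F' u) / 2) + (u - u) * (F'' u / 2)) = 0 := by ring
      rw [this, norm_zero]
      have := sub_pos.2 huv
      positivity
    obtain ⟨ξ, hξ, e⟩ := exists_hasDerivAt_eq_slope F' F'' hus
      H.continuous_deriv.continuousOn (fun y _ => H.hasDerivAt' y)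
    have hsu := sub_pos.2 hus
    have e2 : F' s - (1 * ((F' u + F' s) / 2) + (s - u) * (F'' s / 2))
        = (s - u) * (F'' ξ - F'' s) / 2 := by
      rw [e]; field_simp; ring
    have h3 : |F'' ξ - F'' s| ≤ w (v - u) := by
      refine (H.abs_sub_le_modulus ξ s hξ.2.ne).trans (IsModulus.mono H.modulus ?_ ?_)
      · exact abs_pos.2 (sub_ne_zero.2 hξ.2.ne)
      · rw [abs_sub_comm, abs_of_pos (sub_pos.2 hξ.2)]
        linarith [hξ.1, hs.2]
    rw [e2, Real.norm_eq_abs, abs_div, abs_mul, abs_of_pos hsu, abs_of_pos (two_pos (α := ℝ))]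
    have h4 : (s - u) * |F'' ξ - F'' s| ≤ (v - u) * w (v - u) :=
      mul_le_mul (by linarith [hs.2]) h3 (abs_nonneg _) (by linarith [hs.2])
    have : 0 ≤ (s - u) * |F'' ξ - F'' s| := by positivity
    linarith
  have h := (convex_Icc u v).norm_image_sub_le_of_norm_hasDerivWithin_le
    (fun s _ => (hd s).hasDerivWithinAt) hb (left_mem_Icc.2 huv.le) (right_mem_Icc.2 huv.le)
  have e0 : φ u = 0 := by simp [hφ]
  rw [e0, sub_zero, Real.norm_eq_abs, Real.norm_eq_abs, abs_of_pos (sub_pos.2 huv)] at h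
  exact h

/-- The logarithm of a difference quotient is the mean of the logarithms of the derivatives at the
endpoints, up to an error of order `|v - u| w(|v - u|)`. -/
theorem exists_log_slope_bound (H : SmoothLift w F F' F'') :
    ∃ K : ℝ, 0 < K ∧ ∀ u v, u ≠ v → |v - u| ≤ 1 →
      |Real.log ((F v - F u) / (v - u)) - (Real.log (F' u) + Real.log (F' v)) / 2|
        ≤ K * (|v - u| * w |v - u|) := by
  obtain ⟨m, M, hm, hM, h1, h2⟩ := H.exists_bounds
  have hw1 := H.modulus.pos 1 one_pos
  refine ⟨1 / m + M ^ 2 / m ^ 2 * (2 / w 1), by positivity, ?_⟩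
  have key : ∀ u v, u < v → |v - u| ≤ 1 →
      |Real.log ((F v - F u) / (v - u)) - (Real.log (F' u) + Real.log (F' v)) / 2|
        ≤ (1 / m + M ^ 2 / m ^ 2 * (2 / w 1)) * (|v - u| * w |v - u|) := by
    intro u v huv hle
    have hpos := sub_pos.2 huv
    rw [abs_of_pos hpos] at *
    obtain ⟨ξ, -, e⟩ := exists_hasDerivAt_eq_slope F F' huv H.continuous.continuousOn
      (fun y _ => H.hasDerivAt y)
    have hD : m ≤ (F v - F u) / (v - u) := e ▸ h1 ξ
    have hA : m ≤ (F' u + F' v) / 2 := by linarith [h1 u, h1 v]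
    have t1 := abs_log_sub_log_le hm hD hA
    have t2 := abs_log_midpoint_sub_le hm (h1 u) (h1 v)
    have t3 : |(F v - F u) / (v - u) - (F' u + F' v) / 2| ≤ (v - u) * w (v - u) := by
      have e3 : (F v - F u) / (v - u) - (F' u + F' v) / 2
          = (F v - F u - (v - u) * ((F' u + F' v) / 2)) / (v - u) := by field_simp
      rw [e3, abs_div, abs_of_pos hpos, div_le_iff₀ hpos]
      exact H.trapezoid huv
    have t4 : (F' u - F' v) ^ 2 ≤ M ^ 2 * (v - u) ^ 2 := by
      rw [← sq_abs, ← mul_pow]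
      have := H.deriv_sub_le h2 u v
      rw [abs_sub_comm u v, abs_of_pos hpos] at this
      gcongr
    have t5 := IsModulus.le_mul H.modulus hpos hle
    have t6 : (v - u) ^ 2 ≤ (2 / w 1) * ((v - u) * w (v - u)) := by nlinarith
    calc _ ≤ |Real.log ((F v - F u) / (v - u)) - Real.log ((F' u + F' v) / 2)|
          + |Real.log ((F' u + F' v) / 2) - (Real.log (F' u) + Real.log (F' v)) / 2| :=
          abs_sub_le _ _ _
      _ ≤ ((v - u) * w (v - u)) / m + M ^ 2 * ((2 / w 1) * ((v - u) * w (v - u))) / m ^ 2 := by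
          refine add_le_add (t1.trans (by gcongr)) (t2.trans ?_)
          gcongr
          exact t4.trans (by gcongr)
      _ = _ := by ring
  intro u v hne hle
  rcases hne.lt_or_gt with h | h
  · exact key u v h hle
  · have := key v u h (by rwa [abs_sub_comm])
    rw [abs_sub_comm u v] at this
    rwa [← neg_div_neg_eq, neg_sub, neg_sub, add_comm (Real.log (F' u))]

theorem iterate_add_int (H : SmoothLift w F F' F'') (n : ℕ) (x : ℝ) (m : ℤ) :
    F^[n] (x + m) = F^[n] x + m := by
  have h1 : ∀ x, F (x - 1) = F x - 1 := fun x => by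
    have := H.add_one (x - 1); rw [sub_add_cancel] at this; linarith
  have h2 : ∀ x (m : ℤ), F (x + m) = F x + m := by
    intro x m
    induction m using Int.induction_on with
    | zero => simp
    | succ i ih => push_cast at *; rw [← add_assoc, H.add_one, ih]; ring
    | pred i ih => push_cast at *; rw [← add_sub_assoc, h1, ih]; ring
  induction n generalizing x with
  | zero => simp
  | succ n ih => rw [Function.iterate_succ_apply, Function.iterate_succ_apply, h2, ih]

theorem iterate_add_nat (H : SmoothLift w F F' F'') (n : ℕ) (x : ℝ) (m : ℕ) :
    F^[n] (x + m) = F^[n] x + m := by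
  simpa using H.iterate_add_int n x m

theorem iterate_sub_nat (H : SmoothLift w F F' F'') (n : ℕ) (x : ℝ) (m : ℕ) :
    F^[n] (x - m) = F^[n] x - m := by
  simpa [sub_eq_add_neg] using H.iterate_add_int n x (-m)

theorem logDer_add_int (H : SmoothLift w F F' F'') (n : ℕ) (x : ℝ) (m : ℤ) :
    logDer F F' n (x + m) = logDer F F' n x := by
  unfold logDer birkhoffSum
  refine Finset.sum_congr rfl fun i _ => ?_
  rw [H.iterate_add_int]
  have := Function.Periodic.int_mul (f := F') (c := 1) H.deriv_add_one m (F^[i] x)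
  rw [mul_one] at this
  simp only [this]

theorem logDer_sub_nat (H : SmoothLift w F F' F'') (n : ℕ) (x : ℝ) (m : ℕ) :
    logDer F F' n (x - m) = logDer F F' n x := by
  simpa [sub_eq_add_neg] using H.logDer_add_int n x (-m)

theorem logDer_add_one (H : SmoothLift w F F' F'') (n : ℕ) (x : ℝ) :
    logDer F F' n (x + 1) = logDer F F' n x := by
  simpa using H.logDer_add_int n x 1

theorem hasDerivAt_iterate (H : SmoothLift w F F' F'') (n : ℕ) (x : ℝ) :
    HasDerivAt F^[n] (Real.exp (logDer F F' n x)) x := by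
  induction n with
  | zero => simpa [logDer] using hasDerivAt_id x
  | succ n ih =>
    rw [Function.iterate_succ']
    have h := (H.hasDerivAt (F^[n] x)).comp x ih
    have e : Real.exp (logDer F F' (n + 1) x) = F' (F^[n] x) * Real.exp (logDer F F' n x) := by
      unfold logDer
      rw [birkhoffSum_succ, Real.exp_add, Real.exp_log (H.deriv_pos _), mul_comm]
    rwa [e]

theorem continuous_logDer (H : SmoothLift w F F' F'') (n : ℕ) :
    Continuous (logDer F F' n) := by
  unfold logDer birkhoffSum
  refine continuous_finsetSum _ fun i _ => ?_
  exact (H.continuous_deriv.comp (H.continuous.iterate i)).log fun x => (H.deriv_pos _).ne'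

theorem exists_logDer_eq_zero (H : SmoothLift w F F' F'') (n : ℕ) :
    ∃ x, logDer F F' n x = 0 := by
  obtain ⟨ξ, -, e⟩ := exists_hasDerivAt_eq_slope F^[n] _ (zero_lt_one (α := ℝ))
    (H.continuous.iterate n).continuousOn (fun y _ => H.hasDerivAt_iterate n y)
  refine ⟨ξ, ?_⟩
  have h := H.iterate_add_nat n 0 1
  simp only [Nat.cast_one, zero_add] at h
  rw [h] at e
  simpa using e

theorem logDer_add (m n : ℕ) (x : ℝ) :
    logDer F F' (m + n) x = logDer F F' m x + logDer F F' n (F^[m] x) :=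
  birkhoffSum_add _ _ _ _ _

theorem logDer_comm (m n : ℕ) (x : ℝ) :
    logDer F F' m (F^[n] x) - logDer F F' m x
      = logDer F F' n (F^[m] x) - logDer F F' n x := by
  have h1 := logDer_add (F := F) (F' := F') m n x
  have h2 := logDer_add (F := F) (F' := F') n m x
  rw [add_comm n m] at h2
  linarith

theorem strictMono_iterate (H : SmoothLift w F F' F'') (n : ℕ) : StrictMono F^[n] :=
  H.strictMono.iterate n

/-- If `Fᵐ` moves one point forward by at most `p`, then `m ρ ≤ p`. -/
theorem rotation_le (H : SmoothLift w F F' F'') {ρ : ℝ}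
    (hrot : ∀ x, Tendsto (fun n : ℕ => (F^[n] x - x) / (n : ℝ)) atTop (𝓝 ρ))
    {m p : ℕ} (hm : 0 < m) {x : ℝ} (h : F^[m] x ≤ x + p) : m * ρ ≤ p := by
  have h1 : ∀ n : ℕ, F^[m * n] x ≤ x + n * p := by
    intro n
    induction n with
    | zero => simp
    | succ n ih =>
      rw [Nat.mul_succ, add_comm, Function.iterate_add_apply]
      calc F^[m] (F^[m * n] x) ≤ F^[m] (x + ((n * p : ℕ) : ℝ)) :=
            (H.strictMono_iterate m).monotone (by push_cast; exact ih)
        _ = F^[m] x + ((n * p : ℕ) : ℝ) := H.iterate_add_nat _ _ _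
        _ ≤ _ := by push_cast; linarith
  have h2 : Tendsto (fun n : ℕ => (F^[m * n] x - x) / ((m * n : ℕ) : ℝ)) atTop (𝓝 ρ) :=
    (hrot x).comp (tendsto_id.const_mul_atTop' hm)
  have hm' : (0 : ℝ) < m := by exact_mod_cast hm
  have h3 : ρ ≤ p / m := by
    refine le_of_tendsto h2 ((eventually_gt_atTop 0).mono fun n hn => ?_)
    have hn' : (0 : ℝ) < n := by exact_mod_cast hn
    rw [div_le_div_iff₀ (by push_cast; positivity) hm']
    push_cast
    nlinarith [h1 n]
  rw [le_div_iff₀ hm'] at h3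
  linarith

theorem le_rotation (H : SmoothLift w F F' F'') {ρ : ℝ}
    (hrot : ∀ x, Tendsto (fun n : ℕ => (F^[n] x - x) / (n : ℝ)) atTop (𝓝 ρ))
    {m p : ℕ} (hm : 0 < m) {x : ℝ} (h : x + p ≤ F^[m] x) : p ≤ m * ρ := by
  have h1 : ∀ n : ℕ, x + n * p ≤ F^[m * n] x := by
    intro n
    induction n with
    | zero => simp
    | succ n ih =>
      rw [Nat.mul_succ, add_comm (m * n), Function.iterate_add_apply]
      calc _ ≤ F^[m] x + ((n * p : ℕ) : ℝ) := by push_cast; linarith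
        _ = F^[m] (x + ((n * p : ℕ) : ℝ)) := (H.iterate_add_nat _ _ _).symm
        _ ≤ F^[m] (F^[m * n] x) :=
            (H.strictMono_iterate m).monotone (by push_cast; exact ih)
  have h2 : Tendsto (fun n : ℕ => (F^[m * n] x - x) / ((m * n : ℕ) : ℝ)) atTop (𝓝 ρ) :=
    (hrot x).comp (tendsto_id.const_mul_atTop' hm)
  have hm' : (0 : ℝ) < m := by exact_mod_cast hm
  have h3 : p / m ≤ ρ := by
    refine ge_of_tendsto h2 ((eventually_gt_atTop 0).mono fun n hn => ?_)
    have hn' : (0 : ℝ) < n := by exact_mod_cast hn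
    rw [div_le_div_iff₀ hm' (by push_cast; positivity)]
    push_cast
    nlinarith [h1 n]
  rw [div_le_iff₀ hm'] at h3
  linarith

theorem abs_logDer_sub_le {K : ℝ}
    (hK : ∀ x y, |Real.log (F' x) - Real.log (F' y)| ≤ K * |x - y|) (m : ℕ) (u v : ℝ) :
    |logDer F F' m u - logDer F F' m v|
      ≤ K * ∑ i ∈ Finset.range m, |F^[i] u - F^[i] v| := by
  unfold logDer birkhoffSum
  rw [← Finset.sum_sub_distrib, Finset.mul_sum]
  exact (Finset.abs_sum_le_sum_abs _ _).trans (Finset.sum_le_sum fun i _ => hK _ _)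

theorem abs_log_slope_iterate_sub_le (H : SmoothLift w F F' F'') {K W : ℝ} (hK0 : 0 ≤ K)
    (hK : ∀ u v, u ≠ v → |v - u| ≤ 1 →
      |Real.log ((F v - F u) / (v - u)) - (Real.log (F' u) + Real.log (F' v)) / 2|
        ≤ K * (|v - u| * w |v - u|))
    {u v : ℝ} (huv : u ≠ v) (m : ℕ)
    (h1 : ∀ i < m, |F^[i] v - F^[i] u| ≤ 1) (hW : ∀ i < m, w |F^[i] v - F^[i] u| ≤ W) :
    |Real.log ((F^[m] v - F^[m] u) / (v - u)) - (logDer F F' m u + logDer F F' m v) / 2|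
      ≤ K * (W * ∑ i ∈ Finset.range m, |F^[i] v - F^[i] u|) := by
  induction m with
  | zero => simp [logDer, div_self (sub_ne_zero.2 huv.symm)]
  | succ m ih =>
    have ih := ih (fun i hi => h1 i (hi.trans m.lt_succ_self))
      (fun i hi => hW i (hi.trans m.lt_succ_self))
    have hne : F^[m] u ≠ F^[m] v := (H.strictMono_iterate m).injective.ne huv
    have hne' : F^[m + 1] u ≠ F^[m + 1] v := (H.strictMono_iterate (m + 1)).injective.ne huv
    have hs := hK _ _ hne (h1 m m.lt_succ_self)
    have hw := hW m m.lt_succ_self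
    have a0 : v - u ≠ 0 := sub_ne_zero.2 huv.symm
    have a1 : F^[m] v - F^[m] u ≠ 0 := sub_ne_zero.2 hne.symm
    have a2 : F^[m + 1] v - F^[m + 1] u ≠ 0 := sub_ne_zero.2 hne'.symm
    have e : Real.log ((F^[m + 1] v - F^[m + 1] u) / (v - u))
        = Real.log ((F^[m + 1] v - F^[m + 1] u) / (F^[m] v - F^[m] u))
          + Real.log ((F^[m] v - F^[m] u) / (v - u)) := by
      rw [← Real.log_mul (div_ne_zero a2 a1) (div_ne_zero a1 a0)]
      congr 1
      field_simp
    have es : ∀ x, logDer F F' (m + 1) x = logDer F F' m x + Real.log (F' (F^[m] x)) :=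
      fun x => birkhoffSum_succ _ _ _ _
    rw [e, es, es, Finset.sum_range_succ]
    rw [Function.iterate_succ_apply' F m v, Function.iterate_succ_apply' F m u]
    have hb : K * (|F^[m] v - F^[m] u| * w |F^[m] v - F^[m] u|)
        ≤ K * (W * |F^[m] v - F^[m] u|) := by
      rw [mul_comm W]
      gcongr
    rw [abs_le] at *
    constructor <;> nlinarith [hs.1, hs.2, ih.1, ih.2]

end SmoothLift

/-- `p n / q n` are the continued fraction convergents of the irrational number `ρ`. -/
structure IsConvergentSeq (ρ : ℝ) (k p q : ℕ → ℕ) : Prop where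
  irrational : Irrational ρ
  one_le_k : ∀ n, 1 ≤ k (n + 1)
  p_zero : p 0 = 0
  p_one : p 1 = 1
  q_zero : q 0 = 1
  q_one : q 1 = k 1
  p_rec : ∀ n, p (n + 2) = k (n + 2) * p (n + 1) + p n
  q_rec : ∀ n, q (n + 2) = k (n + 2) * q (n + 1) + q n
  tendsto : Tendsto (fun n => (p n : ℝ) / (q n : ℝ)) atTop (𝓝 ρ)

namespace IsConvergentSeq

variable {ρ : ℝ} {k p q : ℕ → ℕ}

theorem q_pos_and_le (h : IsConvergentSeq ρ k p q) (n : ℕ) : 0 < q n ∧ q n ≤ q (n + 1) := by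
  induction n with
  | zero => rw [zero_add, h.q_zero, h.q_one]; exact ⟨one_pos, h.one_le_k 0⟩
  | succ n ih =>
    refine ⟨ih.1.trans_le ih.2, ?_⟩
    rw [h.q_rec]
    nlinarith [h.one_le_k (n + 1)]

theorem q_pos (h : IsConvergentSeq ρ k p q) (n : ℕ) : 0 < q n := (h.q_pos_and_le n).1

theorem q_le_succ (h : IsConvergentSeq ρ k p q) (n : ℕ) : q n ≤ q (n + 1) :=
  (h.q_pos_and_le n).2

theorem q_pos_real (h : IsConvergentSeq ρ k p q) (n : ℕ) : (0 : ℝ) < q n := by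
  exact_mod_cast h.q_pos n

theorem det (h : IsConvergentSeq ρ k p q) (n : ℕ) :
    (q n : ℝ) * p (n + 1) - q (n + 1) * p n = (-1) ^ n := by
  induction n with
  | zero => simp [h.p_zero, h.p_one, h.q_zero]
  | succ n ih =>
    rw [h.p_rec, h.q_rec, pow_succ, ← ih]
    push_cast; ring

theorem theta_pos (h : IsConvergentSeq ρ k p q) (n : ℕ) :
    0 < (-1 : ℝ) ^ n * (q n * ρ - p n) := by
  have step : ∀ m, (-1 : ℝ) ^ m * (p m / q m) ≤ (-1) ^ m * (p (m + 2) / q (m + 2)) := by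
    intro m
    have h0 := h.q_pos_real m
    have h2 := h.q_pos_real (m + 2)
    have e : (-1 : ℝ) ^ m * (p (m + 2) / q (m + 2)) - (-1) ^ m * (p m / q m)
        = k (m + 2) / (q m * q (m + 2)) := by
      have hd := h.det m
      have h3 : (q m : ℝ) * p (m + 2) - q (m + 2) * p m = k (m + 2) * (-1) ^ m := by
        rw [h.p_rec, h.q_rec, ← hd]; push_cast; ring
      have h4 : ((-1 : ℝ) ^ m) * (-1) ^ m = 1 := by rw [← mul_pow]; simp
      rw [eq_div_iff (by positivity)]
      field_simp
      linear_combination (-1) ^ m * h3 + (k (m + 2) : ℝ) * h4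
    have : 0 ≤ (k (m + 2) : ℝ) / (q m * q (m + 2)) := by positivity
    linarith
  have hmono : Monotone fun j => (-1 : ℝ) ^ n * (p (n + 2 * j) / q (n + 2 * j)) := by
    refine monotone_nat_of_le_succ fun j => ?_
    have := step (n + 2 * j)
    rwa [pow_add, pow_mul, neg_one_sq, one_pow, mul_one] at this
  have hlim : Tendsto (fun j => (-1 : ℝ) ^ n * (p (n + 2 * j) / q (n + 2 * j))) atTop
      (𝓝 ((-1) ^ n * ρ)) := by
    refine (h.tendsto.comp ?_).const_mul _
    exact tendsto_atTop_mono (fun j => by simp only [id]; omega) tendsto_id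
  have hle := hmono.ge_of_tendsto hlim 0
  simp only [mul_zero, add_zero] at hle
  have hq := h.q_pos_real n
  have hne : (-1 : ℝ) ^ n * (q n * ρ - p n) ≠ 0 := by
    refine mul_ne_zero (pow_ne_zero _ (by norm_num)) fun h0 => ?_
    refine h.irrational ⟨(p n : ℚ) / q n, ?_⟩
    push_cast
    rw [div_eq_iff hq.ne']
    linarith
  refine lt_of_le_of_ne ?_ hne.symm
  have e : (-1 : ℝ) ^ n * (q n * ρ - p n)
      = q n * ((-1) ^ n * ρ - (-1) ^ n * (p n / q n)) := by field_simp
  rw [e]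
  exact mul_nonneg hq.le (sub_nonneg.2 hle)

theorem theta_add_pos (h : IsConvergentSeq ρ k p q) (n : ℕ) :
    0 < (-1 : ℝ) ^ n * (((q n + q (n + 1) : ℕ) : ℝ) * ρ - (p n + p (n + 1) : ℕ)) := by
  have h1 := h.theta_pos (n + 1)
  have h2 := h.theta_pos (n + 2)
  have hk : (1 : ℝ) ≤ k (n + 2) := by exact_mod_cast h.one_le_k (n + 1)
  rw [h.p_rec, h.q_rec] at h2
  rw [pow_succ] at h1
  rw [pow_add, neg_one_sq, mul_one] at h2
  push_cast at *
  nlinarith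

end IsConvergentSeq

/-- A smooth lift of irrational rotation number `ρ`, with the convergents of `ρ`. -/
structure IsRotationLike (w F F' F'' : ℝ → ℝ) (ρ : ℝ) (k p q : ℕ → ℕ) : Prop
    extends SmoothLift w F F' F'', IsConvergentSeq ρ k p q where
  rotation : ∀ x, Tendsto (fun n : ℕ => (F^[n] x - x) / (n : ℝ)) atTop (𝓝 ρ)

/-- The closest return map `F ^ q n - p n`. -/
def shift (F : ℝ → ℝ) (p q : ℕ → ℕ) (n : ℕ) (x : ℝ) : ℝ := F^[q n] x - p n

/-- The length of the interval between `x` and its `n`-th closest return. -/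
def gap (F : ℝ → ℝ) (p q : ℕ → ℕ) (n : ℕ) (x : ℝ) : ℝ := (-1) ^ n * (shift F p q n x - x)

/-- The nonlinearity of `F ^ q (n + 1)` between `x` and its `n`-th closest return. -/
noncomputable def nonlin (F F' : ℝ → ℝ) (p q : ℕ → ℕ) (n : ℕ) (x : ℝ) : ℝ :=
  logDer F F' (q (n + 1)) (shift F p q n x) - logDer F F' (q (n + 1)) x

namespace SmoothLift

variable {w F F' F'' : ℝ → ℝ}

/-- Two opposite returns generate a chain of orbit points which covers the line. -/
theorem exists_chain_interval (H : SmoothLift w F F' F'') {Q P Q' P' : ℕ}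
    (hR : ∀ x, x < F^[Q] x - P) (hL : ∀ x, F^[Q'] x - P' < x) (hQ : 0 < Q) (x z : ℝ) :
    ∃ m : ℤ, (∃ i < Q', z ∈ Icc (F^[i] x + m) (F^[Q] (F^[i] x + m) - P)) ∨
      (∃ i < Q, z ∈ Icc (F^[Q'] (F^[i] x + m) - P') (F^[i] x + m)) := by
  obtain ⟨j, hj, hmax⟩ := (Finset.range (Q + Q')).exists_max_image
    (fun j => F^[j] x + (⌊z - F^[j] x⌋ : ℝ)) ⟨0, by simp; omega⟩
  rw [Finset.mem_range] at hj
  have hle : ∀ i (m : ℤ), i < Q + Q' → F^[i] x + m ≤ z →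
      F^[i] x + m ≤ F^[j] x + (⌊z - F^[j] x⌋ : ℝ) := by
    intro i m hi hm
    refine le_trans ?_ (hmax i (Finset.mem_range.2 hi))
    have : m ≤ ⌊z - F^[i] x⌋ := Int.le_floor.2 (by linarith)
    have : (m : ℝ) ≤ ⌊z - F^[i] x⌋ := by exact_mod_cast this
    linarith
  have hw : F^[j] x + (⌊z - F^[j] x⌋ : ℝ) ≤ z := by
    linarith [Int.floor_le (z - F^[j] x)]
  set m := ⌊z - F^[j] x⌋
  rcases lt_or_ge j Q' with h | h
  · refine ⟨m, Or.inl ⟨j, h, hw, ?_⟩⟩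
    by_contra! hc
    have e : F^[Q] (F^[j] x + m) - P = F^[Q + j] x + ((m - P : ℤ) : ℝ) := by
      rw [H.iterate_add_int, Function.iterate_add_apply]; push_cast; ring
    have h1 := hR (F^[j] x + m)
    rw [e] at hc h1
    linarith [hle (Q + j) _ (by omega) hc.le]
  · refine ⟨m + P', Or.inr ⟨j - Q', by omega, ?_, ?_⟩⟩
    · have e : F^[Q'] (F^[j - Q'] x + ((m + P' : ℤ) : ℝ)) - P' = F^[j] x + m := by
        rw [H.iterate_add_int, ← Function.iterate_add_apply, Nat.add_sub_cancel' h]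
        push_cast; ring
      rw [e]; exact hw
    · by_contra! hc
      have e : F^[Q'] (F^[j - Q'] x + ((m + P' : ℤ) : ℝ)) - P' = F^[j] x + m := by
        rw [H.iterate_add_int, ← Function.iterate_add_apply, Nat.add_sub_cancel' h]
        push_cast; ring
      have h1 := hL (F^[j - Q'] x + ((m + P' : ℤ) : ℝ))
      rw [e] at h1
      linarith [hle (j - Q') _ (by omega) hc.le]

theorem sign_of_rotation (H : SmoothLift w F F' F'') {ρ : ℝ}
    (hrot : ∀ x, Tendsto (fun n : ℕ => (F^[n] x - x) / (n : ℝ)) atTop (𝓝 ρ))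
    {m p : ℕ} (hm : 0 < m) {s : ℝ} (hs : s = 1 ∨ s = -1) (h : 0 < s * (m * ρ - p)) (x : ℝ) :
    0 < s * (F^[m] x - p - x) := by
  by_contra! hc
  rcases hs with rfl | rfl
  · have := H.rotation_le hrot hm (x := x) (p := p) (by linarith)
    linarith
  · have := H.le_rotation hrot hm (x := x) (p := p) (by linarith)
    linarith

end SmoothLift

namespace IsRotationLike

variable {w F F' F'' : ℝ → ℝ} {ρ : ℝ} {k p q : ℕ → ℕ}

theorem gap_pos (H : IsRotationLike w F F' F'' ρ k p q) (n : ℕ) (x : ℝ) : 0 < gap F p q n x :=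
  H.sign_of_rotation H.rotation (H.q_pos n) (neg_one_pow_eq_or ℝ n) (H.theta_pos n) x

theorem shift_shift (H : IsRotationLike w F F' F'' ρ k p q) (m n : ℕ) (x : ℝ) :
    shift F p q m (shift F p q n x) = F^[q m + q n] x - (p m + p n : ℕ) := by
  unfold shift
  rw [H.iterate_sub_nat, Function.iterate_add_apply]
  push_cast; ring

theorem shift_comm (H : IsRotationLike w F F' F'' ρ k p q) (m n : ℕ) (x : ℝ) :
    shift F p q m (shift F p q n x) = shift F p q n (shift F p q m x) := by
  rw [H.shift_shift, H.shift_shift, add_comm (q m), add_comm (p m)]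

theorem iterate_shift (H : IsRotationLike w F F' F'' ρ k p q) (i n : ℕ) (x : ℝ) :
    F^[i] (shift F p q n x) = shift F p q n (F^[i] x) := by
  unfold shift
  rw [H.iterate_sub_nat, ← Function.iterate_add_apply, ← Function.iterate_add_apply, add_comm]

theorem shift_shift_pos (H : IsRotationLike w F F' F'' ρ k p q) (n : ℕ) (x : ℝ) :
    0 < (-1 : ℝ) ^ n * (shift F p q n (shift F p q (n + 1) x) - x) := by
  rw [H.shift_shift]
  exact H.sign_of_rotation H.rotation (by have := H.q_pos n; omega) (neg_one_pow_eq_or ℝ n)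
    (H.theta_add_pos n) x

theorem abs_shift_sub (H : IsRotationLike w F F' F'' ρ k p q) (n : ℕ) (x : ℝ) :
    |shift F p q n x - x| = gap F p q n x := by
  rw [← abs_of_pos (H.gap_pos n x), gap, abs_mul, abs_neg_one_pow, one_mul]

theorem sum_gap (H : IsRotationLike w F F' F'' ρ k p q) (n : ℕ) (x : ℝ) :
    ∑ i ∈ Finset.range (q (n + 1)), gap F p q n (F^[i] x)
      + ∑ i ∈ Finset.range (q n), gap F p q (n + 1) (F^[i] x) = 1 := by
  have key : ∀ a b : ℕ, ∑ i ∈ Finset.range b, (F^[a] (F^[i] x) - F^[i] x)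
      = ∑ i ∈ Finset.range a, (F^[b] (F^[i] x) - F^[i] x) := by
    intro a b
    have h1 := Finset.sum_range_add (fun i => F^[i] x) a b
    have h2 := Finset.sum_range_add (fun i => F^[i] x) b a
    rw [add_comm b a] at h2
    simp only [← Function.iterate_add_apply, Finset.sum_sub_distrib]
    linarith
  have e1 : ∀ a n : ℕ, ∑ i ∈ Finset.range a, gap F p q n (F^[i] x)
      = (-1) ^ n * (∑ i ∈ Finset.range a, (F^[q n] (F^[i] x) - F^[i] x) - a * p n) := by
    intro a n
    simp only [gap, shift, ← Finset.mul_sum, Finset.sum_sub_distrib, Finset.sum_const,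
      Finset.card_range, nsmul_eq_mul]
    ring
  rw [e1, e1, key (q n) (q (n + 1)), pow_succ]
  have h4 : ((-1 : ℝ) ^ n) * (-1) ^ n = 1 := by rw [← mul_pow]; simp
  linear_combination (-1) ^ n * H.det n + h4

theorem sum_gap_le_one (H : IsRotationLike w F F' F'' ρ k p q) {m n : ℕ} (hm : m ≤ q (n + 1))
    (x : ℝ) : ∑ i ∈ Finset.range m, gap F p q n (F^[i] x) ≤ 1 := by
  have h := H.sum_gap n x
  have h1 : 0 ≤ ∑ i ∈ Finset.range (q n), gap F p q (n + 1) (F^[i] x) :=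
    Finset.sum_nonneg fun i _ => (H.gap_pos _ _).le
  have h2 : ∑ i ∈ Finset.range m, gap F p q n (F^[i] x)
      ≤ ∑ i ∈ Finset.range (q (n + 1)), gap F p q n (F^[i] x) :=
    Finset.sum_le_sum_of_subset_of_nonneg (Finset.range_mono hm) fun i _ _ => (H.gap_pos _ _).le
  linarith

theorem gap_le_one (H : IsRotationLike w F F' F'' ρ k p q) (n : ℕ) (x : ℝ) :
    gap F p q n x ≤ 1 := by
  simpa using H.sum_gap_le_one (m := 1) (H.q_pos (n + 1)) x

theorem abs_iterate_sub_le (H : IsRotationLike w F F' F'' ρ k p q) {n : ℕ} {x u v : ℝ}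
    (hu : u ∈ uIcc x (shift F p q n x)) (hv : v ∈ uIcc x (shift F p q n x)) (i : ℕ) :
    |F^[i] u - F^[i] v| ≤ gap F p q n (F^[i] x) := by
  have hm := (H.strictMono_iterate i).monotone
  rw [← H.abs_shift_sub, ← H.iterate_shift]
  exact abs_sub_le_of_uIcc_subset_uIcc (uIcc_subset_uIcc (hm.mapsTo_uIcc hv) (hm.mapsTo_uIcc hu))

theorem sum_abs_iterate_sub_le (H : IsRotationLike w F F' F'' ρ k p q) {n : ℕ} {x u v : ℝ}
    (hu : u ∈ uIcc x (shift F p q n x)) (hv : v ∈ uIcc x (shift F p q n x))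
    {m : ℕ} (hm : m ≤ q (n + 1)) :
    ∑ i ∈ Finset.range m, |F^[i] u - F^[i] v| ≤ 1 :=
  (Finset.sum_le_sum fun i _ => H.abs_iterate_sub_le hu hv i).trans (H.sum_gap_le_one hm x)

theorem exists_cover (H : IsRotationLike w F F' F'' ρ k p q) (n : ℕ) (x z : ℝ) :
    ∃ m : ℤ, (∃ i < q (n + 1), z ∈ uIcc (F^[i] x + m) (shift F p q n (F^[i] x + m))) ∨
      (∃ i < q n, z ∈ uIcc (F^[i] x + m) (shift F p q (n + 1) (F^[i] x + m))) := by
  have h0 := H.gap_pos n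
  have h1 := H.gap_pos (n + 1)
  simp only [gap, pow_succ] at h0 h1
  rcases neg_one_pow_eq_or ℝ n with hs | hs <;> rw [hs] at h0 h1
  · obtain ⟨m, ⟨i, hi, hz⟩ | ⟨i, hi, hz⟩⟩ := H.exists_chain_interval (Q := q n) (P := p n)
      (Q' := q (n + 1)) (P' := p (n + 1)) (fun x => by have := h0 x; unfold shift at this; linarith)
      (fun x => by have := h1 x; unfold shift at this; linarith) (H.q_pos n) x z
    · exact ⟨m, Or.inl ⟨i, hi, Icc_subset_uIcc hz⟩⟩
    · exact ⟨m, Or.inr ⟨i, hi, Icc_subset_uIcc' hz⟩⟩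
  · obtain ⟨m, ⟨i, hi, hz⟩ | ⟨i, hi, hz⟩⟩ := H.exists_chain_interval (Q' := q n) (P' := p n)
      (Q := q (n + 1)) (P := p (n + 1)) (fun x => by have := h1 x; unfold shift at this; linarith)
      (fun x => by have := h0 x; unfold shift at this; linarith) (H.q_pos (n + 1)) x z
    · exact ⟨m, Or.inr ⟨i, hi, Icc_subset_uIcc hz⟩⟩
    · exact ⟨m, Or.inl ⟨i, hi, Icc_subset_uIcc' hz⟩⟩

theorem logDer_shift_comm (H : IsRotationLike w F F' F'' ρ k p q) (m n : ℕ) (x : ℝ) :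
    logDer F F' m (shift F p q n x) - logDer F F' m x
      = logDer F F' (q n) (F^[m] x) - logDer F F' (q n) x := by
  unfold shift
  rw [H.logDer_sub_nat, SmoothLift.logDer_comm]

/-- A form of Denjoy's inequality. -/
theorem abs_logDer_le (H : IsRotationLike w F F' F'' ρ k p q) {K : ℝ} (hK0 : 0 ≤ K)
    (hK : ∀ x y, |Real.log (F' x) - Real.log (F' y)| ≤ K * |x - y|) (n : ℕ) (z : ℝ) :
    |logDer F F' (q n) z| ≤ 2 * K := by
  have osc : ∀ {j m : ℕ} {x u v : ℝ}, u ∈ uIcc x (shift F p q j x) →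
      v ∈ uIcc x (shift F p q j x) → m ≤ q (j + 1) →
      |logDer F F' m u - logDer F F' m v| ≤ K := by
    intro j m x u v hu hv hm
    refine (SmoothLift.abs_logDer_sub_le hK m u v).trans ?_
    have := H.sum_abs_iterate_sub_le hu hv hm
    nlinarith
  obtain ⟨x, hx⟩ := H.exists_logDer_eq_zero (q n)
  have orbit : ∀ i < q (n + 1), |logDer F F' (q n) (F^[i] x)| ≤ K := by
    intro i hi
    have h := H.logDer_shift_comm i n x
    rw [hx, sub_zero] at h
    rw [← h]
    exact osc right_mem_uIcc left_mem_uIcc hi.le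
  have fin : ∀ {j i : ℕ} {m : ℤ}, i < q (n + 1) → q n ≤ q (j + 1) →
      z ∈ uIcc (F^[i] x + m) (shift F p q j (F^[i] x + m)) →
      |logDer F F' (q n) z| ≤ 2 * K := by
    intro j i m hi hj hz
    have h1 := osc hz left_mem_uIcc hj
    rw [H.logDer_add_int] at h1
    have h2 := orbit i hi
    rw [abs_le] at *
    constructor <;> linarith
  obtain ⟨m, ⟨i, hi, hz⟩ | ⟨i, hi, hz⟩⟩ := H.exists_cover n x z
  · exact fin hi (H.q_le_succ n) hz
  · exact fin (hi.trans_le (H.q_le_succ n)) ((H.q_le_succ n).trans (H.q_le_succ (n + 1))) hz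

theorem shift_sub_shift (H : IsRotationLike w F F' F'' ρ k p q) {K : ℝ} {n : ℕ}
    (hK : ∀ x, |logDer F F' (q n) x| ≤ K) (u v : ℝ) :
    ∃ c : ℝ, 0 < c ∧ c ≤ Real.exp K ∧ shift F p q n u - shift F p q n v = c * (u - v) := by
  have key : ∀ u v : ℝ, u < v → ∃ c : ℝ, 0 < c ∧ c ≤ Real.exp K ∧
      shift F p q n v - shift F p q n u = c * (v - u) := by
    intro u v huv
    obtain ⟨ξ, -, e⟩ := exists_hasDerivAt_eq_slope F^[q n] _ huv
      (H.continuous.iterate _).continuousOn (fun y _ => H.hasDerivAt_iterate (q n) y)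
    refine ⟨_, Real.exp_pos _, Real.exp_le_exp.2 ((le_abs_self _).trans (hK ξ)), ?_⟩
    rw [e, div_mul_cancel₀ _ (sub_ne_zero.2 huv.ne')]
    unfold shift; ring
  rcases lt_trichotomy u v with h | rfl | h
  · obtain ⟨c, h1, h2, h3⟩ := key u v h
    exact ⟨c, h1, h2, by linarith⟩
  · exact ⟨1, one_pos, Real.one_le_exp ((abs_nonneg _).trans (hK u)), by simp⟩
  · exact key v u h

theorem gap_succ_le (H : IsRotationLike w F F' F'' ρ k p q) {K : ℝ} {n : ℕ}
    (hK : ∀ x, |logDer F F' (q (n + 1)) x| ≤ K) (x : ℝ) :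
    gap F p q (n + 1) x ≤ Real.exp K * gap F p q n x := by
  have h1 := H.shift_shift_pos n x
  obtain ⟨c, hc0, hc, e⟩ := H.shift_sub_shift hK (shift F p q n x) x
  rw [H.shift_comm, ← sub_add_sub_cancel _ (shift F p q (n + 1) x), e] at h1
  have h2 : c * gap F p q n x ≤ Real.exp K * gap F p q n x :=
    mul_le_mul_of_nonneg_right hc (H.gap_pos n x).le
  simp only [gap, pow_succ] at *
  nlinarith

theorem iterate_shift_succ (H : IsRotationLike w F F' F'' ρ k p q) (n : ℕ) (x : ℝ) :
    shift F p q (n + 2) x = (shift F p q (n + 1))^[k (n + 2)] (shift F p q n x) := by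
  have h : ∀ j, (shift F p q (n + 1))^[j] (shift F p q n x)
      = F^[j * q (n + 1) + q n] x - ((j * p (n + 1) + p n : ℕ) : ℝ) := by
    intro j
    induction j with
    | zero => simp [shift]
    | succ j ih =>
      rw [Function.iterate_succ_apply', ih, shift, H.iterate_sub_nat,
        ← Function.iterate_add_apply, show q (n + 1) + (j * q (n + 1) + q n)
          = (j + 1) * q (n + 1) + q n by ring]
      push_cast; ring
  rw [h, shift, H.q_rec, H.p_rec]

theorem gap_add_two_le (H : IsRotationLike w F F' F'' ρ k p q) {K : ℝ} {n : ℕ}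
    (hK : ∀ x, |logDer F F' (q (n + 1)) x| ≤ K) (x : ℝ) :
    gap F p q (n + 2) x ≤ 1 / (1 + Real.exp (-K)) * gap F p q n x := by
  obtain ⟨j, hj⟩ : ∃ j, k (n + 2) = j + 1 :=
    ⟨k (n + 2) - 1, (Nat.sub_add_cancel (H.one_le_k (n + 1))).symm⟩
  set s : ℝ := (-1) ^ n with hs
  set u := (shift F p q (n + 1))^[j] (shift F p q n x) with hu
  set y := shift F p q (n + 2) x with hy
  have hyu : y = shift F p q (n + 1) u := by
    rw [hy, H.iterate_shift_succ, hj, Function.iterate_succ_apply']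
  have h1 : s * (u - shift F p q n x) ≤ 0 := by
    have : ∀ i, s * ((shift F p q (n + 1))^[i] (shift F p q n x) - shift F p q n x) ≤ 0 := by
      intro i
      induction i with
      | zero => simp
      | succ i ih =>
        rw [Function.iterate_succ_apply']
        have := H.gap_pos (n + 1) ((shift F p q (n + 1))^[i] (shift F p q n x))
        rw [gap, pow_succ, ← hs] at this
        linarith
    exact this j
  have h2 : 0 < s * (u - y) := by
    have := H.gap_pos (n + 1) u
    rw [gap, pow_succ, ← hs, ← hyu] at this
    linarith
  have h3 : s * (shift F p q (n + 1) y - x) < 0 := by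
    have := H.shift_shift_pos (n + 1) x
    rw [pow_succ, ← hs, ← hy] at this
    linarith
  obtain ⟨c, hc0, hc, e⟩ := H.shift_sub_shift hK u y
  rw [← hyu] at e
  have h4 : s * (y - shift F p q (n + 1) y) = c * (s * (u - y)) := by rw [e]; ring
  have h5 : c * (s * (u - y)) ≤ Real.exp K * (s * (u - y)) := by gcongr
  have e1 : gap F p q (n + 2) x = s * (y - x) := by
    rw [gap, pow_add, neg_one_sq, mul_one]
  have e2 : gap F p q n x = s * (shift F p q n x - x) := rfl
  have h6 : s * (y - x) ≤ Real.exp K * (gap F p q n x - gap F p q (n + 2) x) := by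
    have : s * (u - y) ≤ gap F p q n x - gap F p q (n + 2) x := by rw [e1, e2]; linarith
    have := mul_le_mul_of_nonneg_left this (Real.exp_pos K).le
    linarith
  rw [← e1] at h6
  rw [one_div_mul_eq_div, le_div_iff₀ (by positivity)]
  have h7 : Real.exp (-K) * Real.exp K = 1 := by rw [← Real.exp_add]; simp
  have h8 := mul_le_mul_of_nonneg_left h6 (Real.exp_pos (-K)).le
  rw [← mul_assoc, h7] at h8
  linarith

end IsRotationLike

theorem abs_exp_sub_one_le_of_mobius {a b c t η₁ η₂ η₃ N ε E : ℝ} (ht0 : 0 ≤ t) (ht1 : t ≤ 1)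
    (hb : |b - a| ≤ N) (hc : |c - a| ≤ N) (h₁ : |η₁| ≤ ε) (h₂ : |η₂| ≤ ε) (h₃ : |η₃| ≤ ε)
    (hε : ε ≤ E)
    (h : Real.exp ((a + b) / 2 + η₁)
      = t * Real.exp ((a + c) / 2 + η₂) + (1 - t) * Real.exp ((b + c) / 2 + η₃)) :
    |Real.exp (-(c - a) / 2) - 1|
      ≤ t * |Real.exp (-(b - a) / 2) - 1| + (2 * Real.exp N + 1) * (Real.exp E * ε) := by
  have hε0 := (abs_nonneg _).trans h₁
  have hN0 := (abs_nonneg _).trans hb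
  have small : ∀ η, |η| ≤ ε → |Real.exp η - 1| ≤ Real.exp E * ε := fun η hη =>
    (abs_exp_sub_one_le_of_abs_le (hη.trans hε)).trans (by gcongr)
  set X := Real.exp (-(c - a) / 2) with hX
  set Y := Real.exp (-(b - a) / 2) with hY
  have hXN : X ≤ Real.exp N := Real.exp_le_exp.2 (by have := (abs_le.1 hc).1; linarith)
  have hYN : Y ≤ Real.exp N := Real.exp_le_exp.2 (by have := (abs_le.1 hb).1; linarith)
  have e1 : Real.exp ((a + b) / 2 + η₁) = Real.exp ((b + c) / 2) * (X * Real.exp η₁) := by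
    rw [hX, ← Real.exp_add, ← Real.exp_add]; ring_nf
  have e2 : Real.exp ((a + c) / 2 + η₂) = Real.exp ((b + c) / 2) * (Y * Real.exp η₂) := by
    rw [hY, ← Real.exp_add, ← Real.exp_add]; ring_nf
  rw [e1, e2, Real.exp_add _ η₃] at h
  have h' : X * Real.exp η₁ = t * (Y * Real.exp η₂) + (1 - t) * Real.exp η₃ := by
    have := (Real.exp_pos ((b + c) / 2)).ne'
    apply mul_left_cancel₀ this
    linear_combination h
  have e3 : X - 1 = t * (Y - 1) + (-(X * (Real.exp η₁ - 1)) + t * (Y * (Real.exp η₂ - 1))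
      + (1 - t) * (Real.exp η₃ - 1)) := by linear_combination h'
  have b1 : |-(X * (Real.exp η₁ - 1))| ≤ Real.exp N * (Real.exp E * ε) := by
    rw [abs_neg, abs_mul, abs_of_pos (Real.exp_pos _)]
    exact mul_le_mul hXN (small _ h₁) (abs_nonneg _) (Real.exp_pos _).le
  have b2 : |t * (Y * (Real.exp η₂ - 1))| ≤ Real.exp N * (Real.exp E * ε) := by
    rw [abs_mul, abs_mul, abs_of_nonneg ht0, abs_of_pos (Real.exp_pos (-(b - a) / 2))]
    calc _ ≤ 1 * (Y * |Real.exp η₂ - 1|) := by gcongr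
      _ ≤ Real.exp N * (Real.exp E * ε) := by
        rw [one_mul]
        exact mul_le_mul hYN (small _ h₂) (abs_nonneg _) (Real.exp_pos _).le
  have b3 : |(1 - t) * (Real.exp η₃ - 1)| ≤ Real.exp E * ε := by
    rw [abs_mul, abs_of_nonneg (by linarith : 0 ≤ 1 - t)]
    calc _ ≤ 1 * |Real.exp η₃ - 1| := by gcongr; linarith
      _ ≤ _ := by rw [one_mul]; exact small _ h₃
  rw [e3]
  refine (abs_add_le _ _).trans ?_
  rw [abs_mul t, abs_of_nonneg ht0]
  have := abs_add_three (-(X * (Real.exp η₁ - 1))) (t * (Y * (Real.exp η₂ - 1)))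
    ((1 - t) * (Real.exp η₃ - 1))
  linarith

theorem abs_exp_sub_one_le_of_return {t S₀ S₁ N η₀ η₁ K ε E : ℝ} (ht0 : 0 ≤ t)
    (ht : t ≤ Real.exp K) (h₀ : |S₀| ≤ K) (h₁ : |S₁| ≤ K) (hN : |N| ≤ 2 * K)
    (hη₀ : |η₀| ≤ ε) (hη₁ : |η₁| ≤ ε) (hε : ε ≤ E)
    (h : Real.exp (S₁ + N / 2 + η₁) - 1 = -(t * (Real.exp (S₀ + N / 2 + η₀) - 1))) :
    |Real.exp S₁ - 1| ≤ t * |Real.exp S₀ - 1|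
      + (Real.exp K * Real.exp K + Real.exp K) * (Real.exp K *
        (Real.exp E * ε + |Real.exp (-N / 2) - 1|)) := by
  have hε0 := (abs_nonneg _).trans hη₀
  set d := |Real.exp (-N / 2) - 1| with hd
  have small : ∀ η, |η| ≤ ε →
      |Real.exp (N / 2 + η) - 1| ≤ Real.exp K * (Real.exp E * ε + d) := by
    intro η hη
    have e : Real.exp (N / 2 + η) - 1
        = Real.exp (N / 2) * ((Real.exp η - 1) - (Real.exp (-N / 2) - 1)) := by
      have h1 : Real.exp (N / 2) * Real.exp (-N / 2) = 1 := by
        rw [← Real.exp_add, ← Real.exp_zero]; ring_nf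
      rw [Real.exp_add]
      linear_combination h1
    rw [e, abs_mul, abs_of_pos (Real.exp_pos _)]
    have h2 : Real.exp (N / 2) ≤ Real.exp K :=
      Real.exp_le_exp.2 (by have := (abs_le.1 hN).2; linarith)
    refine mul_le_mul h2 ?_ (abs_nonneg _) (Real.exp_pos _).le
    refine (abs_sub _ _).trans (add_le_add ?_ le_rfl)
    exact (abs_exp_sub_one_le_of_abs_le (hη.trans hε)).trans (by gcongr)
  set R := Real.exp K * (Real.exp E * ε + d) with hR
  have hR0 : 0 ≤ R := by positivity
  have s0 := small _ hη₀
  have s1 := small _ hη₁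
  have hS0 : Real.exp S₀ ≤ Real.exp K := Real.exp_le_exp.2 ((le_abs_self _).trans h₀)
  have hS1 : Real.exp S₁ ≤ Real.exp K := Real.exp_le_exp.2 ((le_abs_self _).trans h₁)
  rw [add_assoc, add_assoc, Real.exp_add S₁, Real.exp_add S₀] at h
  have e1 : Real.exp S₁ - 1 = -(t * (Real.exp S₀ - 1))
      + (-(t * (Real.exp S₀ * (Real.exp (N / 2 + η₀) - 1)))
        - Real.exp S₁ * (Real.exp (N / 2 + η₁) - 1)) := by linear_combination h
  have b0 : |-(t * (Real.exp S₀ * (Real.exp (N / 2 + η₀) - 1)))|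
      ≤ Real.exp K * Real.exp K * R := by
    rw [abs_neg, abs_mul, abs_mul, abs_of_nonneg ht0, abs_of_pos (Real.exp_pos S₀), ← mul_assoc]
    gcongr
  have b1 : |Real.exp S₁ * (Real.exp (N / 2 + η₁) - 1)| ≤ Real.exp K * R := by
    rw [abs_mul, abs_of_pos (Real.exp_pos S₁)]
    gcongr
  rw [e1]
  refine (abs_add_le _ _).trans ?_
  have e2 : |-(t * (Real.exp S₀ - 1))| = t * |Real.exp S₀ - 1| := by
    rw [abs_neg, abs_mul, abs_of_nonneg ht0]
  rw [e2]
  have := abs_sub (-(t * (Real.exp S₀ * (Real.exp (N / 2 + η₀) - 1))))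
    (Real.exp S₁ * (Real.exp (N / 2 + η₁) - 1))
  linarith

/-- The solution of `c (n + 1) = r c n + e n`, `c 0 = a`. -/
def geomConv (r a : ℝ) (e : ℕ → ℝ) : ℕ → ℝ
  | 0 => a
  | n + 1 => r * geomConv r a e n + e n

theorem geomConv_nonneg {r a : ℝ} {e : ℕ → ℝ} (hr : 0 ≤ r) (ha : 0 ≤ a) (he : ∀ n, 0 ≤ e n)
    (n : ℕ) : 0 ≤ geomConv r a e n := by
  induction n with
  | zero => exact ha
  | succ n ih => exact add_nonneg (mul_nonneg hr ih) (he n)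

theorem summable_geomConv {r a g : ℝ} {e : ℕ → ℝ} (hr : 0 ≤ r) (ha : 0 ≤ a) (he : ∀ n, 0 ≤ e n)
    (hg : 0 ≤ g) (hgr : g * r < 1) (hs : Summable fun n => g ^ n * e n) :
    Summable fun n => g ^ n * geomConv r a e n := by
  have hE : ∀ N, ∑ n ∈ Finset.range N, g ^ n * e n ≤ ∑' n, g ^ n * e n := fun N =>
    hs.sum_le_tsum _ fun n _ => mul_nonneg (pow_nonneg hg n) (he n)
  set E := ∑' n, g ^ n * e n
  have hE0 : 0 ≤ E := by simpa using hE 0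
  have h1 : 0 < 1 - g * r := by linarith
  refine summable_of_sum_range_le (c := (a + g * E) / (1 - g * r))
    (fun n => mul_nonneg (pow_nonneg hg n) (geomConv_nonneg hr ha he n)) fun N => ?_
  induction N with
  | zero => simp only [Finset.range_zero, Finset.sum_empty]; positivity
  | succ N ih =>
    rw [Finset.sum_range_succ']
    have e1 : ∑ n ∈ Finset.range N, g ^ (n + 1) * geomConv r a e (n + 1)
        = g * r * ∑ n ∈ Finset.range N, g ^ n * geomConv r a e n
          + g * ∑ n ∈ Finset.range N, g ^ n * e n := by
      rw [Finset.mul_sum, Finset.mul_sum, ← Finset.sum_add_distrib]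
      refine Finset.sum_congr rfl fun n _ => ?_
      rw [geomConv]; ring
    rw [e1, geomConv, pow_zero, one_mul]
    have h2 := mul_le_mul_of_nonneg_left ih (mul_nonneg hg hr)
    have h3 := mul_le_mul_of_nonneg_left (hE N) hg
    have h4 : (a + g * E) / (1 - g * r) = g * r * ((a + g * E) / (1 - g * r)) + (a + g * E) := by
      field_simp; ring
    linarith

theorem le_geomConv {r B a₀ : ℝ} {a δ e : ℕ → ℝ} (hδ : ∀ n, 0 < δ n)
    (he : ∀ n, 0 ≤ e n) (hB : ∀ n d, δ (n + d) ≤ B * r ^ d * δ n) (ha : 0 ≤ a 0) (h0 : a 0 ≤ a₀)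
    (h : ∀ n, a (n + 1) ≤ δ (n + 1) / δ n * a n + e n) (n : ℕ) :
    a n ≤ B * geomConv r a₀ e n := by
  have hB' : ∀ n d, δ (n + d) / δ n ≤ B * r ^ d := fun n d => (div_le_iff₀ (hδ n)).2 (hB n d)
  have key : ∀ n d, δ (n + d) / δ n * a n ≤ B * r ^ d * geomConv r a₀ e n := by
    intro n
    induction n with
    | zero =>
      intro d
      exact mul_le_mul (hB' 0 d) h0 ha ((div_pos (hδ _) (hδ _)).le.trans (hB' 0 d))
    | succ n ih =>
      intro d
      have h1 := ih (d + 1)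
      have h2 := mul_le_mul_of_nonneg_right (hB' (n + 1) d) (he n)
      have h3 := mul_le_mul_of_nonneg_left (h n) (div_pos (hδ (n + 1 + d)) (hδ (n + 1))).le
      have h4 : δ (n + 1 + d) / δ (n + 1) * (δ (n + 1) / δ n * a n + e n)
          = δ (n + (d + 1)) / δ n * a n + δ (n + 1 + d) / δ (n + 1) * e n := by
        have := (hδ n).ne'
        have := (hδ (n + 1)).ne'
        rw [show n + (d + 1) = n + 1 + d by ring]
        field_simp
      have h5 : B * r ^ d * geomConv r a₀ e (n + 1)
          = B * r ^ (d + 1) * geomConv r a₀ e n + B * r ^ d * e n := by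
        rw [geomConv]; ring
      linarith
  simpa [div_self (hδ n).ne'] using key n 0

namespace IsRotationLike

variable {w F F' F'' : ℝ → ℝ} {ρ : ℝ} {k p q : ℕ → ℕ}

theorem exists_iterate_sub_eq (H : IsRotationLike w F F' F'' ρ k p q) {K W : ℝ} (hK0 : 0 ≤ K)
    (hK : ∀ u v, u ≠ v → |v - u| ≤ 1 →
      |Real.log ((F v - F u) / (v - u)) - (Real.log (F' u) + Real.log (F' v)) / 2|
        ≤ K * (|v - u| * w |v - u|))
    {n : ℕ} {x u v : ℝ} (hu : u ∈ uIcc x (shift F p q n x)) (hv : v ∈ uIcc x (shift F p q n x))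
    {m : ℕ} (hm : m ≤ q (n + 1)) (hW : ∀ y, w (gap F p q n y) ≤ W) :
    ∃ η, |η| ≤ K * W ∧ F^[m] v - F^[m] u
      = (v - u) * Real.exp ((logDer F F' m u + logDer F F' m v) / 2 + η) := by
  have hW0 : 0 ≤ W := (H.modulus.pos _ (H.gap_pos n x)).le.trans (hW x)
  rcases eq_or_ne u v with rfl | huv
  · exact ⟨0, by simpa using by positivity, by simp⟩
  have hpos : 0 < (F^[m] v - F^[m] u) / (v - u) := by
    rcases huv.lt_or_gt with h | h
    · exact div_pos (sub_pos.2 (H.strictMono_iterate m h)) (sub_pos.2 h)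
    · exact div_pos_of_neg_of_neg (sub_neg.2 (H.strictMono_iterate m h)) (sub_neg.2 h)
  have hle := fun i => H.abs_iterate_sub_le hv hu i
  have key := H.abs_log_slope_iterate_sub_le hK0 hK huv m
    (fun i _ => (hle i).trans (H.gap_le_one n _)) (fun i _ =>
      (IsModulus.mono H.modulus (abs_pos.2 (sub_ne_zero.2
        ((H.strictMono_iterate i).injective.ne huv.symm))) (hle i)).trans (hW _))
  refine ⟨_, key.trans ?_, ?_⟩
  · have := mul_le_mul_of_nonneg_left (H.sum_abs_iterate_sub_le hv hu hm) hW0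
    rw [mul_one] at this
    exact mul_le_mul_of_nonneg_left this hK0
  · rw [add_sub_cancel, Real.exp_log hpos, mul_div_cancel₀ _ (sub_ne_zero.2 huv.symm)]

theorem nonlin_succ (H : IsRotationLike w F F' F'' ρ k p q) (n : ℕ) (x : ℝ) :
    nonlin F F' p q (n + 1) x
      = logDer F F' (q (n + 1)) (shift F p q (n + 2) x) - logDer F F' (q (n + 1)) x := by
  rw [nonlin, H.logDer_shift_comm, shift, H.logDer_sub_nat]

theorem exists_bound_nonlin_succ (H : IsRotationLike w F F' F'' ρ k p q) :
    ∃ A : ℝ, 0 < A ∧ ∀ n W x, (∀ y, w (gap F p q n y) ≤ W) →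
      |Real.exp (-nonlin F F' p q (n + 1) x / 2) - 1|
        ≤ gap F p q (n + 2) x / gap F p q n x * |Real.exp (-nonlin F F' p q n x / 2) - 1|
          + A * W := by
  obtain ⟨K, hK0, hK⟩ := H.exists_log_lipschitz
  obtain ⟨L, hL0, hL⟩ := H.exists_log_slope_bound
  have hD := H.abs_logDer_le hK0.le hK
  refine ⟨(2 * Real.exp (4 * K) + 1) * (Real.exp (L * w 1) * L), by positivity,
    fun n W x hW => ?_⟩
  have hW' : ∀ y, w (gap F p q n y) ≤ min W (w 1) := fun y =>
    le_min (hW y) (IsModulus.mono H.modulus (H.gap_pos n y) (H.gap_le_one n y))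
  have g0 := H.gap_pos n x
  have g2 := H.gap_pos (n + 2) x
  set t := gap F p q (n + 2) x / gap F p q n x with ht
  have ht0 : 0 ≤ t := (div_pos g2 g0).le
  have ht1 : t ≤ 1 := by
    rw [ht, div_le_one g0]
    refine (H.gap_add_two_le (fun y => hD (n + 1) y) x).trans (mul_le_of_le_one_left g0.le ?_)
    rw [div_le_one (by positivity)]
    linarith [Real.exp_pos (-(2 * K))]
  set y := shift F p q n x with hy
  set z := shift F p q (n + 2) x with hz
  have hzx : z - x = t * (y - x) := by
    rw [ht, gap, gap, pow_add, neg_one_sq, mul_one, ← hy, ← hz]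
    have hyx : y - x ≠ 0 := fun h => by rw [gap, ← hy, h, mul_zero] at g0; exact lt_irrefl _ g0
    have := pow_ne_zero n (by norm_num : (-1 : ℝ) ≠ 0)
    field_simp
  have hzI : z ∈ uIcc x y := by
    rw [← segment_eq_uIcc]
    exact ⟨1 - t, t, by linarith, ht0, by ring, by simp only [smul_eq_mul]; linarith⟩
  obtain ⟨η₁, h1, e1⟩ := H.exists_iterate_sub_eq hL0.le hL (n := n) (x := x) left_mem_uIcc
    right_mem_uIcc le_rfl hW'
  obtain ⟨η₂, h2, e2⟩ := H.exists_iterate_sub_eq hL0.le hL (n := n) (x := x) left_mem_uIcc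
    hzI le_rfl hW'
  obtain ⟨η₃, h3, e3⟩ := H.exists_iterate_sub_eq hL0.le hL (n := n) (x := x) hzI
    right_mem_uIcc le_rfl hW'
  rw [← hy] at e1 e3
  have hb := abs_le.1 (hD (n + 1) y)
  have ha := abs_le.1 (hD (n + 1) x)
  have hc := abs_le.1 (hD (n + 1) z)
  have hyx : y - x ≠ 0 := fun h => by rw [gap, ← hy, h, mul_zero] at g0; exact lt_irrefl _ g0
  have main := abs_exp_sub_one_le_of_mobius (N := 4 * K) (E := L * w 1) ht0 ht1
    (abs_le.2 ⟨by linarith, by linarith⟩) (abs_le.2 ⟨by linarith, by linarith⟩) h1 h2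
    (η₃ := η₃) (by exact h3) (by gcongr; exact min_le_right _ _)
    (a := logDer F F' (q (n + 1)) x) (b := logDer F F' (q (n + 1)) y)
    (c := logDer F F' (q (n + 1)) z) (by
      apply mul_left_cancel₀ hyx
      rw [← e1]
      rw [hzx] at e2
      have h5 : y - z = (1 - t) * (y - x) := by linear_combination -hzx
      rw [h5, add_comm (logDer F F' (q (n + 1)) z)] at e3
      linear_combination e2 + e3)
  rw [H.nonlin_succ, nonlin]
  refine main.trans (add_le_add le_rfl ?_)
  rw [mul_assoc, mul_assoc]
  gcongr
  exact min_le_left _ _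

theorem exists_bound_logDer_succ (H : IsRotationLike w F F' F'' ρ k p q) :
    ∃ A : ℝ, 0 < A ∧ ∀ n W x, (∀ y, w (gap F p q n y) ≤ W) →
      (∀ y, w (gap F p q (n + 1) y) ≤ W) →
      |Real.exp (logDer F F' (q (n + 1)) x) - 1|
        ≤ gap F p q (n + 1) x / gap F p q n x * |Real.exp (logDer F F' (q n) x) - 1|
          + A * (W + |Real.exp (-nonlin F F' p q n x / 2) - 1|) := by
  obtain ⟨K, hK0, hK⟩ := H.exists_log_lipschitz
  obtain ⟨L, hL0, hL⟩ := H.exists_log_slope_bound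
  have hD := H.abs_logDer_le hK0.le hK
  set E := L * w 1 with hE
  set M := (Real.exp (2 * K) * Real.exp (2 * K) + Real.exp (2 * K)) * Real.exp (2 * K) with hM
  refine ⟨M * (Real.exp E * L + 1), by positivity, fun n W x hW hW₁ => ?_⟩
  have hW' : ∀ y, w (gap F p q n y) ≤ min W (w 1) := fun y =>
    le_min (hW y) (IsModulus.mono H.modulus (H.gap_pos n y) (H.gap_le_one n y))
  have hW₁' : ∀ y, w (gap F p q (n + 1) y) ≤ min W (w 1) := fun y =>
    le_min (hW₁ y) (IsModulus.mono H.modulus (H.gap_pos _ y) (H.gap_le_one _ y))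
  have hW0 : 0 ≤ W := (H.modulus.pos _ (H.gap_pos n x)).le.trans (hW x)
  have g0 := H.gap_pos n x
  have g1 := H.gap_pos (n + 1) x
  have hN : logDer F F' (q n) (shift F p q (n + 1) x) - logDer F F' (q n) x
      = nonlin F F' p q n x := by
    rw [nonlin, H.logDer_shift_comm]
    nth_rw 1 [shift]
    rw [H.logDer_sub_nat]
  obtain ⟨η₁, h1, e1⟩ := H.exists_iterate_sub_eq hL0.le hL (n := n) (x := x) left_mem_uIcc
    right_mem_uIcc le_rfl hW'
  obtain ⟨η₀, h0, e0⟩ := H.exists_iterate_sub_eq hL0.le hL (n := n + 1) (x := x) left_mem_uIcc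
    right_mem_uIcc ((H.q_le_succ n).trans (H.q_le_succ (n + 1))) hW₁'
  have f1 : (logDer F F' (q (n + 1)) x + logDer F F' (q (n + 1)) (shift F p q n x)) / 2 + η₁
      = logDer F F' (q (n + 1)) x + nonlin F F' p q n x / 2 + η₁ := by rw [nonlin]; ring
  have f0 : (logDer F F' (q n) x + logDer F F' (q n) (shift F p q (n + 1) x)) / 2 + η₀
      = logDer F F' (q n) x + nonlin F F' p q n x / 2 + η₀ := by rw [← hN]; ring
  rw [f1] at e1
  rw [f0] at e0
  have hcomm := H.shift_comm n (n + 1) x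
  have e1' : F^[q (n + 1)] (shift F p q n x) - F^[q (n + 1)] x
      = shift F p q (n + 1) (shift F p q n x) - shift F p q (n + 1) x := by
    simp only [shift]; ring
  have e0' : F^[q n] (shift F p q (n + 1) x) - F^[q n] x
      = shift F p q n (shift F p q (n + 1) x) - shift F p q n x := by
    simp only [shift]; ring
  rw [e1'] at e1
  rw [e0', hcomm] at e0
  have ht : gap F p q (n + 1) x / gap F p q n x ≤ Real.exp (2 * K) :=
    (div_le_iff₀ g0).2 (H.gap_succ_le (fun y => hD (n + 1) y) x)
  have b1 := abs_le.1 (hD (n + 1) x)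
  have b2 := abs_le.1 (hD (n + 1) (shift F p q n x))
  have main := abs_exp_sub_one_le_of_return (div_pos g1 g0).le ht (hD n x) (hD (n + 1) x)
    (N := nonlin F F' p q n x) (E := E)
    (by rw [nonlin]; exact abs_le.2 ⟨by linarith, by linarith⟩) h0 h1
    (by rw [hE]; gcongr; exact min_le_right _ _) (by
      have hs : ((-1 : ℝ) ^ n) ≠ 0 := pow_ne_zero n (by norm_num)
      have hyx : shift F p q n x - x ≠ 0 := fun h => by
        rw [gap, h, mul_zero] at g0; exact lt_irrefl _ g0
      rw [gap, gap, pow_succ]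
      generalize Real.exp (_ + η₀) = X₀ at e0 ⊢
      generalize Real.exp (_ + η₁) = X₁ at e1 ⊢
      field_simp
      linear_combination e0 - e1)
  refine main.trans (add_le_add le_rfl ?_)
  rw [← mul_assoc, ← hM, mul_assoc M]
  gcongr
  set d := |Real.exp (-nonlin F F' p q n x / 2) - 1| with hd
  have hd0 : 0 ≤ d := abs_nonneg _
  have h6 : Real.exp E * (L * min W (w 1)) ≤ Real.exp E * (L * W) := by
    gcongr; exact min_le_left _ _
  have h7 : 0 ≤ Real.exp E * L * d := by positivity
  nlinarith

end IsRotationLike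

theorem exists_le_mul_pow_of_two_step {A r : ℝ} (hA : 1 ≤ A) (hr0 : 0 < r) (hr1 : r ≤ 1)
    (n₀ : ℕ) : ∃ B : ℝ, 0 < B ∧ ∀ g : ℕ → ℝ, (∀ n, 0 < g n) → (∀ n, g (n + 1) ≤ A * g n) →
      (∀ n, n₀ ≤ n → g (n + 2) ≤ r ^ 2 * g n) → ∀ n d, g (n + d) ≤ B * r ^ d * g n := by
  have hR1 : 1 ≤ A / r := (one_le_div hr0).2 (hr1.trans hA)
  have hR : A = A / r * r := (div_mul_cancel₀ _ hr0.ne').symm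
  set R := A / r
  refine ⟨R ^ (n₀ + 1), by positivity, fun g hg h1 h2 => ?_⟩
  have step : ∀ n, n₀ ≤ n → ∀ d,
      g (n + d) ≤ R * r ^ d * g n ∧ g (n + (d + 1)) ≤ R * r ^ (d + 1) * g n := by
    intro n hn d
    induction d with
    | zero =>
      refine ⟨?_, ?_⟩
      · simpa using le_mul_of_one_le_left (hg n).le hR1
      · simpa [← hR] using h1 n
    | succ d ih =>
      refine ⟨ih.2, ?_⟩
      calc g (n + (d + 2)) ≤ r ^ 2 * g (n + d) := h2 (n + d) (by omega)
        _ ≤ r ^ 2 * (R * r ^ d * g n) := by gcongr; exact ih.1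
        _ = R * r ^ (d + 2) * g n := by ring
  have all : ∀ j n, n₀ ≤ n + j → ∀ d, g (n + d) ≤ R ^ (j + 1) * r ^ d * g n := by
    intro j
    induction j with
    | zero => intro n hn d; simpa using (step n hn d).1
    | succ j ih =>
      intro n hn d
      cases d with
      | zero => simpa using le_mul_of_one_le_left (hg n).le (one_le_pow₀ hR1)
      | succ d =>
        calc g (n + (d + 1)) = g (n + 1 + d) := by congr 1; ring
          _ ≤ R ^ (j + 1) * r ^ d * g (n + 1) := ih (n + 1) (by omega) d
          _ ≤ R ^ (j + 1) * r ^ d * (A * g n) := by gcongr; exact h1 n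
          _ = R ^ (j + 1 + 1) * r ^ (d + 1) * g n := by rw [hR]; ring
  exact fun n d => all n₀ n (by omega) d

theorem summable_modulus {w : ℝ → ℝ} (hw : IsModulus w) {b : ℝ} (hb : 0 < b)
    (hint : MeasureTheory.IntegrableOn (fun y : ℝ => w y / y ^ (1 + b)) (Ioc 0 1))
    {r B : ℝ} (hr0 : 0 < r) (hr1 : r < 1) (hB : 0 < B) :
    Summable fun n : ℕ => (r ^ (-b)) ^ n * w (B * r ^ n) := by
  have hanti : Antitone fun n : ℕ => r ^ n := pow_right_anti₀ hr0.le hr1.le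
  have hsub : (⋃ n : ℕ, Ioc (r ^ (n + 1)) (r ^ n)) ⊆ Ioc 0 1 := iUnion_subset fun n =>
    Ioc_subset_Ioc (by positivity) (pow_le_one₀ hr0.le hr1.le)
  have hsum := MeasureTheory.hasSum_integral_iUnion (μ := MeasureTheory.volume)
    (s := fun n : ℕ => Ioc (r ^ (n + 1)) (r ^ n)) (fun n => measurableSet_Ioc)
    hanti.pairwise_disjoint_on_Ioc_succ (hint.mono_set hsub)
  refine Summable.of_nonneg_of_le (fun n => ?_) (fun n => ?_)
    (hsum.summable.mul_left ((B / r + 1) / (1 - r)))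
  · exact mul_nonneg (by positivity) (hw.pos _ (by positivity)).le
  · have hrn : 0 < r ^ n := by positivity
    have hrn1 : 0 < r ^ (n + 1) := by positivity
    have h1 : w (B * r ^ n) ≤ (B / r + 1) * w (r ^ (n + 1)) := by
      have := IsModulus.mul_le hw hrn1 (div_pos hB hr0)
      rwa [show B / r * r ^ (n + 1) = B * r ^ n by field_simp; ring] at this
    have h2 : w (r ^ (n + 1)) / (r ^ n) ^ (1 + b) * (r ^ n - r ^ (n + 1))
        ≤ ∫ y in Ioc (r ^ (n + 1)) (r ^ n), w y / y ^ (1 + b) := by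
      have hle : r ^ (n + 1) ≤ r ^ n := hanti n.le_succ
      have hc : ∫ _ in Ioc (r ^ (n + 1)) (r ^ n), w (r ^ (n + 1)) / (r ^ n) ^ (1 + b)
          = w (r ^ (n + 1)) / (r ^ n) ^ (1 + b) * (r ^ n - r ^ (n + 1)) := by
        rw [MeasureTheory.setIntegral_const, smul_eq_mul, mul_comm, MeasureTheory.measureReal_def,
          Real.volume_Ioc, ENNReal.toReal_ofReal (by linarith)]
      rw [← hc]
      refine MeasureTheory.setIntegral_mono_on (by simp) (hint.mono_set
        ((subset_iUnion (fun n : ℕ => Ioc (r ^ (n + 1)) (r ^ n)) n).trans hsub))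
        measurableSet_Ioc fun y hy => ?_
      have hy0 : 0 < y := hrn1.trans hy.1
      exact div_le_div₀ (hw.pos _ hy0).le (IsModulus.mono hw hrn1 hy.1.le)
        (Real.rpow_pos_of_pos hy0 _) (Real.rpow_le_rpow hy0.le hy.2 (by linarith))
    have h3 : w (r ^ (n + 1)) / (r ^ n) ^ (1 + b) * (r ^ n - r ^ (n + 1))
        = (1 - r) * ((r ^ (-b)) ^ n * w (r ^ (n + 1))) := by
      have e : (r ^ n) ^ (1 + b) = r ^ n * ((r ^ (-b)) ^ n)⁻¹ := by
        rw [Real.rpow_add hrn, Real.rpow_one, ← inv_pow, ← Real.rpow_neg hr0.le, neg_neg,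
          ← Real.rpow_natCast, ← Real.rpow_natCast, ← Real.rpow_mul hr0.le,
          ← Real.rpow_mul hr0.le, mul_comm b]
      have hg : 0 < (r ^ (-b)) ^ n := by positivity
      rw [e]
      field_simp
      ring
    rw [h3] at h2
    have h4 : 0 < 1 - r := by linarith
    calc (r ^ (-b)) ^ n * w (B * r ^ n)
        ≤ (r ^ (-b)) ^ n * ((B / r + 1) * w (r ^ (n + 1))) := by gcongr
      _ = (B / r + 1) / (1 - r) * ((1 - r) * ((r ^ (-b)) ^ n * w (r ^ (n + 1)))) := by
        field_simp
      _ ≤ _ := by gcongr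

namespace IsRotationLike

variable {w F F' F'' : ℝ → ℝ} {ρ : ℝ} {k p q : ℕ → ℕ}

theorem exists_summable_bound (H : IsRotationLike w F F' F'' ρ k p q) {b r B : ℝ} (hb0 : 0 < b)
    (hb1 : b < 1) (hint : MeasureTheory.IntegrableOn (fun y : ℝ => w y / y ^ (1 + b)) (Ioc 0 1))
    (hr0 : 0 < r) (hr1 : r < 1) (hB : 0 < B)
    (hgap : ∀ n d x, gap F p q (n + d) x ≤ B * r ^ d * gap F p q n x) :
    ∃ D : ℕ → ℝ, (∀ n x, |logDer F F' (q n) x| ≤ D n) ∧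
      Summable fun n => (r ^ (-b)) ^ n * D n := by
  obtain ⟨K, hK0, hK⟩ := H.exists_log_lipschitz
  have hD := H.abs_logDer_le hK0.le hK
  obtain ⟨A₁, hA₁, h₁⟩ := H.exists_bound_nonlin_succ
  obtain ⟨A₂, hA₂, h₂⟩ := H.exists_bound_logDer_succ
  set g := r ^ (-b) with hg
  have hg0 : 0 < g := Real.rpow_pos_of_pos hr0 _
  have hgr : g * r < 1 := by
    have e : g * r = r ^ (-b + 1) := by rw [Real.rpow_add hr0, Real.rpow_one]
    rw [e]
    exact Real.rpow_lt_one hr0.le hr1 (by linarith)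
  set W : ℕ → ℝ := fun n => w (B * r ^ n) with hW
  have hW0 : ∀ n, 0 ≤ W n := fun n => (H.modulus.pos _ (by positivity)).le
  have hWg : ∀ n y, w (gap F p q n y) ≤ W n := fun n y => by
    refine IsModulus.mono H.modulus (H.gap_pos n y) ?_
    have h := hgap 0 n y
    rw [zero_add] at h
    exact h.trans (mul_le_of_le_one_right (by positivity) (H.gap_le_one 0 y))
  have hWs : ∀ n, W (n + 1) ≤ W n := fun n =>
    IsModulus.mono H.modulus (by positivity)
      (mul_le_mul_of_nonneg_left (pow_le_pow_of_le_one hr0.le hr1.le n.le_succ) hB.le)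
  have sW : Summable fun n => g ^ n * W n := summable_modulus H.modulus hb0 hint hr0 hr1 hB
  set s₀ := Real.exp (2 * K) * (2 * K) with hs₀
  have hs0 : 0 ≤ s₀ := by positivity
  have hstart : ∀ y, |y| ≤ 2 * K → |Real.exp y - 1| ≤ s₀ := fun y hy =>
    (abs_exp_sub_one_le_of_abs_le hy).trans
      (mul_le_mul_of_nonneg_left hy (Real.exp_pos _).le)
  set N : ℕ → ℝ := fun n => B * B * geomConv r s₀ (fun n => A₁ * W n) n with hN
  have hN0 : ∀ n, 0 ≤ N n := fun n => mul_nonneg (by positivity)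
    (geomConv_nonneg hr0.le hs0 (fun n => mul_nonneg hA₁.le (hW0 n)) n)
  have sN : Summable fun n => g ^ n * N n := by
    have := (summable_geomConv hr0.le hs0 (fun n => mul_nonneg hA₁.le (hW0 n)) hg0.le hgr
      ((sW.mul_left A₁).congr fun n => by ring)).mul_left (B * B)
    exact this.congr fun n => by simp only [hN]; ring
  have bN : ∀ n x, |Real.exp (-nonlin F F' p q n x / 2) - 1| ≤ N n := by
    intro n x
    refine le_geomConv (a := fun n => |Real.exp (-nonlin F F' p q n x / 2) - 1|)
      (δ := fun n => gap F p q (n + 1) x * gap F p q n x)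
      (fun n => mul_pos (H.gap_pos _ _) (H.gap_pos _ _))
      (fun n => mul_nonneg hA₁.le (hW0 n)) (fun n d => ?_) (abs_nonneg _) ?_ (fun n => ?_) n
    · have e1 := hgap (n + 1) d x
      rw [add_right_comm] at e1
      calc _ ≤ (B * r ^ d * gap F p q (n + 1) x) * (B * r ^ d * gap F p q n x) :=
            mul_le_mul e1 (hgap n d x) (H.gap_pos _ _).le
              (mul_nonneg (by positivity) (H.gap_pos _ _).le)
        _ = B * B * (r ^ d * r ^ d) * (gap F p q (n + 1) x * gap F p q n x) := by ring
        _ ≤ B * B * (r ^ d * 1) * (gap F p q (n + 1) x * gap F p q n x) := by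
          have := H.gap_pos (n + 1) x
          have := H.gap_pos n x
          gcongr
          exact pow_le_one₀ hr0.le hr1.le
        _ = _ := by ring
    · refine hstart _ ?_
      have b1 := abs_le.1 (hD 1 x)
      have b2 := abs_le.1 (hD 1 (shift F p q 0 x))
      rw [nonlin, abs_le]
      constructor <;> linarith
    · have := h₁ n (W n) x (hWg n)
      rwa [mul_comm (gap F p q (n + 1) x), mul_div_mul_right _ _ (H.gap_pos (n + 1) x).ne']
  have hE0 : ∀ n, 0 ≤ A₂ * (W n + N n) := fun n => by
    have := hW0 n
    have := hN0 n
    positivity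
  refine ⟨fun n => Real.exp (2 * K) * (B * geomConv r s₀ (fun n => A₂ * (W n + N n)) n),
    fun n x => ?_, ?_⟩
  · refine (abs_le_exp_mul_abs_exp_sub_one (hD n x)).trans ?_
    refine mul_le_mul_of_nonneg_left ?_ (Real.exp_pos _).le
    refine le_geomConv (a := fun n => |Real.exp (logDer F F' (q n) x) - 1|)
      (δ := fun n => gap F p q n x) (fun n => H.gap_pos _ _) hE0 (fun n d => hgap n d x)
      (abs_nonneg _) (hstart _ (hD 0 x)) (fun n => ?_) n
    exact (h₂ n (W n) x (hWg n) fun y => (hWg _ y).trans (hWs n)).trans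
      (add_le_add le_rfl (mul_le_mul_of_nonneg_left (add_le_add le_rfl (bN n x)) hA₂.le))
  · have := ((summable_geomConv hr0.le hs0 hE0 hg0.le hgr
      (((sW.add sN).mul_left A₂).congr fun n => by ring)).mul_left B).mul_left (Real.exp (2 * K))
    exact this.congr fun n => by ring

end IsRotationLike

namespace IsConvergentSeq

variable {ρ : ℝ} {k p q : ℕ → ℕ}

theorem lt_q_succ (h : IsConvergentSeq ρ k p q) (n : ℕ) : n < q (n + 1) := by
  induction n with
  | zero => exact h.q_pos 1
  | succ n ih =>
    have h1 := h.q_pos n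
    have h2 : q (n + 1) ≤ k (n + 2) * q (n + 1) := Nat.le_mul_of_pos_left _ (h.one_le_k (n + 1))
    rw [h.q_rec]
    omega

theorem q_succ_le (h : IsConvergentSeq ρ k p q) (n : ℕ) : q (n + 1) ≤ k (n + 1) * q n + q n := by
  cases n with
  | zero => simp [h.q_zero, h.q_one]
  | succ n => rw [h.q_rec]; exact Nat.add_le_add_left (h.q_le_succ n) _

/-- Bounding a sequence that grows at most by `E m` at steps of length `q m`, through the Ostrowski
expansion of its index. -/
theorem le_add_sum_of_ostrowski (h : IsConvergentSeq ρ k p q) {f E : ℕ → ℝ} (hE : ∀ n, 0 ≤ E n)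
    (hf : ∀ m b r, f (r + b * q m) ≤ f r + b * E m) {I : ℕ} {s : ℝ}
    (hs : ∀ n, n < q I → f n ≤ s) {M : ℕ} (hM : I ≤ M) :
    ∀ n, n < q M → f n ≤ s + ∑ i ∈ Finset.Ico I M, (k (i + 1) : ℝ) * E i := by
  induction M, hM using Nat.le_induction with
  | base => simpa using hs
  | succ M hM ih =>
    intro n hn
    rw [Finset.sum_Ico_succ_top hM]
    have h1 := ih (n % q M) (Nat.mod_lt _ (h.q_pos M))
    have h2 := hf M (n / q M) (n % q M)
    rw [mul_comm (n / q M), Nat.mod_add_div] at h2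
    have h3 : n / q M ≤ k (M + 1) := by
      rw [← Nat.lt_succ_iff, Nat.div_lt_iff_lt_mul (h.q_pos M), Nat.succ_mul]
      exact hn.trans_le (h.q_succ_le M)
    have h4 : ((n / q M : ℕ) : ℝ) * E M ≤ k (M + 1) * E M :=
      mul_le_mul_of_nonneg_right (by exact_mod_cast h3) (hE M)
    linarith

end IsConvergentSeq

namespace SmoothLift

variable {w F F' F'' : ℝ → ℝ}

theorem abs_logDer_mul_le {m : ℕ} {D : ℝ} (hD : ∀ x, |logDer F F' m x| ≤ D) (b : ℕ) (x : ℝ) :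
    |logDer F F' (b * m) x| ≤ b * D := by
  induction b with
  | zero => simp [logDer]
  | succ b ih =>
    rw [Nat.succ_mul, logDer_add]
    push_cast
    exact (abs_add_le _ _).trans (by linarith [hD (F^[b * m] x)])

theorem logDer_eq_zero_of_integral_eq_zero (H : SmoothLift w F F' F'')
    (h : ∫ x in (0 : ℝ)..1, |F'' x / F' x| = 0) (n : ℕ) (x : ℝ) : logDer F F' n x = 0 := by
  have h0 : ∀ y ∈ Icc (0 : ℝ) 1, F'' y = 0 := by
    intro y hy
    by_contra hne
    have hc : Continuous fun x => |F'' x / F' x| :=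
      (H.continuous_deriv2.div H.continuous_deriv fun x => (H.deriv_pos x).ne').abs
    exact (intervalIntegral.integral_pos one_pos hc.continuousOn (fun _ _ => abs_nonneg _)
      ⟨y, hy, abs_pos.2 (div_ne_zero hne (H.deriv_pos y).ne')⟩).ne' h
  have h1 : ∀ y, F'' y = 0 := fun y => by
    have hp : Function.Periodic F'' 1 := H.deriv2_add_one
    have := hp.sub_zsmul_eq (x := y) ⌊y⌋
    rw [← this, zsmul_eq_mul, mul_one]
    exact h0 _ ⟨by linarith [Int.floor_le y], by linarith [Int.lt_floor_add_one y]⟩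
  have h2 : ∀ y z, F' y = F' z := fun y z =>
    is_const_of_deriv_eq_zero (fun x => (H.hasDerivAt' x).differentiableAt)
      (fun x => (H.hasDerivAt' x).deriv.trans (h1 x)) y z
  obtain ⟨z, hz⟩ := H.exists_logDer_eq_zero 1
  simp only [logDer, birkhoffSum_one] at hz
  simp only [logDer, birkhoffSum, h2 _ z, hz, Finset.sum_const_zero]

end SmoothLift

namespace IsRotationLike

variable {w F F' F'' : ℝ → ℝ} {ρ : ℝ} {k p q : ℕ → ℕ}

theorem exists_gap_add_le (H : IsRotationLike w F F' F'' ρ k p q) {C r : ℝ} {n₀ : ℕ}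
    (hr0 : 0 < r) (hr : r ^ 2 = 1 / (1 + Real.exp (-C)))
    (hC : ∀ n, n₀ ≤ n → ∀ x, |logDer F F' (q (n + 1)) x| ≤ C) :
    ∃ B : ℝ, 0 < B ∧ ∀ n d x, gap F p q (n + d) x ≤ B * r ^ d * gap F p q n x := by
  obtain ⟨K, hK0, hK⟩ := H.exists_log_lipschitz
  have hr1 : r ≤ 1 := by
    refine (sq_le_one_iff₀ hr0.le).1 ?_
    rw [hr, div_le_one (by positivity)]
    linarith [Real.exp_pos (-C)]
  obtain ⟨B, hB, h⟩ := exists_le_mul_pow_of_two_step (Real.one_le_exp (by positivity : 0 ≤ 2 * K))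
    hr0 hr1 n₀
  refine ⟨B, hB, fun n d x => h (fun n => gap F p q n x) (fun n => H.gap_pos n x)
    (fun n => H.gap_succ_le (fun y => H.abs_logDer_le hK0.le hK _ y) x) (fun n hn => ?_) n d⟩
  rw [hr]
  exact H.gap_add_two_le (hC n hn) x

theorem exists_summable_bound_exponent (H : IsRotationLike w F F' F'' ρ k p q) {b lam : ℝ}
    (hb0 : 0 < b) (hb1 : b < 1)
    (hint : MeasureTheory.IntegrableOn (fun y : ℝ => w y / y ^ (1 + b)) (Ioc 0 1))
    (hlam : lam = 1 / Real.sqrt (1 + Real.exp (-(∫ x in (0 : ℝ)..1, |F'' x / F' x|)))) :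
    ∃ D : ℕ → ℝ, (∀ n x, |logDer F F' (q n) x| ≤ D n) ∧
      Summable fun n => (lam ^ (-b)) ^ n * D n := by
  set C := ∫ x in (0 : ℝ)..1, |F'' x / F' x| with hC
  have root : ∀ C : ℝ, 0 < 1 / Real.sqrt (1 + Real.exp (-C)) ∧
      1 / Real.sqrt (1 + Real.exp (-C)) < 1 ∧
      (1 / Real.sqrt (1 + Real.exp (-C))) ^ 2 = 1 / (1 + Real.exp (-C)) := by
    intro C
    have h := Real.exp_pos (-C)
    refine ⟨by positivity, ?_, by rw [div_pow, one_pow, Real.sq_sqrt (by positivity)]⟩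
    rw [div_lt_one (by positivity)]
    exact Real.lt_sqrt_of_sq_lt (by linarith)
  have phase : ∀ C n₀, (∀ n, n₀ ≤ n → ∀ x, |logDer F F' (q (n + 1)) x| ≤ C) →
      ∃ D : ℕ → ℝ, (∀ n x, |logDer F F' (q n) x| ≤ D n) ∧
        Summable fun n => ((1 / Real.sqrt (1 + Real.exp (-C))) ^ (-b)) ^ n * D n := by
    intro C n₀ h
    obtain ⟨h0, h1, h2⟩ := root C
    obtain ⟨B, hB, hg⟩ := H.exists_gap_add_le h0 h2 h
    exact H.exists_summable_bound hb0 hb1 hint h0 h1 hB hg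
  suffices ∃ n₀, ∀ n, n₀ ≤ n → ∀ x, |logDer F F' (q (n + 1)) x| ≤ C by
    obtain ⟨n₀, h⟩ := this
    rw [hlam]
    exact phase C n₀ h
  have hC0 : 0 ≤ C :=
    intervalIntegral.integral_nonneg zero_le_one fun _ _ => abs_nonneg _
  rcases hC0.eq_or_lt with h | h
  · refine ⟨0, fun n _ x => ?_⟩
    rw [H.logDer_eq_zero_of_integral_eq_zero (hC.symm.trans h.symm), abs_zero]
    exact hC0
  · obtain ⟨K, hK0, hK⟩ := H.exists_log_lipschitz
    obtain ⟨D, hD, hs⟩ := phase (2 * K) 0 fun n _ x => H.abs_logDer_le hK0.le hK _ x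
    obtain ⟨r0, r1, -⟩ := root (2 * K)
    have hg := Real.one_le_rpow_of_pos_of_le_one_of_nonpos r0 r1.le (by linarith : -b ≤ 0)
    have hD0 : ∀ n, 0 ≤ D n := fun n => (abs_nonneg _).trans (hD n 0)
    have hlim : Tendsto D atTop (𝓝 0) :=
      squeeze_zero hD0 (fun n => le_mul_of_one_le_left (hD0 n) (one_le_pow₀ hg))
        hs.tendsto_atTop_zero
    obtain ⟨n₀, hn⟩ := eventually_atTop.1 (hlim.eventually_lt_const h)
    exact ⟨n₀, fun n hn' x => (hD _ x).trans (hn (n + 1) (by omega)).le⟩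

theorem exists_continuous_cocycle (H : IsRotationLike w F F' F'' ρ k p q) {D : ℕ → ℝ}
    (hD : ∀ n x, |logDer F F' (q n) x| ≤ D n) (hs : Summable fun n => (k (n + 1) : ℝ) * D n) :
    ∃ h : ℝ → ℝ, Continuous h ∧ (∀ x, h (x + 1) = h x) ∧
      ∀ x, h (F x) = h x - Real.log (F' x) := by
  have hD0 : ∀ n, 0 ≤ D n := fun n => (abs_nonneg _).trans (hD n 0)
  set e : ℕ → ℝ := fun n => (k (n + 1) : ℝ) * D n with he
  have he0 : ∀ n, 0 ≤ e n := fun n => mul_nonneg (Nat.cast_nonneg _) (hD0 n)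
  have hlt : ∀ n, n < q (n + 1 + 1) := fun n => n.lt_succ_self.trans (H.lt_q_succ (n + 1))
  have hsum : ∀ I M, ∑ i ∈ Finset.Ico I M, e i ≤ ∑' i, e (i + I) := by
    intro I M
    rw [Finset.sum_Ico_eq_sum_range]
    simp only [add_comm I]
    exact ((summable_nat_add_iff I).2 hs).sum_le_tsum _ fun i _ => he0 _
  have hmul := fun m b x => SmoothLift.abs_logDer_mul_le (hD m) b x
  have bdd : ∀ x n, |logDer F F' n x| ≤ ∑' i, e i := by
    intro x n
    have h1 := H.le_add_sum_of_ostrowski (f := fun n => |logDer F F' n x|) (E := D) hD0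
      (fun m b r => by
        rw [SmoothLift.logDer_add]
        exact (abs_add_le _ _).trans (add_le_add le_rfl (hmul m b _)))
      (I := 0) (s := 0) (fun n hn => by
        rw [H.q_zero, Nat.lt_one_iff] at hn
        simp [hn, logDer]) (Nat.zero_le (n + 2)) n (hlt n)
    have h2 := hsum 0 (n + 2)
    simp only [add_zero, zero_add] at h1 h2
    exact h1.trans h2
  have equi : ∀ x, ∀ ε > 0, ∀ᶠ y in 𝓝 x, ∀ n, |logDer F F' n y - logDer F F' n x| ≤ ε := by
    intro x ε hε
    have ht : Tendsto (fun I => ∑' i, e (i + I)) atTop (𝓝 0) := tendsto_sum_nat_add e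
    obtain ⟨I, hI⟩ := (ht.eventually_lt_const (show (0 : ℝ) < ε / 4 by positivity)).exists
    have hfin : ∀ᶠ y in 𝓝 x, ∀ n ∈ Finset.range (q I),
        |logDer F F' n y - logDer F F' n x| < ε / 2 := by
      refine (Finset.eventually_all _).2 fun n _ => ?_
      exact (Metric.tendsto_nhds.1 ((H.continuous_logDer n).tendsto x)) (ε / 2) (by positivity)
    filter_upwards [hfin] with y hy n
    have h1 := H.le_add_sum_of_ostrowski
      (f := fun n => |logDer F F' n y - logDer F F' n x|) (E := fun n => 2 * D n)
      (fun n => mul_nonneg zero_le_two (hD0 n))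
      (fun m b r => by
        rw [SmoothLift.logDer_add, SmoothLift.logDer_add, add_sub_add_comm]
        have a1 := hmul m b (F^[r] y)
        have a2 := hmul m b (F^[r] x)
        have a3 := abs_sub (logDer F F' (b * q m) (F^[r] y)) (logDer F F' (b * q m) (F^[r] x))
        exact (abs_add_le _ _).trans (add_le_add le_rfl (by linarith)))
      (I := I) (s := ε / 2) (fun n hn => (hy n (Finset.mem_range.2 hn)).le)
      (le_max_right (n + 2) I) n ((hlt n).trans_le
        (monotone_nat_of_le_succ H.q_le_succ (le_max_left (n + 2) I)))
    have h2 := hsum I (max (n + 2) I)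
    have h3 : ∑ i ∈ Finset.Ico I (max (n + 2) I), (k (i + 1) : ℝ) * (2 * D i)
        = 2 * ∑ i ∈ Finset.Ico I (max (n + 2) I), e i := by
      rw [Finset.mul_sum]
      exact Finset.sum_congr rfl fun i _ => by simp only [he]; ring
    rw [h3] at h1
    linarith
  have hb : ∀ x, atTop.IsBoundedUnder (· ≤ ·) fun n => logDer F F' n x := fun x =>
    isBoundedUnder_of ⟨_, fun n => (abs_le.1 (bdd x n)).2⟩
  have hcb : ∀ x, atTop.IsCoboundedUnder (· ≤ ·) fun n => logDer F F' n x := fun x =>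
    (isBoundedUnder_of ⟨_, fun n => (abs_le.1 (bdd x n)).1⟩ :
      atTop.IsBoundedUnder (· ≥ ·) fun n => logDer F F' n x).isCoboundedUnder_le
  set h : ℝ → ℝ := fun x => limsup (fun n => logDer F F' n x) atTop with hh
  have hle : ∀ x y ε, (∀ n, logDer F F' n x ≤ ε + logDer F F' n y) → h x ≤ ε + h y := by
    intro x y ε hn
    rw [hh, ← limsup_const_add atTop _ ε (hb y) (hcb y)]
    refine limsup_le_limsup (Eventually.of_forall hn) (hcb x) ?_
    exact isBoundedUnder_of ⟨_, fun n => add_le_add le_rfl (abs_le.1 (bdd y n)).2⟩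
  refine ⟨h, ?_, fun x => ?_, fun x => ?_⟩
  · refine continuous_iff_continuousAt.2 fun x => Metric.tendsto_nhds.2 fun ε hε => ?_
    filter_upwards [equi x (ε / 2) (by positivity)] with y hy
    have h1 := hle y x (ε / 2) fun n => by linarith [(abs_le.1 (hy n)).2]
    have h2 := hle x y (ε / 2) fun n => by linarith [(abs_le.1 (hy n)).1]
    rw [Real.dist_eq, abs_lt]
    constructor <;> linarith
  · simp only [hh, H.logDer_add_one]
  · have h1 : h x = limsup (fun n => Real.log (F' x) + logDer F F' n (F x)) atTop := by
      rw [hh]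
      simp only
      rw [← limsup_nat_add _ 1]
      refine limsup_congr (Eventually.of_forall fun n => ?_)
      rw [add_comm n 1, SmoothLift.logDer_add]
      simp [logDer]
    rw [h1, limsup_const_add atTop _ _ (hb _) (hcb _)]
    simp only [hh]
    ring

theorem exists_conjugacy (H : IsRotationLike w F F' F'' ρ k p q) {h : ℝ → ℝ} (hc : Continuous h)
    (h1 : ∀ x, h (x + 1) = h x) (hF : ∀ x, h (F x) = h x - Real.log (F' x)) :
    ∃ Φ Φ' : ℝ → ℝ, Continuous Φ' ∧ (∀ x, 0 < Φ' x) ∧ (∀ x, HasDerivAt Φ (Φ' x) x) ∧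
      (∀ x, Φ (x + 1) = Φ x + 1) ∧ ∀ x, Φ (F x) = Φ x + ρ := by
  have hce : Continuous fun x => Real.exp (h x) := Real.continuous_exp.comp hc
  set J := ∫ x in (0 : ℝ)..1, Real.exp (h x) with hJ
  have hJ0 : 0 < J := intervalIntegral.integral_pos one_pos hce.continuousOn
    (fun _ _ => (Real.exp_pos _).le) ⟨0, by simp, Real.exp_pos _⟩
  set Φ' : ℝ → ℝ := fun x => Real.exp (h x) / J with hΦ'
  have hc' : Continuous Φ' := hce.div_const J
  have hper : Function.Periodic Φ' 1 := fun x => by simp only [hΦ', h1]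
  set Φ : ℝ → ℝ := fun x => ∫ y in (0 : ℝ)..x, Φ' y with hΦ
  have hd : ∀ x, HasDerivAt Φ (Φ' x) x := fun x =>
    intervalIntegral.integral_hasDerivAt_right (hc'.intervalIntegrable _ _)
      (hc'.stronglyMeasurableAtFilter _ _) hc'.continuousAt
  have hone : ∀ x, Φ (x + 1) = Φ x + 1 := by
    intro x
    have e1 := intervalIntegral.integral_add_adjacent_intervals
      (hc'.intervalIntegrable (μ := MeasureTheory.volume) 0 x) (hc'.intervalIntegrable x (x + 1))
    have e2 := hper.intervalIntegral_add_eq x 0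
    rw [zero_add] at e2
    have e3 : ∫ y in (0 : ℝ)..1, Φ' y = 1 := by
      simp only [hΦ', intervalIntegral.integral_div]
      exact div_self hJ0.ne'
    simp only [hΦ]
    rw [← e1, e2, e3]
  obtain ⟨κ, hκ⟩ : ∃ κ, ∀ x, Φ (F x) = Φ x + κ := by
    refine ⟨Φ (F 0) - Φ 0, fun x => ?_⟩
    have hz : ∀ x, HasDerivAt (fun x => Φ (F x) - Φ x) 0 x := fun x => by
      have e := ((hd (F x)).comp x (H.hasDerivAt x)).sub (hd x)
      have e0 : Φ' (F x) * F' x - Φ' x = 0 := by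
        simp only [hΦ', hF, Real.exp_sub, Real.exp_log (H.deriv_pos x)]
        field_simp [(H.deriv_pos x).ne']
        ring
      rwa [e0] at e
    have := is_const_of_deriv_eq_zero (fun x => (hz x).differentiableAt)
      (fun x => (hz x).deriv) x 0
    linarith
  have hit : ∀ n : ℕ, ∀ x, Φ (F^[n] x) = Φ x + n * κ := by
    intro n x
    induction n with
    | zero => simp
    | succ n ih => rw [Function.iterate_succ_apply', hκ, ih]; push_cast; ring
  have hcΦ : Continuous Φ := continuous_iff_continuousAt.2 fun x => (hd x).continuousAt
  obtain ⟨M, hM⟩ : ∃ M, ∀ x, |Φ x - x| ≤ M := by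
    obtain ⟨v, -, hv⟩ := isCompact_Icc.exists_isMaxOn (nonempty_Icc.2 zero_le_one)
      ((hcΦ.sub continuous_id).abs.continuousOn (s := Icc (0 : ℝ) 1))
    refine ⟨|Φ v - v|, fun x => ?_⟩
    have hp : Function.Periodic (fun x => |Φ x - x|) 1 := fun x => by
      simp only [hone]; congr 1; ring
    obtain ⟨y, hy, e⟩ := hp.exists_mem_Ico₀ one_pos x
    rw [e]; exact hv (Ico_subset_Icc_self hy)
  have hlim : Tendsto (fun n : ℕ => (F^[n] 0 - 0) / (n : ℝ) - κ) atTop (𝓝 0) := by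
    refine squeeze_zero_norm' ?_ (tendsto_const_div_atTop_nhds_zero_nat (2 * M))
    filter_upwards [eventually_gt_atTop 0] with n hn
    have hn' : (0 : ℝ) < n := by exact_mod_cast hn
    have e : (F^[n] 0 - 0) / (n : ℝ) - κ = (F^[n] 0 - 0 - n * κ) / n := by field_simp
    rw [e, Real.norm_eq_abs, abs_div, abs_of_pos hn']
    gcongr
    have a1 := abs_le.1 (hM (F^[n] 0))
    have a2 := abs_le.1 (hM 0)
    have a3 := hit n 0
    rw [abs_le]
    constructor <;> linarith
  have hκρ : κ = ρ := by
    have := tendsto_nhds_unique hlim ((H.rotation 0).sub_const κ)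
    linarith
  exact ⟨Φ, Φ', hc', fun x => div_pos (Real.exp_pos _) hJ0, hd, hone, hκρ ▸ hκ⟩

end IsRotationLike

end CircleConjugacy

/-- Exponential-type rotation numbers: fix `0 < b < 1` and set `a = λ^{−b}`.
If `k_{n+1} ≤ c aⁿ` and `∫₀¹ ϖ(y)/y^{1+b} dy < ∞`, then the `C_{2,ϖ}`
diffeomorphism `T` admits a `C¹` conjugacy to `R_ρ`. -/
theorem C1_conjugacy_exponential_type
    (w : ℝ → ℝ) (hw : IsModulus w)
    (F F' F'' : ℝ → ℝ) (hF : StrictMono F) (hFp : ∀ x, F (x + 1) = F x + 1)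
    (hF' : ∀ x, HasDerivAt F (F' x) x) (hF'' : ∀ x, HasDerivAt F' (F'' x) x)
    (hF'pos : ∀ x, 0 < F' x)
    (hmod : ∀ x y : ℝ, x ≠ y → |F'' x - F'' y| ≤ w |x - y|)
    (ρ : ℝ) (hρ : ρ ∈ Set.Ioo (0:ℝ) 1) (hirr : Irrational ρ)
    (hrot : ∀ x : ℝ,
      Filter.Tendsto (fun n : ℕ => (F^[n] x - x) / (n : ℝ)) Filter.atTop (nhds ρ))
    (k p q : ℕ → ℕ) (hk : ∀ n, 1 ≤ k (n + 1))
    (hp0 : p 0 = 0) (hp1 : p 1 = 1) (hq0 : q 0 = 1) (hq1 : q 1 = k 1)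
    (hprec : ∀ n, p (n + 2) = k (n + 2) * p (n + 1) + p n)
    (hqrec : ∀ n, q (n + 2) = k (n + 2) * q (n + 1) + q n)
    (hconv : Filter.Tendsto (fun n => (p n : ℝ) / (q n : ℝ)) Filter.atTop (nhds ρ))
    (lam : ℝ)
    (hlam : lam = 1 / Real.sqrt (1 + Real.exp (-(∫ x in (0:ℝ)..1, |F'' x / F' x|))))
    (b : ℝ) (hb0 : 0 < b) (hb1 : b < 1)
    (a : ℝ) (ha : a = lam ^ (-b))
    (c : ℝ) (hc : 0 < c) (hka : ∀ n : ℕ, (k (n + 1) : ℝ) ≤ c * a ^ (n : ℕ))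
    (hint : MeasureTheory.IntegrableOn
      (fun y : ℝ => w y / y ^ (1 + b)) (Set.Ioc 0 1)) :
    ∃ Φ Φ' : ℝ → ℝ, Continuous Φ' ∧ (∀ x, 0 < Φ' x) ∧
      (∀ x, HasDerivAt Φ (Φ' x) x) ∧
      (∀ x, Φ (x + 1) = Φ x + 1) ∧
      (∀ x, Φ (F x) = Φ x + ρ) := by
  have H : CircleConjugacy.IsRotationLike w F F' F'' ρ k p q :=
    { modulus := hw, strictMono := hF, add_one := hFp, hasDerivAt := hF', hasDerivAt' := hF''
      deriv_pos := hF'pos, abs_sub_le_modulus := hmod, irrational := hirr, one_le_k := hk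
      p_zero := hp0, p_one := hp1, q_zero := hq0, q_one := hq1, p_rec := hprec, q_rec := hqrec
      tendsto := hconv, rotation := hrot }
  obtain ⟨D, hD, hs⟩ := H.exists_summable_bound_exponent hb0 hb1 hint hlam
  have hD0 : ∀ n, 0 ≤ D n := fun n => (abs_nonneg _).trans (hD n 0)
  obtain ⟨h, hc, h1, hcocycle⟩ := H.exists_continuous_cocycle hD
    (Summable.of_nonneg_of_le (fun n => mul_nonneg (Nat.cast_nonneg _) (hD0 n))
      (fun n => by
        have := mul_le_mul_of_nonneg_right (hka n) (hD0 n)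
        rwa [ha, mul_assoc] at this) (hs.mul_left c))
  exact H.exists_conjugacy hc h1 hcocycle
end

section
/- (Higher regularity) Let ϖ be a modulus of continuity, φ : [0,∞) → (0,∞) nondecreasing and continuous, and let T be a C_{2,ϖ} orientation-preserving circle diffeomorphism with irrational rotation number ρ = [k₁,k₂,…] satisfying k_{n+1} ≤ c·φ(n) for some c > 0 and all n, and such that ∫₀¹ (∫₀^y φ(log_λ x) dx) · ϖ(y)/y² dy < +∞, where λ = 1/√(1 + e^{−𝒞}), 𝒞 = ∫₀¹ |F″(x)/F′(x)| dx. Define R(t) := ∫₀^{λ^t} φ(log_λ x) (∫ₓ¹ ϖ(y)/y² dy) dx for t ≥ 1, let Δ : [1,∞) → (0,1] be a continuous strictly decreasing function with Δ(n) = Δₙ = |qₙρ − pₙ| for every integer n ≥ 1, and let Δ⁻¹ be its inverse. If ϖ̃ := R ∘ Δ⁻¹ is a modulus of continuity, then the C¹ conjugacy Φ of T to R_ρ satisfies: there is a constant C > 0 such that |Φ′(x) − Φ′(y)| ≤ C ϖ̃(|x − y|) for all x, y ∈ ℝ with 0 < |x − y| ≤ 1; that is, Φ is of class C_{1,ϖ̃}.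 -/
section

open Real

theorem IsModulus.mono {w : ℝ → ℝ} (hw : IsModulus w) {x y : ℝ} (hx : 0 < x) (hxy : x ≤ y) :
    w x ≤ w y :=
  hw.strictMono.monotoneOn hx (hx.trans_le hxy) hxy

theorem IsModulus.nat_mul_le {w : ℝ → ℝ} (hw : IsModulus w) {x : ℝ} (hx : 0 < x) (n : ℕ) :
    w ((n + 1) * x) ≤ (n + 1) * w x := by
  induction n with
  | zero => simp
  | succ n ih =>
    have h := hw.subadd ((n + 1) * x) x (by positivity) hx
    push_cast
    calc w ((n + 1 + 1) * x) = w ((n + 1) * x + x) := by ring_nf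
      _ ≤ _ := by linarith

theorem IsModulus.mul_le {w : ℝ → ℝ} (hw : IsModulus w) {x K : ℝ} (hx : 0 < x) (hK : 0 < K) :
    w (K * x) ≤ (K + 1) * w x := by
  have h1 : K ≤ (⌊K⌋₊ : ℝ) + 1 := (Nat.lt_floor_add_one K).le
  have h2 : (⌊K⌋₊ : ℝ) ≤ K := Nat.floor_le hK.le
  calc w (K * x) ≤ w ((⌊K⌋₊ + 1) * x) := hw.mono (by positivity) (by gcongr)
    _ ≤ (⌊K⌋₊ + 1) * w x := hw.nat_mul_le hx _
    _ ≤ _ := by have := hw.pos x hx; gcongr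

/-- A modulus dominates a multiple of the identity on bounded intervals. -/
theorem IsModulus.id_le {w : ℝ → ℝ} (hw : IsModulus w) {x : ℝ} (hx : 0 < x) (hx1 : x ≤ 1) :
    x ≤ 2 / w 1 * w x := by
  have h := hw.mul_le hx (inv_pos.2 hx)
  rw [inv_mul_cancel₀ hx.ne'] at h
  have h1 := hw.pos 1 one_pos
  have h2 := hw.pos x hx
  have h3 : 1 ≤ x⁻¹ := (one_le_inv₀ hx).2 hx1
  rw [div_mul_eq_mul_div, le_div_iff₀ h1]
  have h4 : w 1 ≤ 2 * x⁻¹ * w x := h.trans (by gcongr; linarith)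
  calc x * w 1 ≤ x * (2 * x⁻¹ * w x) := by gcongr
    _ = 2 * w x := by field_simp

theorem abs_log_sub_log_le {a b m : ℝ} (hm : 0 < m) (ha : m ≤ a) (hb : m ≤ b) :
    |log a - log b| ≤ |a - b| / m := by
  have key : ∀ {a b : ℝ}, m ≤ a → m ≤ b → log a - log b ≤ |a - b| / m := by
    intro a b ha hb
    have ha0 := hm.trans_le ha
    have hb0 := hm.trans_le hb
    rw [← log_div ha0.ne' hb0.ne']
    calc log (a / b) ≤ a / b - 1 := log_le_sub_one_of_pos (by positivity)
      _ = (a - b) / b := by field_simp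
      _ ≤ |a - b| / b := by gcongr; exact le_abs_self _
      _ ≤ |a - b| / m := by gcongr
  rw [abs_le]
  refine ⟨?_, key ha hb⟩
  have := key hb ha
  rw [abs_sub_comm] at this
  linarith

/-- Trapezoidal rule with remainder controlled by the modulus of the second derivative. -/
theorem abs_trapezoid_le {w F F' F'' : ℝ → ℝ} (hw : IsModulus w)
    (hF' : ∀ x, HasDerivAt F (F' x) x) (hF'' : ∀ x, HasDerivAt F' (F'' x) x)
    (hmod : ∀ x y : ℝ, x ≠ y → |F'' x - F'' y| ≤ w |x - y|) {x y : ℝ} (hxy : x < y) :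
    |F y - F x - (y - x) * ((F' x + F' y) / 2)| ≤ (y - x) ^ 2 / 2 * w (y - x) := by
  set G : ℝ → ℝ := fun t => F t - F x - (t - x) * ((F' x + F' t) / 2) with hG
  have hGd : ∀ t, HasDerivAt G (F' t - (1 * ((F' x + F' t) / 2) + (t - x) * (F'' t / 2))) t := by
    intro t
    have h1 := (hF' t).sub_const (F x)
    have h2 := (hasDerivAt_id t).sub_const x
    have h3 := ((hF'' t).const_add (F' x)).div_const 2
    exact h1.sub (h2.mul h3)
  obtain ⟨t, ht, hteq⟩ := exists_hasDerivAt_eq_slope G _ hxy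
    (fun t _ => (hGd t).continuousAt.continuousWithinAt) (fun t _ => hGd t)
  obtain ⟨s, hs, hseq⟩ := exists_hasDerivAt_eq_slope F' F'' ht.1
    (fun t _ => (hF'' t).continuousAt.continuousWithinAt) (fun t _ => hF'' t)
  have hd : 0 < y - x := sub_pos.2 hxy
  have ht0 : 0 < t - x := sub_pos.2 ht.1
  have hGx : G x = 0 := by simp [hG]
  rw [hGx, sub_zero, eq_div_iff hd.ne'] at hteq
  rw [eq_div_iff ht0.ne'] at hseq
  have hval : G y = (y - x) * ((t - x) / 2 * (F'' s - F'' t)) := by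
    rw [← hteq]; linear_combination (-(y - x) / 2) * hseq
  have hb : |F'' s - F'' t| ≤ w (y - x) := by
    refine (hmod s t hs.2.ne).trans (hw.mono (abs_pos.2 (sub_ne_zero.2 hs.2.ne)) ?_)
    rw [abs_le]; constructor <;> linarith [hs.1, hs.2, ht.1, ht.2]
  change |G y| ≤ _
  rw [hval, abs_mul, abs_mul, abs_of_pos hd, abs_of_pos (by positivity : 0 < (t - x) / 2)]
  have hwp := hw.pos _ hd
  calc (y - x) * ((t - x) / 2 * |F'' s - F'' t|)
      ≤ (y - x) * ((y - x) / 2 * w (y - x)) := by gcongr; linarith [ht.2]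
    _ = _ := by ring

theorem abs_log_sub_log_mean_le {A u v m : ℝ} (hm : 0 < m) (hA : m ≤ A) (hu : m ≤ u)
    (hv : m ≤ v) :
    |log A - (log u + log v) / 2| ≤ |A - (u + v) / 2| / m + (u - v) ^ 2 / (8 * m ^ 2) := by
  have hu0 := hm.trans_le hu
  have hv0 := hm.trans_le hv
  have h1 := abs_log_sub_log_le hm hA (show m ≤ (u + v) / 2 by linarith)
  have hquot : ((u + v) / 2) ^ 2 / (u * v) = 1 + (u - v) ^ 2 / (4 * (u * v)) := by
    field_simp; ring
  have h2 : log ((u + v) / 2) - (log u + log v) / 2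
      = log (1 + (u - v) ^ 2 / (4 * (u * v))) / 2 := by
    have hp : ((u + v) / 2) ^ 2 ≠ 0 := by positivity
    rw [← hquot, log_div hp (by positivity), log_pow, log_mul hu0.ne' hv0.ne']
    push_cast; ring
  have h3 : 0 ≤ log (1 + (u - v) ^ 2 / (4 * (u * v))) := by
    apply log_nonneg; have : 0 ≤ (u - v) ^ 2 / (4 * (u * v)) := by positivity
    linarith
  have h4 : log (1 + (u - v) ^ 2 / (4 * (u * v))) ≤ (u - v) ^ 2 / (4 * m ^ 2) := by
    have hpos : 0 < 1 + (u - v) ^ 2 / (4 * (u * v)) := by positivity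
    have := log_le_sub_one_of_pos hpos
    have h5 : (u - v) ^ 2 / (4 * (u * v)) ≤ (u - v) ^ 2 / (4 * m ^ 2) := by
      have : m ^ 2 ≤ u * v := by nlinarith
      gcongr
    linarith
  have h6 : (u - v) ^ 2 / (8 * m ^ 2) = (u - v) ^ 2 / (4 * m ^ 2) / 2 := by
    field_simp; ring
  rw [h6]
  rw [abs_le] at h1 ⊢
  constructor <;> linarith [h1.1, h1.2]

/-- One-step distortion estimate for a circle diffeomorphism of class `C_{2,w}`. -/
theorem exists_abs_log_slope_sub_le {w F F' F'' : ℝ → ℝ} (hw : IsModulus w)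
    (hF' : ∀ x, HasDerivAt F (F' x) x) (hF'' : ∀ x, HasDerivAt F' (F'' x) x)
    (hmod : ∀ x y : ℝ, x ≠ y → |F'' x - F'' y| ≤ w |x - y|) {m : ℝ} (hm : 0 < m)
    (hmF : ∀ x, m ≤ F' x) {B : ℝ} (hB : ∀ x, |F'' x| ≤ B) :
    ∃ K > 0, ∀ x y : ℝ, x < y → y - x ≤ 1 →
      |log ((F y - F x) / (y - x)) - (log (F' x) + log (F' y)) / 2|
        ≤ K * ((y - x) * w (y - x)) := by
  have hw1 := hw.pos 1 one_pos
  refine ⟨1 / (2 * m) + B ^ 2 * (2 / w 1) / (8 * m ^ 2), by positivity, fun x y hxy hle => ?_⟩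
  have hd : 0 < y - x := sub_pos.2 hxy
  have hwd := hw.pos _ hd
  have htr := abs_trapezoid_le hw hF' hF'' hmod hxy
  obtain ⟨s, hs, hseq⟩ := exists_hasDerivAt_eq_slope F F' hxy
    (fun t _ => (hF' t).continuousAt.continuousWithinAt) (fun t _ => hF' t)
  obtain ⟨t, ht, hteq⟩ := exists_hasDerivAt_eq_slope F' F'' hxy
    (fun t _ => (hF'' t).continuousAt.continuousWithinAt) (fun t _ => hF'' t)
  have hA : m ≤ (F y - F x) / (y - x) := by rw [← hseq]; exact hmF s
  refine (abs_log_sub_log_mean_le hm hA (hmF x) (hmF y)).trans ?_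
  have e1 : |(F y - F x) / (y - x) - (F' x + F' y) / 2| ≤ (y - x) / 2 * w (y - x) := by
    have : (F y - F x) / (y - x) - (F' x + F' y) / 2
        = (F y - F x - (y - x) * ((F' x + F' y) / 2)) / (y - x) := by field_simp
    rw [this, abs_div, abs_of_pos hd, div_le_iff₀ hd]
    calc _ ≤ _ := htr
      _ = _ := by ring
  have e2 : (F' x - F' y) ^ 2 ≤ B ^ 2 * (2 / w 1) * ((y - x) * w (y - x)) := by
    rw [eq_div_iff hd.ne'] at hteq
    have hB2 : F'' t ^ 2 ≤ B ^ 2 := sq_le_sq' (abs_le.1 (hB t)).1 (abs_le.1 (hB t)).2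
    calc (F' x - F' y) ^ 2 = F'' t ^ 2 * ((y - x) * (y - x)) := by
          have : F' y - F' x = F'' t * (y - x) := hteq.symm
          calc (F' x - F' y) ^ 2 = (F' y - F' x) ^ 2 := by ring
            _ = _ := by rw [this]; ring
      _ ≤ B ^ 2 * ((y - x) * (2 / w 1 * w (y - x))) := by
          gcongr; exact hw.id_le hd hle
      _ = _ := by ring
  calc _ ≤ (y - x) / 2 * w (y - x) / m
        + B ^ 2 * (2 / w 1) * ((y - x) * w (y - x)) / (8 * m ^ 2) := by gcongr
    _ = _ := by field_simp

/-- Convolution of a sequence with the geometric sequence of ratio `μ`. -/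
noncomputable def geomConv (μ : ℝ) (u : ℕ → ℝ) (n : ℕ) : ℝ :=
  ∑ j ∈ Finset.range (n + 1), μ ^ (n - j) * u j

theorem geomConv_zero (μ : ℝ) (u : ℕ → ℝ) : geomConv μ u 0 = u 0 := by
  simp [geomConv]

theorem geomConv_succ (μ : ℝ) (u : ℕ → ℝ) (n : ℕ) :
    geomConv μ u (n + 1) = μ * geomConv μ u n + u (n + 1) := by
  unfold geomConv
  rw [Finset.sum_range_succ _ (n + 1), Finset.mul_sum]
  congr 1
  · refine Finset.sum_congr rfl fun j hj => ?_
    rw [Nat.succ_sub (Nat.lt_succ_iff.1 (Finset.mem_range.1 hj)), pow_succ]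
    ring
  · simp

theorem geomConv_pos {μ : ℝ} (hμ : 0 < μ) {u : ℕ → ℝ} (hu : ∀ n, 0 < u n) (n : ℕ) :
    0 < geomConv μ u n :=
  Finset.sum_pos (fun _ _ => mul_pos (pow_pos hμ _) (hu _)) ⟨0, by simp⟩

theorem le_geomConv {μ : ℝ} (hμ : 0 < μ) {u : ℕ → ℝ} (hu : ∀ n, 0 < u n) (n : ℕ) :
    u n ≤ geomConv μ u n := by
  cases n with
  | zero => rw [geomConv_zero]
  | succ n =>
    rw [geomConv_succ]
    have := mul_pos hμ (geomConv_pos hμ hu n)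
    linarith

theorem pow_mul_le_geomConv {μ : ℝ} (hμ : 0 < μ) {u : ℕ → ℝ} (hu : ∀ n, 0 < u n) (n : ℕ) :
    μ ^ n * u 0 ≤ geomConv μ u n := by
  induction n with
  | zero => simp [geomConv_zero]
  | succ n ih =>
    rw [geomConv_succ, pow_succ]
    have := hu (n + 1)
    nlinarith

theorem geomConv_geomConv_add_le {lam : ℝ} (hlam : 7 / 10 ≤ lam) {u : ℕ → ℝ}
    (hu : ∀ n, 0 < u n) (n : ℕ) :
    geomConv lam (geomConv (3 / 5) u) n + 6 * geomConv (3 / 5) u n ≤ 7 * geomConv lam u n := by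
  induction n with
  | zero => simp only [geomConv_zero]; linarith
  | succ n ih =>
    have h := geomConv_pos (μ := 3 / 5) (by norm_num) hu n
    simp only [geomConv_succ]
    nlinarith

theorem abs_exp_sub_exp_le {a b M : ℝ} (ha : a ≤ M) (hb : b ≤ M) :
    |exp a - exp b| ≤ exp M * |a - b| := by
  have key : ∀ {a b : ℝ}, a ≤ M → exp a - exp b ≤ exp M * |a - b| := by
    intro a b ha
    have h1 : exp a - exp b = exp a * (1 - exp (b - a)) := by
      rw [mul_sub, ← exp_add]; ring_nf
    have h2 := add_one_le_exp (b - a)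
    rw [h1]
    calc exp a * (1 - exp (b - a)) ≤ exp a * |a - b| := by
          gcongr; linarith [le_abs_self (a - b)]
      _ ≤ _ := by gcongr
  rw [abs_le]
  have := key (a := b) (b := a) hb
  rw [abs_sub_comm] at this
  exact ⟨by linarith, key ha⟩

theorem abs_log_convexComb_sub_log_le {A B l : ℝ} (hA : 0 < A) (hB : 0 < B) (hl : 0 ≤ l)
    (hl1 : l ≤ 1) :
    |log (l * A + (1 - l) * B) - log B| ≤ l * (exp |log A - log B| * |log A - log B|) := by
  set W := l * A + (1 - l) * B with hW
  have hmin : min A B ≤ W := by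
    rcases le_total A B with h | h
    · rw [min_eq_left h]; nlinarith
    · rw [min_eq_right h]; nlinarith
  have hm : 0 < min A B := lt_min hA hB
  have h1 := abs_log_sub_log_le hm hmin (min_le_right A B)
  have h2 : |W - B| = l * |A - B| := by
    rw [show W - B = l * (A - B) by rw [hW]; ring, abs_mul, abs_of_nonneg hl]
  have h3 : |A - B| ≤ max A B * |log A - log B| := by
    have := abs_exp_sub_exp_le (a := log A) (b := log B) (M := log (max A B))
      (log_le_log hA (le_max_left _ _)) (log_le_log hB (le_max_right _ _))
    rwa [exp_log hA, exp_log hB, exp_log (lt_max_of_lt_left hA)] at this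
  have h4 : max A B / min A B = exp |log A - log B| := by
    rcases le_total A B with h | h
    · rw [max_eq_right h, min_eq_left h, abs_of_nonpos (sub_nonpos.2 (log_le_log hA h)), neg_sub,
        exp_sub, exp_log hA, exp_log hB]
    · rw [max_eq_left h, min_eq_right h, abs_of_nonneg (sub_nonneg.2 (log_le_log hB h)),
        exp_sub, exp_log hA, exp_log hB]
  calc _ ≤ |W - B| / min A B := h1
    _ ≤ l * (max A B * |log A - log B|) / min A B := by rw [h2]; gcongr
    _ = l * (max A B / min A B * |log A - log B|) := by ring
    _ = _ := by rw [h4]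

/-- If the log-averages over two adjacent intervals and over their union are given by the
trapezoidal rule up to `e`, then the increment over the first one is a fraction of the increment
over the union. -/
theorem abs_sub_le_of_trapezoid {A B l e r S₀ S₁ S₂ : ℝ} (hA : 0 < A) (hB : 0 < B) (hl : 0 ≤ l)
    (hl1 : l ≤ 1) (h1 : |log A - (S₀ + S₁) / 2| ≤ e) (h2 : |log B - (S₁ + S₂) / 2| ≤ e)
    (h3 : |log (l * A + (1 - l) * B) - (S₀ + S₂) / 2| ≤ e)
    (hr : l * exp |log A - log B| ≤ r) :
    |S₀ - S₁| ≤ r * |S₀ - S₂| + (4 + 4 * r) * e := by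
  have h4 := abs_log_convexComb_sub_log_le hA hB hl hl1
  set W := log (l * A + (1 - l) * B)
  have hAB : |log A - log B| ≤ |S₀ - S₂| / 2 + 2 * e := by
    have : log A - log B = (log A - (S₀ + S₁) / 2) - (log B - (S₁ + S₂) / 2) + (S₀ - S₂) / 2 := by
      ring
    rw [this]
    refine (abs_add_le _ _).trans ?_
    rw [abs_div, abs_two]
    linarith [abs_sub (log A - (S₀ + S₁) / 2) (log B - (S₁ + S₂) / 2)]
  have hS : |S₀ - S₁| / 2 ≤ |W - log B| + 2 * e := by
    have : (S₀ - S₁) / 2 = (W - log B) + ((log B - (S₁ + S₂) / 2) - (W - (S₀ + S₂) / 2)) := by ring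
    rw [← abs_two (α := ℝ), ← abs_div, this]
    refine (abs_add_le _ _).trans ?_
    rw [abs_two]
    linarith [abs_sub (log B - (S₁ + S₂) / 2) (W - (S₀ + S₂) / 2)]
  have hr0 : 0 ≤ r := le_trans (by positivity) hr
  have h5 : |W - log B| ≤ r * (|S₀ - S₂| / 2 + 2 * e) := by
    calc _ ≤ l * (exp |log A - log B| * |log A - log B|) := h4
      _ = l * exp |log A - log B| * |log A - log B| := by ring
      _ ≤ _ := by gcongr
  linarith

/-- Data of a conjugacy `ψ` from rotations by the numbers `b n` (the signed closest returns) to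
iterates of a circle diffeomorphism, with `H = log ψ'`, together with the distortion estimate for
these iterates. -/
structure ConjugacyData (w ψ H : ℝ → ℝ) (b : ℕ → ℝ) (lam B K : ℝ) : Prop where
  modulus : IsModulus w
  lam_lt : lam < 1
  lam_ge : 7 / 10 ≤ lam
  half_le : 1 / 2 ≤ lam ^ 2
  deriv : ∀ x, HasDerivAt ψ (exp (H x)) x
  bound : ∀ x, |H x| ≤ B
  unif : UniformContinuous H
  b_mul_pos : ∀ n, 0 < b n * b (n + 2)
  b_half : ∀ n, |b (n + 2)| ≤ |b n| / 2
  b_le : ∀ n, |b (n + 1)| ≤ |b n|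
  b_zero : |b 0| ≤ 1
  K_pos : 0 < K
  distortion : ∀ n x y, x ≠ y → |x - y| ≤ |b n| →
    |log ((ψ (y + b (n + 1)) - ψ (x + b (n + 1))) / (ψ y - ψ x))
      - ((H (x + b (n + 1)) - H x) + (H (y + b (n + 1)) - H y)) / 2| ≤ K * w |b n|

/-- The second difference of `H` along two consecutive closest returns. -/
def secondDiff (H : ℝ → ℝ) (b : ℕ → ℝ) (n : ℕ) (x : ℝ) : ℝ :=
  (H (x + b (n + 1)) - H x) - (H (x + b n + b (n + 1)) - H (x + b n))

theorem exists_slope_eq_exp {ψ H : ℝ → ℝ} (hψ : ∀ x, HasDerivAt ψ (exp (H x)) x) {x y : ℝ}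
    (hxy : x ≠ y) : ∃ t, |t - x| ≤ |y - x| ∧ ψ y - ψ x = exp (H t) * (y - x) := by
  rcases lt_or_gt_of_ne hxy with h | h
  · obtain ⟨t, ht, hteq⟩ := exists_hasDerivAt_eq_slope ψ _ h
      (fun t _ => (hψ t).continuousAt.continuousWithinAt) (fun t _ => hψ t)
    refine ⟨t, ?_, ?_⟩
    · rw [abs_of_pos (sub_pos.2 ht.1), abs_of_pos (sub_pos.2 h)]; linarith [ht.2]
    · rw [hteq, div_mul_cancel₀ _ (sub_pos.2 h).ne']
  · obtain ⟨t, ht, hteq⟩ := exists_hasDerivAt_eq_slope ψ _ h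
      (fun t _ => (hψ t).continuousAt.continuousWithinAt) (fun t _ => hψ t)
    refine ⟨t, ?_, ?_⟩
    · rw [abs_of_neg (sub_neg.2 ht.2), abs_of_neg (sub_neg.2 h)]; linarith [ht.1]
    · rw [eq_div_iff (sub_pos.2 h).ne'] at hteq
      linarith

namespace ConjugacyData

variable {w ψ H : ℝ → ℝ} {b : ℕ → ℝ} {lam B K : ℝ}

theorem lam_pos (D : ConjugacyData w ψ H b lam B K) : 0 < lam := by linarith [D.lam_ge]

theorem B_nonneg (D : ConjugacyData w ψ H b lam B K) : 0 ≤ B := (abs_nonneg _).trans (D.bound 0)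

theorem b_ne (D : ConjugacyData w ψ H b lam B K) (n : ℕ) : b n ≠ 0 :=
  left_ne_zero_of_mul (D.b_mul_pos n).ne'

theorem abs_b_pos (D : ConjugacyData w ψ H b lam B K) (n : ℕ) : 0 < |b n| := abs_pos.2 (D.b_ne n)

theorem abs_b_add_le (D : ConjugacyData w ψ H b lam B K) (j i : ℕ) :
    |b (j + i)| ≤ 2 * lam ^ i * |b j| := by
  have hj := abs_nonneg (b j)
  induction i using Nat.twoStepInduction with
  | zero => simp; linarith
  | one =>
    rw [pow_one]
    have := D.b_le j
    have := D.lam_ge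
    nlinarith
  | more i ih _ =>
    have h1 := D.b_half (j + i)
    have h2 := D.half_le
    have h3 : 0 ≤ 2 * lam ^ i * |b j| := (abs_nonneg _).trans ih
    calc |b (j + (i + 2))| ≤ |b (j + i)| / 2 := h1
      _ ≤ 2 * lam ^ i * |b j| * (1 / 2) := by linarith
      _ ≤ 2 * lam ^ i * |b j| * lam ^ 2 := by gcongr
      _ = _ := by ring

theorem w_pow_pos (D : ConjugacyData w ψ H b lam B K) (n : ℕ) : 0 < w (lam ^ n) :=
  D.modulus.pos _ (pow_pos D.lam_pos n)

theorem w_pow_le_succ (D : ConjugacyData w ψ H b lam B K) (n : ℕ) :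
    w (lam ^ n) ≤ 3 * w (lam ^ (n + 1)) := by
  have h := D.lam_ge
  have hp := pow_pos D.lam_pos n
  calc w (lam ^ n) ≤ w (2 * lam ^ (n + 1)) := by
        refine D.modulus.mono hp ?_
        rw [pow_succ]; nlinarith
    _ ≤ (2 + 1) * w (lam ^ (n + 1)) := D.modulus.mul_le (pow_pos D.lam_pos _) two_pos
    _ = _ := by ring

theorem w_pow_succ_le (D : ConjugacyData w ψ H b lam B K) (n : ℕ) :
    w (lam ^ (n + 1)) ≤ w (lam ^ n) :=
  D.modulus.mono (pow_pos D.lam_pos _) (pow_le_pow_of_le_one D.lam_pos.le D.lam_lt.le n.le_succ)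

theorem w_abs_b_le (D : ConjugacyData w ψ H b lam B K) (n : ℕ) : w |b n| ≤ 3 * w (lam ^ n) := by
  have h := D.abs_b_add_le 0 n
  rw [zero_add] at h
  have hp := pow_pos D.lam_pos n
  have h0 := D.b_zero
  calc w |b n| ≤ w (2 * lam ^ n) := D.modulus.mono (D.abs_b_pos n) (by nlinarith)
    _ ≤ (2 + 1) * w (lam ^ n) := D.modulus.mul_le hp two_pos
    _ = _ := by ring

theorem tendsto_b (D : ConjugacyData w ψ H b lam B K) :
    Filter.Tendsto (fun n => |b n|) Filter.atTop (nhds 0) := by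
  have h1 : Filter.Tendsto (fun n => 2 * lam ^ n) Filter.atTop (nhds 0) := by
    simpa using (tendsto_pow_atTop_nhds_zero_of_lt_one D.lam_pos.le D.lam_lt).const_mul 2
  refine squeeze_zero (fun n => abs_nonneg _) (fun n => ?_) h1
  have h := D.abs_b_add_le 0 n
  rw [zero_add] at h
  have hp := pow_pos D.lam_pos n
  have h0 := D.b_zero
  nlinarith

/-- At small scales `H` oscillates little and the distortion error is small. -/
theorem eventually_small (D : ConjugacyData w ψ H b lam B K) {ε : ℝ} (hε : 0 < ε) :
    ∃ N, ∀ n, N ≤ n → (∀ x t, |t| ≤ |b n| → |H (x + t) - H x| ≤ ε) ∧ K * w |b n| ≤ ε := by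
  obtain ⟨δ, hδ, hH⟩ := Metric.uniformContinuous_iff.1 D.unif ε hε
  have h1 : ∀ᶠ n in Filter.atTop, |b n| < δ := D.tendsto_b.eventually_lt_const hδ
  have h2 : Filter.Tendsto (fun n => w |b n|) Filter.atTop (nhds 0) :=
    D.modulus.tendsto.comp (tendsto_nhdsWithin_iff.2
      ⟨D.tendsto_b, Filter.Eventually.of_forall fun n => D.abs_b_pos n⟩)
  have h3 : ∀ᶠ n in Filter.atTop, w |b n| < ε / K :=
    h2.eventually_lt_const (div_pos hε D.K_pos)
  obtain ⟨N, hN⟩ := Filter.eventually_atTop.1 (h1.and h3)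
  refine ⟨N, fun n hn => ⟨fun x t ht => ?_, ?_⟩⟩
  · have := hH (a := x + t) (b := x) (by
      rw [Real.dist_eq, add_sub_cancel_left]; exact ht.trans_lt (hN n hn).1)
    rw [Real.dist_eq] at this
    exact this.le
  · have := (lt_div_iff₀ D.K_pos).1 (hN n hn).2
    linarith

theorem slope_pos (D : ConjugacyData w ψ H b lam B K) {x y : ℝ} (hxy : x ≠ y) :
    0 < (ψ y - ψ x) / (y - x) := by
  obtain ⟨t, -, ht⟩ := exists_slope_eq_exp D.deriv hxy
  rw [ht, mul_div_cancel_right₀ _ (sub_ne_zero.2 hxy.symm)]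
  exact exp_pos _

theorem sub_ne (D : ConjugacyData w ψ H b lam B K) {x y : ℝ} (hxy : x ≠ y) : ψ y - ψ x ≠ 0 := by
  intro h
  have := D.slope_pos hxy
  simp [h] at this

theorem abs_sub_le (D : ConjugacyData w ψ H b lam B K) (x y : ℝ) :
    |ψ y - ψ x| ≤ exp B * |y - x| := by
  rcases eq_or_ne x y with rfl | hxy
  · simp
  obtain ⟨t, -, ht⟩ := exists_slope_eq_exp D.deriv hxy
  rw [ht, abs_mul, abs_exp]
  gcongr
  exact (le_abs_self _).trans (D.bound t)

theorem abs_sub_ge (D : ConjugacyData w ψ H b lam B K) (x y : ℝ) :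
    exp (-B) * |y - x| ≤ |ψ y - ψ x| := by
  rcases eq_or_ne x y with rfl | hxy
  · simp
  obtain ⟨t, -, ht⟩ := exists_slope_eq_exp D.deriv hxy
  rw [ht, abs_mul, abs_exp]
  gcongr
  exact (abs_le.1 (D.bound t)).1

/-- The average slope of a translate is positive and bounded. -/
theorem ratio_bounds (D : ConjugacyData w ψ H b lam B K) {x y : ℝ} (hxy : x ≠ y) (g : ℝ) :
    0 < (ψ (y + g) - ψ (x + g)) / (ψ y - ψ x) ∧
      |log ((ψ (y + g) - ψ (x + g)) / (ψ y - ψ x))| ≤ 2 * B := by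
  obtain ⟨t, -, ht⟩ := exists_slope_eq_exp D.deriv hxy
  obtain ⟨s, -, hs⟩ := exists_slope_eq_exp D.deriv (x := x + g) (y := y + g) (by simpa using hxy)
  have hd := sub_ne_zero.2 hxy.symm
  have h : (ψ (y + g) - ψ (x + g)) / (ψ y - ψ x) = exp (H s - H t) := by
    rw [ht, hs, exp_sub, add_sub_add_right_eq_sub, mul_div_mul_right _ _ hd]
  rw [h, log_exp]
  refine ⟨exp_pos _, ?_⟩
  linarith [abs_sub (H s) (H t), D.bound s, D.bound t]

/-- The average slope of the translation by `b (n + 1)` over `[x, x + b n]`. -/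
theorem three_points (D : ConjugacyData w ψ H b lam B K) (n : ℕ) (x : ℝ) :
    ∃ l A E W : ℝ, 0 < l ∧ l < 1 ∧ 0 < A ∧ 0 < E ∧ W = l * A + (1 - l) * E ∧
      A = (ψ (x + b (n + 2) + b (n + 1)) - ψ (x + b (n + 1))) / (ψ (x + b (n + 2)) - ψ x) ∧
      W = (ψ (x + b n + b (n + 1)) - ψ (x + b (n + 1))) / (ψ (x + b n) - ψ x) ∧
      E = (ψ (x + b n + b (n + 1)) - ψ (x + b (n + 2) + b (n + 1))) /
        (ψ (x + b n) - ψ (x + b (n + 2))) ∧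
      l = (ψ (x + b (n + 2)) - ψ x) / (ψ (x + b n) - ψ x) := by
  have hlt : |b (n + 2)| < |b n| := by linarith [D.b_half n, D.abs_b_pos n]
  have h1 : x ≠ x + b (n + 2) := by simpa using (D.b_ne (n + 2))
  have h2 : x ≠ x + b n := by simpa using (D.b_ne n)
  have h3 : x + b (n + 2) ≠ x + b n := by
    intro h
    rw [add_left_cancel h] at hlt
    exact lt_irrefl _ hlt
  have n1 := D.sub_ne h1
  have n2 := D.sub_ne h2
  have n3 := D.sub_ne h3
  have hsign : 0 < (x + b (n + 2) - x) / (x + b n - x) := by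
    rw [add_sub_cancel_left, add_sub_cancel_left]
    have := D.b_mul_pos n
    rw [mul_comm] at this
    exact div_pos_iff.2 (mul_pos_iff.1 this)
  have hsign' : 0 < (x + b n - (x + b (n + 2))) / (x + b n - x) := by
    have e : (x + b n - (x + b (n + 2))) / (x + b n - x) = 1 - b (n + 2) / b n := by
      have := D.b_ne n
      rw [add_sub_add_left_eq_sub, add_sub_cancel_left]; field_simp
    rw [e, sub_pos]
    refine (le_abs_self _).trans_lt ?_
    rw [abs_div, div_lt_one (D.abs_b_pos n)]
    exact hlt
  have hl : 0 < (ψ (x + b (n + 2)) - ψ x) / (ψ (x + b n) - ψ x) := by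
    have p1 := D.slope_pos h1
    have p2 := D.slope_pos h2
    have : (ψ (x + b (n + 2)) - ψ x) / (ψ (x + b n) - ψ x)
        = ((ψ (x + b (n + 2)) - ψ x) / (x + b (n + 2) - x)) *
          ((x + b (n + 2) - x) / (x + b n - x)) / ((ψ (x + b n) - ψ x) / (x + b n - x)) := by
      have := sub_ne_zero.2 h1.symm
      have := sub_ne_zero.2 h2.symm
      field_simp
    rw [this]; positivity
  have hl' : 0 < (ψ (x + b n) - ψ (x + b (n + 2))) / (ψ (x + b n) - ψ x) := by
    have p1 := D.slope_pos h3
    have p2 := D.slope_pos h2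
    have : (ψ (x + b n) - ψ (x + b (n + 2))) / (ψ (x + b n) - ψ x)
        = ((ψ (x + b n) - ψ (x + b (n + 2))) / (x + b n - (x + b (n + 2)))) *
          ((x + b n - (x + b (n + 2))) / (x + b n - x)) /
            ((ψ (x + b n) - ψ x) / (x + b n - x)) := by
      have := sub_ne_zero.2 h3.symm
      have := sub_ne_zero.2 h2.symm
      field_simp
    rw [this]; positivity
  have hsum : (ψ (x + b n) - ψ (x + b (n + 2))) / (ψ (x + b n) - ψ x)
      = 1 - (ψ (x + b (n + 2)) - ψ x) / (ψ (x + b n) - ψ x) := by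
    field_simp; ring
  refine ⟨_, _, _, _, hl, ?_, (D.ratio_bounds h1 _).1, (D.ratio_bounds h3 (b (n + 1))).1, ?_, rfl,
    rfl, rfl, rfl⟩
  · linarith
  · rw [← hsum]
    field_simp
    ring

theorem secondDiff_eq (H : ℝ → ℝ) (b : ℕ → ℝ) (n : ℕ) (x : ℝ) :
    secondDiff H b (n + 1) x
      = (H (x + b (n + 1)) - H x) - (H (x + b (n + 2) + b (n + 1)) - H (x + b (n + 2))) := by
  unfold secondDiff
  rw [add_right_comm x (b (n + 1)) (b (n + 1 + 1))]
  ring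

theorem distortion_add (D : ConjugacyData w ψ H b lam B K) (n : ℕ) (x : ℝ) :
    |log ((ψ (x + b n + b (n + 1)) - ψ (x + b (n + 1))) / (ψ (x + b n) - ψ x))
      - ((H (x + b (n + 1)) - H x) + (H (x + b n + b (n + 1)) - H (x + b n))) / 2|
        ≤ K * w |b n| :=
  D.distortion n x (x + b n) (by simpa using D.b_ne n) (by simp)

theorem distortion_add_two (D : ConjugacyData w ψ H b lam B K) (n : ℕ) (x : ℝ) :
    |log ((ψ (x + b (n + 2) + b (n + 1)) - ψ (x + b (n + 1))) / (ψ (x + b (n + 2)) - ψ x))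
      - ((H (x + b (n + 1)) - H x) + (H (x + b (n + 2) + b (n + 1)) - H (x + b (n + 2)))) / 2|
        ≤ K * w |b n| :=
  D.distortion n x (x + b (n + 2)) (by simpa using D.b_ne (n + 2))
    (by simpa using (D.b_le (n + 1)).trans (D.b_le n))

theorem distortion_sub (D : ConjugacyData w ψ H b lam B K) (n : ℕ) (x : ℝ) :
    |log ((ψ (x + b n + b (n + 1)) - ψ (x + b (n + 2) + b (n + 1))) /
        (ψ (x + b n) - ψ (x + b (n + 2))))
      - ((H (x + b (n + 2) + b (n + 1)) - H (x + b (n + 2)))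
        + (H (x + b n + b (n + 1)) - H (x + b n))) / 2| ≤ K * w |b n| := by
  have hlt : |b (n + 2)| < |b n| := by linarith [D.b_half n, D.abs_b_pos n]
  refine D.distortion n (x + b (n + 2)) (x + b n) ?_ ?_
  · intro h
    rw [add_left_cancel h] at hlt
    exact lt_irrefl _ hlt
  · rw [add_sub_add_left_eq_sub, ← sq_le_sq]
    have h1 := D.b_mul_pos n
    have h2 : b (n + 2) ^ 2 ≤ b n * b (n + 2) := by
      rw [← sq_abs, ← abs_of_pos h1, abs_mul, sq]
      gcongr
    nlinarith

theorem abs_secondDiff_succ_le (D : ConjugacyData w ψ H b lam B K) {n : ℕ}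
    (hH : ∀ x t, |t| ≤ |b n| → |H (x + t) - H x| ≤ 1 / 40) (hw : K * w |b n| ≤ 1 / 40) (x : ℝ) :
    |secondDiff H b (n + 1) x| ≤ 3 / 5 * |secondDiff H b n x| + 7 * (K * w |b n|) := by
  obtain ⟨l, A, E, W, hl, hl1, hA, hE, hW, eA, eW, eE, el⟩ := D.three_points n x
  have d1 := D.distortion_add_two n x
  have d2 := D.distortion_sub n x
  have d3 := D.distortion_add n x
  rw [← eA] at d1
  rw [← eE] at d2
  rw [← eW, hW] at d3
  have hlt : |b (n + 2)| ≤ |b n| := by linarith [D.b_half n, D.abs_b_pos n]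
  have hl' : l ≤ exp (1 / 20) * (1 / 2) := by
    obtain ⟨t, ht, hteq⟩ := exists_slope_eq_exp D.deriv (x := x) (y := x + b (n + 2))
      (by simpa using D.b_ne (n + 2))
    obtain ⟨s, hs, hseq⟩ := exists_slope_eq_exp D.deriv (x := x) (y := x + b n)
      (by simpa using D.b_ne n)
    rw [add_sub_cancel_left] at ht hteq hs hseq
    have h1 := hH x (t - x) (ht.trans hlt)
    have h2 := hH x (s - x) hs
    rw [add_sub_cancel] at h1 h2
    have e : l = exp (H t - H s) * (b (n + 2) / b n) := by
      rw [el, hteq, hseq, exp_sub]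
      field_simp
    rw [e]
    have h3 : b (n + 2) / b n ≤ 1 / 2 := by
      refine (le_abs_self _).trans ?_
      rw [abs_div, div_le_iff₀ (D.abs_b_pos n)]
      linarith [D.b_half n]
    have h4 : 0 ≤ b (n + 2) / b n := by
      have := D.b_mul_pos n
      rw [mul_comm] at this
      exact (div_pos_iff.2 (mul_pos_iff.1 this)).le
    gcongr
    linarith [(abs_le.1 h1).2, (abs_le.1 h2).1]
  have hdist : |log A - log E| ≤ 3 / 40 := by
    have h1 := hH x (b (n + 1)) (D.b_le n)
    have h2 := hH (x + b n) (b (n + 1)) (D.b_le n)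
    rw [abs_le] at *
    constructor <;> linarith [d1.1, d1.2, d2.1, d2.2, h1.1, h1.2, h2.1, h2.2]
  have hr : l * exp |log A - log E| ≤ 3 / 5 := by
    have h8 : exp (1 / 8) ≤ 8 / 7 := by
      have := add_one_le_exp (-(1 / 8) : ℝ)
      rw [exp_neg] at this
      have hp := exp_pos (1 / 8)
      have h9 : (-(1 / 8) + 1) * exp (1 / 8) ≤ 1 := by
        calc _ ≤ (exp (1 / 8))⁻¹ * exp (1 / 8) := by gcongr
          _ = 1 := inv_mul_cancel₀ hp.ne'
      linarith
    calc l * exp |log A - log E| ≤ exp (1 / 20) * (1 / 2) * exp (3 / 40) := by gcongr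
      _ = exp (1 / 8) * (1 / 2) := by rw [mul_right_comm, ← exp_add]; norm_num
      _ ≤ 3 / 5 := by linarith
  have := abs_sub_le_of_trapezoid hA hE hl.le hl1.le d1 d2 d3 hr
  rw [secondDiff_eq]
  unfold secondDiff
  have hp := mul_pos D.K_pos (D.modulus.pos _ (D.abs_b_pos n))
  linarith

theorem abs_shift_le (D : ConjugacyData w ψ H b lam B K) (x t : ℝ) : |H (x + t) - H x| ≤ 2 * B := by
  linarith [abs_sub (H (x + t)) (H x), D.bound (x + t), D.bound x]

theorem exists_abs_secondDiff_le (D : ConjugacyData w ψ H b lam B K) :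
    ∃ C > 0, ∀ n x, |secondDiff H b n x| ≤ C * geomConv (3 / 5) (fun j => w (lam ^ j)) n := by
  obtain ⟨N, hN⟩ := D.eventually_small (ε := 1 / 40) (by norm_num)
  have hu := D.w_pow_pos
  have hK := D.K_pos
  have hp : 0 < (3 / 5 : ℝ) ^ N * w (lam ^ 0) := mul_pos (by positivity) (hu 0)
  have hB := D.B_nonneg
  set C := 4 * B / ((3 / 5 : ℝ) ^ N * w (lam ^ 0)) + 63 * K with hC
  have hC0 : 0 < C := by positivity
  have hsmall : ∀ n x, n ≤ N →
      |secondDiff H b n x| ≤ C * geomConv (3 / 5) (fun j => w (lam ^ j)) n := by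
    intro n x hn
    have h1 : |secondDiff H b n x| ≤ 4 * B := by
      refine (abs_sub _ _).trans ?_
      linarith [D.abs_shift_le x (b (n + 1)), D.abs_shift_le (x + b n) (b (n + 1))]
    have h2 := pow_mul_le_geomConv (μ := 3 / 5) (by norm_num) hu n
    have h3 : (3 / 5 : ℝ) ^ N ≤ (3 / 5) ^ n :=
      pow_le_pow_of_le_one (by norm_num) (by norm_num) hn
    calc |secondDiff H b n x| ≤ 4 * B := h1
      _ = 4 * B / ((3 / 5 : ℝ) ^ N * w (lam ^ 0)) * ((3 / 5 : ℝ) ^ N * w (lam ^ 0)) :=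
          (div_mul_cancel₀ _ hp.ne').symm
      _ ≤ C * ((3 / 5 : ℝ) ^ n * w (lam ^ 0)) := by
          have := (hu 0).le
          gcongr
          rw [hC]; linarith
      _ ≤ _ := by gcongr
  refine ⟨C, hC0, fun n => ?_⟩
  induction n with
  | zero => exact fun x => hsmall 0 x (Nat.zero_le _)
  | succ n ih =>
    intro x
    rcases le_or_gt (n + 1) N with h | h
    · exact hsmall _ x h
    · obtain ⟨h1, h2⟩ := hN n (by omega)
      have h3 := D.abs_secondDiff_succ_le h1 h2 x
      have h4 := ih x
      have h5 : 7 * (K * w |b n|) ≤ C * w (lam ^ (n + 1)) := by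
        have h6 := D.w_abs_b_le n
        have h7 := D.w_pow_le_succ n
        have h8 := (hu (n + 1)).le
        calc 7 * (K * w |b n|) ≤ 7 * (K * (3 * (3 * w (lam ^ (n + 1))))) := by
              gcongr; linarith
          _ = 63 * K * w (lam ^ (n + 1)) := by ring
          _ ≤ _ := by
            gcongr; rw [hC]
            have : 0 ≤ 4 * B / ((3 / 5 : ℝ) ^ N * w (lam ^ 0)) := by positivity
            linarith
      rw [geomConv_succ]
      linarith

theorem geomConv_succ_le (D : ConjugacyData w ψ H b lam B K) (n : ℕ) :
    geomConv (3 / 5) (fun j => w (lam ^ j)) (n + 1)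
      ≤ 2 * geomConv (3 / 5) (fun j => w (lam ^ j)) n := by
  rw [geomConv_succ]
  have h1 := D.w_pow_succ_le n
  have h2 := le_geomConv (μ := 3 / 5) (by norm_num) D.w_pow_pos n
  have h3 := geomConv_pos (μ := 3 / 5) (by norm_num) D.w_pow_pos n
  linarith

/-- The average slope of the translation by `b (n + 1)` over `[x, x + b n]`. -/
noncomputable def avgSlope (ψ : ℝ → ℝ) (b : ℕ → ℝ) (n : ℕ) (x : ℝ) : ℝ :=
  (ψ (x + b n + b (n + 1)) - ψ (x + b (n + 1))) / (ψ (x + b n) - ψ x)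

theorem exists_avgSlope_step (D : ConjugacyData w ψ H b lam B K) :
    ∃ C > 0, ∀ n x, |avgSlope ψ b (n + 1) x - 1| ≤
      |ψ (x + b (n + 2)) - ψ x| / |ψ (x + b (n + 1)) - ψ x| *
        (|avgSlope ψ b n x - 1| + C * geomConv (3 / 5) (fun j => w (lam ^ j)) n) := by
  obtain ⟨C, hC, hsd⟩ := D.exists_abs_secondDiff_le
  have hK := D.K_pos
  refine ⟨exp (2 * B) * (2 * C + 6 * K), by positivity, fun n x => ?_⟩
  obtain ⟨l, A, E, W, hl, hl1, hA, hE, hW, eA, eW, eE, el⟩ := D.three_points n x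
  have d1 := D.distortion_add_two n x
  have d3 := D.distortion_add n x
  have hW' : avgSlope ψ b n x = W := by rw [eW]; rfl
  have n1 := D.sub_ne (x := x) (y := x + b (n + 1)) (by simpa using D.b_ne (n + 1))
  have n2 := D.sub_ne (x := x) (y := x + b (n + 2)) (by simpa using D.b_ne (n + 2))
  have h1 : avgSlope ψ b (n + 1) x - 1
      = (ψ (x + b (n + 2)) - ψ x) / (ψ (x + b (n + 1)) - ψ x) * (A - 1) := by
    rw [eA]
    unfold avgSlope
    rw [add_right_comm x (b (n + 1)) (b (n + 1 + 1))]
    field_simp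
    ring
  have rA := D.ratio_bounds (x := x) (y := x + b (n + 2)) (by simpa using D.b_ne (n + 2))
    (b (n + 1))
  have rW := D.ratio_bounds (x := x) (y := x + b n) (by simpa using D.b_ne n) (b (n + 1))
  rw [← eA] at d1 rA
  rw [← eW] at d3 rW
  have h2 : |A - W| ≤ exp (2 * B) * |log A - log W| := by
    have := abs_exp_sub_exp_le (abs_le.1 rA.2).2 (abs_le.1 rW.2).2
    rwa [exp_log rA.1, exp_log rW.1] at this
  have h3 : |log A - log W|
      ≤ (2 * C + 6 * K) * geomConv (3 / 5) (fun j => w (lam ^ j)) n := by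
    have s1 := hsd (n + 1) x
    have s0 := hsd n x
    rw [secondDiff_eq] at s1
    unfold secondDiff at s0
    have g1 := mul_le_mul_of_nonneg_left (D.geomConv_succ_le n) hC.le
    have hg := le_geomConv (μ := 3 / 5) (by norm_num) D.w_pow_pos n
    have hw : K * w |b n| ≤ K * (3 * geomConv (3 / 5) (fun j => w (lam ^ j)) n) := by
      have := D.w_abs_b_le n
      gcongr; linarith
    have hg0 := mul_pos hC (geomConv_pos (μ := 3 / 5) (by norm_num) D.w_pow_pos n)
    rw [abs_le] at *
    constructor <;> linarith [d1.1, d1.2, d3.1, d3.2, s0.1, s0.2, s1.1, s1.2]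
  rw [h1, abs_mul, abs_div, hW']
  gcongr
  calc |A - 1| ≤ |W - 1| + |A - W| := by
        have := abs_add_le (W - 1) (A - W)
        rwa [show W - 1 + (A - W) = A - 1 by ring] at this
    _ ≤ |W - 1| + exp (2 * B) * ((2 * C + 6 * K) * geomConv (3 / 5) (fun j => w (lam ^ j)) n) := by
        gcongr
        exact h2.trans (by gcongr)
    _ = _ := by ring

theorem exists_abs_avgSlope_sub_one_le (D : ConjugacyData w ψ H b lam B K) :
    ∃ C > 0, ∀ n x, |avgSlope ψ b n x - 1| ≤ C * geomConv lam (fun j => w (lam ^ j)) n := by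
  obtain ⟨C, hC, hstep⟩ := D.exists_avgSlope_step
  have hB := D.B_nonneg
  set X := geomConv (3 / 5) (fun j => w (lam ^ j)) with hX
  have hXpos : ∀ n, 0 < X n := geomConv_pos (by norm_num) D.w_pow_pos
  set ℓ : ℕ → ℝ → ℝ := fun n x => |ψ (x + b n) - ψ x| with hℓ
  have hℓpos : ∀ n x, 0 < ℓ n x := fun n x =>
    abs_pos.2 (D.sub_ne (by simpa using D.b_ne n))
  have hℓle : ∀ j i x, ℓ (j + i) x / ℓ j x ≤ 2 * exp (2 * B) * lam ^ i := by
    intro j i x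
    rw [div_le_iff₀ (hℓpos j x)]
    have h1 := D.abs_sub_le x (x + b (j + i))
    have h2 := D.abs_sub_ge x (x + b j)
    rw [add_sub_cancel_left] at h1 h2
    have h3 := D.abs_b_add_le j i
    have h4 := pow_pos D.lam_pos i
    calc ℓ (j + i) x ≤ exp B * |b (j + i)| := h1
      _ ≤ exp B * (2 * lam ^ i * |b j|) := by gcongr
      _ = 2 * exp (2 * B) * lam ^ i * (exp (-B) * |b j|) := by
          have : exp (2 * B) * exp (-B) = exp B := by rw [← exp_add]; ring_nf
          rw [← this]; ring
      _ ≤ _ := by gcongr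
  have hbase : ∀ x, |avgSlope ψ b 0 x - 1| ≤ exp (2 * B) * (2 * B) := by
    intro x
    have rW := D.ratio_bounds (x := x) (y := x + b 0) (by simpa using D.b_ne 0) (b 1)
    have h := abs_exp_sub_exp_le (abs_le.1 rW.2).2 (show (0 : ℝ) ≤ 2 * B by positivity)
    rw [exp_log rW.1, exp_zero, sub_zero] at h
    exact h.trans (by gcongr; exact rW.2)
  set C₃ := exp (2 * B) * (2 * B) / X 0 + C * (4 * exp (2 * B)) with hC₃
  have hC₃pos : 0 < C₃ := by
    have := hXpos 0
    positivity
  have key : ∀ n x, |avgSlope ψ b n x - 1| ≤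
      C₃ * ∑ j ∈ Finset.range (n + 1), X j * (ℓ (n + 1) x / ℓ (j + 1) x) := by
    intro n x
    induction n with
    | zero =>
      have := hXpos 0
      have := hℓpos 1 x
      rw [Finset.sum_range_one, div_self this.ne', mul_one]
      refine (hbase x).trans ?_
      rw [hC₃, add_mul, div_mul_cancel₀ _ (hXpos 0).ne']
      have : 0 ≤ C * (4 * exp (2 * B)) * X 0 := by positivity
      linarith
    | succ n ih =>
      have hl1 := hℓpos (n + 1) x
      have hl2 := hℓpos (n + 2) x
      have hx1 := hXpos n
      have hx2 := hXpos (n + 1)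
      rw [Finset.sum_range_succ, div_self hl2.ne', mul_one]
      have h1 : ∑ j ∈ Finset.range (n + 1), X j * (ℓ (n + 1 + 1) x / ℓ (j + 1) x)
          = ℓ (n + 2) x / ℓ (n + 1) x *
            ∑ j ∈ Finset.range (n + 1), X j * (ℓ (n + 1) x / ℓ (j + 1) x) := by
        rw [Finset.mul_sum]
        refine Finset.sum_congr rfl fun j _ => ?_
        have := hℓpos (j + 1) x
        field_simp
      rw [h1]
      have h2 : ℓ (n + 2) x / ℓ (n + 1) x * (C * X n) ≤ C₃ * X (n + 1) := by
        have h3 := hℓle (n + 1) 1 x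
        have h4 : X n ≤ 2 * X (n + 1) := by
          have : X (n + 1) = 3 / 5 * X n + w (lam ^ (n + 1)) := geomConv_succ _ _ _
          linarith [D.w_pow_pos (n + 1)]
        have h5 : ℓ (n + 2) x / ℓ (n + 1) x ≤ 2 * exp (2 * B) := by
          refine h3.trans ?_
          rw [pow_one]
          have := exp_pos (2 * B)
          nlinarith [D.lam_lt]
        calc _ ≤ 2 * exp (2 * B) * (C * (2 * X (n + 1))) := by gcongr
          _ = C * (4 * exp (2 * B)) * X (n + 1) := by ring
          _ ≤ _ := by
            gcongr
            rw [hC₃]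
            have : 0 ≤ exp (2 * B) * (2 * B) / X 0 := by
              have := hXpos 0
              positivity
            linarith
      calc |avgSlope ψ b (n + 1) x - 1|
          ≤ ℓ (n + 2) x / ℓ (n + 1) x * (|avgSlope ψ b n x - 1| + C * X n) := hstep n x
        _ ≤ ℓ (n + 2) x / ℓ (n + 1) x * (C₃ * ∑ j ∈ Finset.range (n + 1),
              X j * (ℓ (n + 1) x / ℓ (j + 1) x) + C * X n) := by gcongr
        _ ≤ _ := by linarith
  refine ⟨C₃ * (2 * exp (2 * B)) * 7, by positivity, fun n x => (key n x).trans ?_⟩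
  have h1 : ∑ j ∈ Finset.range (n + 1), X j * (ℓ (n + 1) x / ℓ (j + 1) x)
      ≤ 2 * exp (2 * B) * geomConv lam X n := by
    rw [geomConv, Finset.mul_sum]
    refine Finset.sum_le_sum fun j hj => ?_
    have hjn : j ≤ n := Nat.lt_succ_iff.1 (Finset.mem_range.1 hj)
    have h2 := hℓle (j + 1) (n - j) x
    rw [show j + 1 + (n - j) = n + 1 by omega] at h2
    have := hXpos j
    calc X j * (ℓ (n + 1) x / ℓ (j + 1) x) ≤ X j * (2 * exp (2 * B) * lam ^ (n - j)) := by gcongr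
      _ = _ := by ring
  have h2 := geomConv_geomConv_add_le D.lam_ge D.w_pow_pos n
  have h3 := hXpos n
  calc _ ≤ C₃ * (2 * exp (2 * B) * geomConv lam X n) := by gcongr
    _ ≤ C₃ * (2 * exp (2 * B) * (7 * geomConv lam (fun j => w (lam ^ j)) n)) := by
        gcongr; linarith
    _ = _ := by ring

/-- The increments of `H` along closest returns are controlled by the convolution of the modulus
with a geometric sequence. -/
theorem exists_abs_shift_le (D : ConjugacyData w ψ H b lam B K) :
    ∃ C > 0, ∀ n x, |H (x + b n) - H x| ≤ C * geomConv lam (fun j => w (lam ^ j)) n := by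
  obtain ⟨C₁, hC₁, h1⟩ := D.exists_abs_secondDiff_le
  obtain ⟨C₂, hC₂, h2⟩ := D.exists_abs_avgSlope_sub_one_le
  have hB := D.B_nonneg
  have hK := D.K_pos
  have hl := D.lam_ge
  have hu := D.w_pow_pos
  set Y := geomConv lam (fun j => w (lam ^ j)) with hY
  have hYpos : ∀ n, 0 < Y n := geomConv_pos D.lam_pos hu
  set C := exp (2 * B) * C₂ + 7 * C₁ + 3 * K with hC
  have hC0 : 0 < C := by positivity
  refine ⟨2 * C + 2 * B / Y 0, by have := hYpos 0; positivity, fun n x => ?_⟩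
  cases n with
  | zero =>
    refine (D.abs_shift_le x (b 0)).trans ?_
    rw [add_mul, div_mul_cancel₀ _ (hYpos 0).ne']
    have := mul_pos hC0 (hYpos 0)
    linarith
  | succ n =>
    have d := D.distortion_add n x
    have hsd := h1 n x
    have hP := h2 n x
    have hX : geomConv (3 / 5) (fun j => w (lam ^ j)) n ≤ 7 * Y n := by
      have e1 := geomConv_geomConv_add_le D.lam_ge hu n
      have e2 := geomConv_pos D.lam_pos
        (geomConv_pos (μ := 3 / 5) (by norm_num) hu) n
      have e3 := geomConv_pos (μ := 3 / 5) (by norm_num) hu n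
      linarith
    have hw : K * w |b n| ≤ K * (3 * Y n) := by
      have := D.w_abs_b_le n
      have := le_geomConv D.lam_pos hu n
      gcongr; linarith
    have rW : 0 < avgSlope ψ b n x ∧ |log (avgSlope ψ b n x)| ≤ 2 * B :=
      D.ratio_bounds (x := x) (y := x + b n) (by simpa using D.b_ne n) (b (n + 1))
    have hlog : |log (avgSlope ψ b n x)| ≤ exp (2 * B) * |avgSlope ψ b n x - 1| := by
      have hm : exp (-(2 * B)) ≤ avgSlope ψ b n x := by
        rw [← le_log_iff_exp_le rW.1]; exact (abs_le.1 rW.2).1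
      have h3 := abs_log_sub_log_le (exp_pos (-(2 * B))) hm
        (exp_le_one_iff.2 (by linarith : -(2 * B) ≤ 0))
      rw [log_one, sub_zero, exp_neg, div_inv_eq_mul] at h3
      linarith
    have hlog' : |log (avgSlope ψ b n x)| ≤ exp (2 * B) * (C₂ * Y n) :=
      hlog.trans (by gcongr)
    have hX' : C₁ * geomConv (3 / 5) (fun j => w (lam ^ j)) n ≤ C₁ * (7 * Y n) := by gcongr
    have hfin : |H (x + b (n + 1)) - H x| ≤ C * Y n := by
      unfold secondDiff at hsd
      change |log (avgSlope ψ b n x) - _| ≤ _ at d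
      have := mul_pos hC₁ (hYpos n)
      rw [hC, abs_le] at *
      constructor <;> linarith [d.1, d.2, hsd.1, hsd.2, hlog'.1, hlog'.2]
    have hYs : Y n ≤ 2 * Y (n + 1) := by
      have e : Y (n + 1) = lam * Y n + w (lam ^ (n + 1)) := geomConv_succ _ _ _
      have := hu (n + 1)
      have := hYpos n
      nlinarith
    calc _ ≤ C * Y n := hfin
      _ ≤ C * (2 * Y (n + 1)) := by gcongr
      _ = 2 * C * Y (n + 1) := by ring
      _ ≤ _ := by
        have := hYpos (n + 1)
        have := hYpos 0
        gcongr
        have : 0 ≤ 2 * B / Y 0 := by positivity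
        linarith

end ConjugacyData

theorem abs_shift_int_mul_le {H : ℝ → ℝ} {g s : ℝ} (h : ∀ x, |H (x + g) - H x| ≤ s) (z : ℤ)
    (x : ℝ) : |H (x + z * g) - H x| ≤ |(z : ℝ)| * s := by
  have key : ∀ (n : ℕ) x, |H (x + n * g) - H x| ≤ n * s := by
    intro n x
    induction n with
    | zero => simp
    | succ n ih =>
      have h1 := h (x + n * g)
      rw [show x + n * g + g = x + (n + 1 : ℕ) * g by push_cast; ring] at h1
      push_cast at h1 ⊢
      rw [abs_le] at *
      constructor <;> linarith [ih.1, ih.2, h1.1, h1.2]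
  obtain ⟨n, rfl | rfl⟩ := z.eq_nat_or_neg
  · simpa using key n x
  · have := key n (x - n * g)
    rw [sub_add_cancel, abs_sub_comm] at this
    simpa [sub_eq_add_neg] using this

/-- Decomposition of an increment of `H` into increments along closest returns. -/
theorem abs_shift_le_sum {H : ℝ → ℝ} {b κ s : ℕ → ℝ} (hb : ∀ n, b n ≠ 0)
    (hκ : ∀ n, |b n| ≤ κ n * |b (n + 1)|) (hs : ∀ n x, |H (x + b n) - H x| ≤ s n) {ε : ℝ} (j : ℕ) :
    ∀ (n : ℕ) (d x : ℝ), |d| ≤ |b n| →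
      (∀ x d, |d| ≤ |b (n + j)| → |H (x + d) - H x| ≤ ε) →
      |H (x + d) - H x| ≤ ∑ i ∈ Finset.range j, (κ (n + i) + 1) * s (n + i + 1) + ε := by
  induction j with
  | zero => intro n d x hd hε; simpa using hε x d hd
  | succ j ih =>
    intro n d x hd hε
    have hpos : 0 < |b (n + 1)| := abs_pos.2 (hb _)
    set z := round (d / b (n + 1)) with hz
    have hz1 : |d / b (n + 1) - z| ≤ 1 / 2 := abs_sub_round _
    have hrem : |d - z * b (n + 1)| ≤ |b (n + 1)| := by
      have e : d - z * b (n + 1) = (d / b (n + 1) - z) * b (n + 1) := by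
        have := hb (n + 1)
        field_simp
      rw [e, abs_mul]
      nlinarith
    have hz2 : |(z : ℝ)| ≤ κ n + 1 := by
      have h1 : |d / b (n + 1)| ≤ κ n := by
        rw [abs_div, div_le_iff₀ hpos]; exact hd.trans (hκ n)
      have := abs_sub_abs_le_abs_sub (z : ℝ) (d / b (n + 1))
      rw [abs_sub_comm] at this
      linarith
    have h1 := abs_shift_int_mul_le (hs (n + 1)) z x
    have h2 := ih (n + 1) _ (x + z * b (n + 1)) hrem (by
      rw [show n + 1 + j = n + (j + 1) by ring]; exact hε)
    rw [show x + z * b (n + 1) + (d - z * b (n + 1)) = x + d by ring] at h2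
    have hs0 : 0 ≤ s (n + 1) := (abs_nonneg _).trans (hs (n + 1) 0)
    have h3 : |(z : ℝ)| * s (n + 1) ≤ (κ n + 1) * s (n + 1) := by gcongr
    rw [Finset.sum_range_succ']
    have h4 : ∑ i ∈ Finset.range j, (κ (n + (i + 1)) + 1) * s (n + (i + 1) + 1)
        = ∑ i ∈ Finset.range j, (κ (n + 1 + i) + 1) * s (n + 1 + i + 1) := by
      refine Finset.sum_congr rfl fun i _ => ?_
      rw [show n + (i + 1) = n + 1 + i by ring]
    rw [h4, add_zero]
    rw [abs_le] at *
    constructor <;> linarith [h1.1, h1.2, h2.1, h2.2]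

theorem IsModulus.continuousOn_div_sq {w : ℝ → ℝ} (hw : IsModulus w) :
    ContinuousOn (fun y => w y / y ^ 2) (Set.Ioi 0) :=
  hw.continuous.div (by fun_prop) fun _ hx => pow_ne_zero 2 (ne_of_gt hx)

theorem IsModulus.integrableOn_div_sq {w : ℝ → ℝ} (hw : IsModulus w) {a : ℝ} (ha : 0 < a) (b : ℝ) :
    MeasureTheory.IntegrableOn (fun y => w y / y ^ 2) (Set.Ioc a b) :=
  ((hw.continuousOn_div_sq.mono fun _ hx => ha.trans_le hx.1).integrableOn_compact
    isCompact_Icc).mono_set Set.Ioc_subset_Icc_self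

theorem setIntegral_Ioc_ge {f : ℝ → ℝ} {a b m : ℝ} (hab : a ≤ b)
    (hf : MeasureTheory.IntegrableOn f (Set.Ioc a b)) (hm : ∀ x ∈ Set.Ioc a b, m ≤ f x) :
    (b - a) * m ≤ ∫ x in Set.Ioc a b, f x := by
  have h := MeasureTheory.setIntegral_mono_on (μ := MeasureTheory.volume) (f := fun _ => m)
    (MeasureTheory.integrableOn_const (by simp)) hf measurableSet_Ioc hm
  rw [MeasureTheory.setIntegral_const] at h
  simpa [MeasureTheory.measureReal_def, Real.volume_Ioc, hab] using h

theorem setIntegral_Ioc_add {f : ℝ → ℝ} {a b c : ℝ} (hab : a ≤ b) (hbc : b ≤ c)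
    (hf : MeasureTheory.IntegrableOn f (Set.Ioc a c)) :
    ∫ x in Set.Ioc a c, f x = (∫ x in Set.Ioc a b, f x) + ∫ x in Set.Ioc b c, f x := by
  rw [← Set.Ioc_union_Ioc_eq_Ioc hab hbc, MeasureTheory.setIntegral_union
    (Set.Ioc_disjoint_Ioc_of_le le_rfl) measurableSet_Ioc
    (hf.mono_set (Set.Ioc_subset_Ioc_right hbc)) (hf.mono_set (Set.Ioc_subset_Ioc_left hab))]

theorem IsModulus.exists_geomConv_le {w : ℝ → ℝ} (hw : IsModulus w) {lam : ℝ} (h0 : 0 < lam)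
    (h1 : lam < 1) : ∃ c > 0, ∀ n : ℕ, 1 ≤ n → c * geomConv lam (fun j => w (lam ^ j)) n
      ≤ lam ^ n * ∫ y in Set.Ioc (lam ^ n) (1 : ℝ), w y / y ^ 2 := by
  set Y := geomConv lam (fun j => w (lam ^ j)) with hY
  have hstep : ∀ n : ℕ, lam * (1 - lam) * w (lam ^ (n + 1))
      ≤ lam ^ (n + 1) * ∫ y in Set.Ioc (lam ^ (n + 1)) (lam ^ n), w y / y ^ 2 := by
    intro n
    have hp := pow_pos h0 n
    have hp' := pow_pos h0 (n + 1)
    have hle : lam ^ (n + 1) ≤ lam ^ n := pow_le_pow_of_le_one h0.le h1.le n.le_succ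
    have hwp := hw.pos _ hp'
    have := setIntegral_Ioc_ge (m := w (lam ^ (n + 1)) / (lam ^ n) ^ 2) hle
      (hw.integrableOn_div_sq hp' _) (fun x hx => by
        have hx0 : 0 < x := hp'.trans hx.1
        have := hw.mono hp' hx.1.le
        have := hw.pos x hx0
        have := hx.2
        gcongr)
    calc lam * (1 - lam) * w (lam ^ (n + 1))
        = lam ^ (n + 1) * ((lam ^ n - lam ^ (n + 1)) * (w (lam ^ (n + 1)) / (lam ^ n) ^ 2)) := by
          field_simp
          ring
      _ ≤ _ := by gcongr
  have hw1 : w (lam ^ 0) ≤ (lam⁻¹ + 1) * w (lam ^ 1) := by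
    have := hw.mul_le h0 (inv_pos.2 h0)
    rw [inv_mul_cancel₀ h0.ne'] at this
    simpa using this
  have h2 : 0 < 1 - lam := sub_pos.2 h1
  refine ⟨lam * (1 - lam) / 3, by positivity, fun n hn => ?_⟩
  induction n, hn using Nat.le_induction with
  | base =>
    have h3 := hstep 0
    have h4 : Y 1 ≤ 3 * w (lam ^ 1) := by
      have e : Y (0 + 1) = lam * Y 0 + w (lam ^ 1) := geomConv_succ _ _ _
      have e0 : Y 0 = w (lam ^ 0) := geomConv_zero _ _
      have h5 : lam * w (lam ^ 0) ≤ lam * ((lam⁻¹ + 1) * w (lam ^ 1)) := by gcongr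
      have h6 : lam * ((lam⁻¹ + 1) * w (lam ^ 1)) = (1 + lam) * w (lam ^ 1) := by field_simp
      have h7 := hw.pos (lam ^ 1) (by positivity)
      rw [zero_add, e0] at e
      nlinarith
    simp only [zero_add, pow_zero] at h3
    calc lam * (1 - lam) / 3 * Y 1 ≤ lam * (1 - lam) / 3 * (3 * w (lam ^ 1)) := by gcongr
      _ = lam * (1 - lam) * w (lam ^ 1) := by ring
      _ ≤ _ := h3
  | succ n hn ih =>
    have h3 := hstep n
    have hp' := pow_pos h0 (n + 1)
    have e : Y (n + 1) = lam * Y n + w (lam ^ (n + 1)) := geomConv_succ _ _ _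
    rw [setIntegral_Ioc_add (pow_le_pow_of_le_one h0.le h1.le n.le_succ)
      (pow_le_one₀ h0.le h1.le) (hw.integrableOn_div_sq hp' _), mul_add, e]
    have h4 := mul_le_mul_of_nonneg_left ih h0.le
    have h5 : 0 ≤ lam * (1 - lam) * w (lam ^ (n + 1)) := by
      have := hw.pos _ hp'
      positivity
    have h6 : lam ^ (n + 1) * ∫ y in Set.Ioc (lam ^ n) (1 : ℝ), w y / y ^ 2
        = lam * (lam ^ n * ∫ y in Set.Ioc (lam ^ n) (1 : ℝ), w y / y ^ 2) := by ring
    rw [h6]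
    linarith

theorem IsModulus.exists_sum_le_setIntegral {w φ : ℝ → ℝ} (hw : IsModulus w)
    (hφmono : MonotoneOn φ (Set.Ici 0)) (hφpos : ∀ x : ℝ, 0 ≤ x → 0 < φ x) {lam : ℝ}
    (h0 : 0 < lam) (h1 : lam < 1) :
    ∃ c > 0, ∀ n : ℕ, 1 ≤ n →
      MeasureTheory.IntegrableOn (fun x => φ (log x / log lam) *
        ∫ y in Set.Ioc x (1 : ℝ), w y / y ^ 2) (Set.Ioc 0 (lam ^ n)) →
      ∀ j : ℕ, c * ∑ i ∈ Finset.range j,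
        φ ((n + i : ℕ) : ℝ) * geomConv lam (fun j => w (lam ^ j)) (n + i)
        ≤ ∫ x in Set.Ioc 0 (lam ^ n), φ (log x / log lam) *
          ∫ y in Set.Ioc x (1 : ℝ), w y / y ^ 2 := by
  obtain ⟨c, hc, hY⟩ := hw.exists_geomConv_le h0 h1
  set Y := geomConv lam (fun j => w (lam ^ j))
  set g := fun x => φ (log x / log lam) * ∫ y in Set.Ioc x (1 : ℝ), w y / y ^ 2 with hg
  have h2 : 0 < 1 - lam := sub_pos.2 h1
  have hlog : log lam < 0 := log_neg h0 h1
  have hlow : ∀ n : ℕ, ∀ x, 0 < x → x ≤ lam ^ n →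
      φ n * ∫ y in Set.Ioc (lam ^ n) (1 : ℝ), w y / y ^ 2 ≤ g x := by
    intro n x hx hxn
    have h3 : (n : ℝ) ≤ log x / log lam := by
      rw [le_div_iff_of_neg hlog, ← log_pow]
      exact log_le_log hx hxn
    have h4 : φ n ≤ φ (log x / log lam) :=
      hφmono (Set.mem_Ici.2 n.cast_nonneg) (Set.mem_Ici.2 (n.cast_nonneg.trans h3)) h3
    have h5 : ∫ y in Set.Ioc (lam ^ n) (1 : ℝ), w y / y ^ 2
        ≤ ∫ y in Set.Ioc x (1 : ℝ), w y / y ^ 2 := by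
      refine MeasureTheory.setIntegral_mono_set (hw.integrableOn_div_sq hx 1) ?_
        (Set.Ioc_subset_Ioc_left hxn).eventuallyLE
      refine MeasureTheory.ae_restrict_of_forall_mem measurableSet_Ioc fun y hy => ?_
      have := hw.pos y (hx.trans hy.1)
      simp only [Pi.zero_apply]
      positivity
    have h6 : 0 ≤ ∫ y in Set.Ioc (lam ^ n) (1 : ℝ), w y / y ^ 2 :=
      MeasureTheory.setIntegral_nonneg measurableSet_Ioc fun y hy => by
        have := hw.pos y ((pow_pos h0 n).trans hy.1)
        positivity
    have := hφpos _ (n.cast_nonneg.trans h3)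
    exact mul_le_mul h4 h5 h6 this.le
  refine ⟨(1 - lam) * c, by positivity, fun n hn hint j => ?_⟩
  induction j generalizing n with
  | zero =>
    simp only [Finset.range_zero, Finset.sum_empty, mul_zero]
    refine MeasureTheory.setIntegral_nonneg measurableSet_Ioc fun x hx => ?_
    refine le_trans ?_ (hlow n x hx.1 hx.2)
    have h6 : 0 ≤ ∫ y in Set.Ioc (lam ^ n) (1 : ℝ), w y / y ^ 2 :=
      MeasureTheory.setIntegral_nonneg measurableSet_Ioc fun y hy => by
        have := hw.pos y ((pow_pos h0 n).trans hy.1)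
        positivity
    exact mul_nonneg (hφpos _ n.cast_nonneg).le h6
  | succ j ih =>
    have hle : lam ^ (n + 1) ≤ lam ^ n := pow_le_pow_of_le_one h0.le h1.le n.le_succ
    have hp' := pow_pos h0 (n + 1)
    have h3 := ih (n + 1) (by omega) (hint.mono_set (Set.Ioc_subset_Ioc_right hle))
    rw [setIntegral_Ioc_add hp'.le hle hint, Finset.sum_range_succ', mul_add]
    have h4 := setIntegral_Ioc_ge hle (hint.mono_set (Set.Ioc_subset_Ioc_left hp'.le))
      (fun x hx => hlow n x (hp'.trans hx.1) hx.2)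
    have h5 : ∑ i ∈ Finset.range j, φ ((n + (i + 1) : ℕ) : ℝ) * Y (n + (i + 1))
        = ∑ i ∈ Finset.range j, φ ((n + 1 + i : ℕ) : ℝ) * Y (n + 1 + i) := by
      refine Finset.sum_congr rfl fun i _ => ?_
      rw [show n + (i + 1) = n + 1 + i by ring]
    rw [h5, add_zero]
    refine add_le_add h3 (le_trans ?_ h4)
    have hφn := hφpos n n.cast_nonneg
    calc (1 - lam) * c * (φ n * Y n) = (1 - lam) * φ n * (c * Y n) := by ring
      _ ≤ (1 - lam) * φ n * (lam ^ n * ∫ y in Set.Ioc (lam ^ n) (1 : ℝ), w y / y ^ 2) := by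
          exact mul_le_mul_of_nonneg_left (hY n hn) (by positivity)
      _ = _ := by rw [pow_succ]; ring

/-- Opposite signs of consecutive terms in a decreasing solution of the convergent recursion. -/
theorem mul_succ_neg_of_recursion {a : ℕ → ℝ} {k : ℕ → ℕ}
    (hrec : ∀ n, a (n + 2) = k (n + 2) * a (n + 1) + a n)
    (hanti : ∀ n, 1 ≤ n → |a (n + 1)| < |a n|) {n : ℕ} (hn : 1 ≤ n) : a n * a (n + 1) < 0 := by
  have h1 := hanti n hn
  have h2 := hanti (n + 1) (by omega)
  have hn0 : a n ≠ 0 := abs_pos.1 ((abs_nonneg _).trans_lt h1)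
  have hn1 : a (n + 1) ≠ 0 := abs_pos.1 ((abs_nonneg _).trans_lt h2)
  by_contra! h
  have h3 : 0 < a n * a (n + 1) := lt_of_le_of_ne h (mul_ne_zero hn0 hn1).symm
  rw [← sq_lt_sq] at h1 h2
  rw [hrec n] at h2
  have hk0 : (0 : ℝ) ≤ k (n + 2) := Nat.cast_nonneg _
  nlinarith [mul_nonneg hk0 h3.le, sq_nonneg ((k (n + 2) : ℝ) * a (n + 1))]

theorem abs_eq_of_recursion {a : ℕ → ℝ} {k : ℕ → ℕ}
    (hrec : ∀ n, a (n + 2) = k (n + 2) * a (n + 1) + a n)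
    (hanti : ∀ n, 1 ≤ n → |a (n + 1)| < |a n|) {n : ℕ} (hn : 1 ≤ n) :
    |a n| = k (n + 2) * |a (n + 1)| + |a (n + 2)| := by
  have h1 := mul_succ_neg_of_recursion hrec hanti hn
  have h2 := mul_succ_neg_of_recursion hrec hanti (n := n + 1) (by omega)
  have h := hrec n
  rcases mul_neg_iff.1 h1 with ⟨h3, h4⟩ | ⟨h3, h4⟩
  · have h5 : 0 < a (n + 2) := by
      rcases mul_neg_iff.1 h2 with ⟨h5, h6⟩ | ⟨h5, h6⟩
      · linarith
      · exact h6
    rw [abs_of_pos h3, abs_of_neg h4, abs_of_pos h5]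
    linarith
  · have h5 : a (n + 2) < 0 := by
      rcases mul_neg_iff.1 h2 with ⟨h5, h6⟩ | ⟨h5, h6⟩
      · exact h6
      · linarith
    rw [abs_of_neg h3, abs_of_pos h4, abs_of_neg h5]
    linarith

theorem mul_abs_le_one_of_recursion {a : ℕ → ℝ} {k q : ℕ → ℕ}
    (hrec : ∀ n, a (n + 2) = k (n + 2) * a (n + 1) + a n)
    (hqrec : ∀ n, q (n + 2) = k (n + 2) * q (n + 1) + q n)
    (hanti : ∀ n, 1 ≤ n → |a (n + 1)| < |a n|) (hdet : q 1 * a 0 - q 0 * a 1 = 1) {n : ℕ}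
    (hn : 1 ≤ n) : q (n + 1) * |a n| ≤ 1 := by
  have hD : ∀ n, |q (n + 1) * a n - q n * a (n + 1)| = 1 := by
    intro n
    induction n with
    | zero => rw [zero_add, hdet, abs_one]
    | succ n ih =>
      rw [← ih, ← abs_neg]
      congr 1
      rw [hqrec, hrec]
      push_cast
      ring
  have hq0 : (0 : ℝ) ≤ q n := Nat.cast_nonneg _
  have hq1 : (0 : ℝ) ≤ q (n + 1) := Nat.cast_nonneg _
  have h := hD n
  have h1 := mul_succ_neg_of_recursion hrec hanti hn
  rw [← h, ← abs_of_nonneg hq1, ← abs_mul, ← sq_le_sq, abs_of_nonneg hq1]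
  nlinarith [mul_nonneg hq0 hq1, sq_nonneg ((q n : ℝ) * a (n + 1)),
    mul_nonneg (mul_nonneg hq0 hq1) (neg_nonneg.2 h1.le)]

theorem one_div_sqrt_one_add_exp_bounds {I lam : ℝ} (hI : 0 ≤ I)
    (h : lam = 1 / Real.sqrt (1 + exp (-I))) : lam < 1 ∧ 7 / 10 ≤ lam ∧ 1 / 2 ≤ lam ^ 2 := by
  have h1 := exp_pos (-I)
  have h2 : exp (-I) ≤ 1 := exp_le_one_iff.2 (neg_nonpos.2 hI)
  have h0 : 0 < lam := by rw [h]; positivity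
  have hsq : lam ^ 2 = 1 / (1 + exp (-I)) := by
    rw [h, div_pow, Real.sq_sqrt (by positivity), one_pow]
  have h3 : lam ^ 2 < 1 := by
    rw [hsq, div_lt_one (by positivity)]
    linarith
  have h4 : 1 / 2 ≤ lam ^ 2 := by
    rw [hsq]
    exact one_div_le_one_div_of_le (by positivity) (by linarith)
  exact ⟨by nlinarith, by nlinarith, h4⟩

theorem Function.Periodic.exists_pos_le {f : ℝ → ℝ} (hp : Function.Periodic f 1)
    (hc : Continuous f) (hf : ∀ x, 0 < f x) : ∃ m > 0, ∀ x, m ≤ f x := by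
  obtain ⟨x₀, -, h⟩ := isCompact_Icc.exists_isMinOn (Set.nonempty_Icc.2 (zero_le_one (α := ℝ)))
    hc.continuousOn
  refine ⟨f x₀, hf x₀, fun x => ?_⟩
  obtain ⟨y, hy, hxy⟩ := hp.exists_mem_Ico₀ one_pos x
  rw [hxy]
  exact h ⟨hy.1, hy.2.le⟩

theorem Function.Periodic.exists_abs_le {f : ℝ → ℝ} (hp : Function.Periodic f 1)
    (hc : Continuous f) : ∃ B, ∀ x, |f x| ≤ B := by
  obtain ⟨B, hB⟩ := isCompact_Icc.exists_bound_of_continuousOn (s := Set.Icc (0 : ℝ) 1)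
    hc.continuousOn
  refine ⟨B, fun x => ?_⟩
  obtain ⟨y, hy, hxy⟩ := hp.exists_mem_Ico₀ one_pos x
  rw [hxy]
  exact hB y ⟨hy.1, hy.2.le⟩

theorem Function.Periodic.uniformContinuous_of_continuous {f : ℝ → ℝ}
    (hp : Function.Periodic f 1) (hc : Continuous f) : UniformContinuous f := by
  have h1 : Continuous (hp.lift : AddCircle (1 : ℝ) → ℝ) := hc.quotient_lift _
  have h2 : UniformContinuous ((↑) : ℝ → AddCircle (1 : ℝ)) :=
    uniformContinuous_addMonoidHom_of_continuous
      (f := QuotientAddGroup.mk' (AddSubgroup.zmultiples (1 : ℝ))) (AddCircle.continuous_mk' 1)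
  exact (CompactSpace.uniformContinuous_of_continuous h1).comp h2

/-- The derivative of a map commuting with integer translations is periodic. -/
theorem periodic_of_hasDerivAt {f f' : ℝ → ℝ} {c : ℝ} (hf : ∀ x, HasDerivAt f (f' x) x)
    (hp : ∀ x, f (x + 1) = f x + c) : Function.Periodic f' 1 := fun x => by
  have h1 := (hf (x + 1)).comp_add_const x 1
  have h2 : HasDerivAt (fun y => f (y + 1)) (f' x) x := by
    simp only [hp]
    exact (hf x).add_const c
  exact h1.unique h2

theorem exists_abs_le_of_modulus {w g : ℝ → ℝ} (hw : IsModulus w) (hp : Function.Periodic g 1)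
    (hmod : ∀ x y : ℝ, x ≠ y → |g x - g y| ≤ w |x - y|) : ∃ B, ∀ x, |g x| ≤ B := by
  refine ⟨|g 0| + w 1, fun x => ?_⟩
  obtain ⟨y, hy, hxy⟩ := hp.exists_mem_Ico₀ one_pos x
  rw [hxy]
  rcases eq_or_ne y 0 with rfl | hy0
  · have := hw.pos 1 one_pos
    linarith
  · have h1 := hmod y 0 hy0
    have hypos : 0 < y := lt_of_le_of_ne hy.1 hy0.symm
    rw [sub_zero, abs_of_pos hypos] at h1
    have h2 := hw.mono hypos hy.2.le
    have h3 := abs_sub_abs_le_abs_sub (g y) (g 0)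
    linarith

/-- The inverse of a `C¹` circle diffeomorphism, with its derivative in logarithmic form. -/
theorem exists_inverse_hasDerivAt_exp {Φ Φ' : ℝ → ℝ} (hΦ : ∀ x, HasDerivAt Φ (Φ' x) x)
    (hΦc : Continuous Φ') (hΦpos : ∀ x, 0 < Φ' x) (hΦp : ∀ x, Φ (x + 1) = Φ x + 1) :
    ∃ ψ H : ℝ → ℝ, (∀ x, ψ (Φ x) = x) ∧ (∀ x, Φ (ψ x) = x) ∧
      (∀ x, HasDerivAt ψ (exp (H x)) x) ∧ (∀ x, H (Φ x) = -log (Φ' x)) ∧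
      (∀ x, ψ (x + 1) = ψ x + 1) ∧ Function.Periodic H 1 ∧ Continuous H := by
  have hcont : Continuous Φ := continuous_iff_continuousAt.2 fun x => (hΦ x).continuousAt
  have hmono : StrictMono Φ := strictMono_of_hasDerivAt_pos hΦ hΦpos
  have hnat : ∀ (n : ℕ) x, Φ (x + n) = Φ x + n := by
    intro n x
    induction n with
    | zero => simp
    | succ n ih => push_cast; rw [← add_assoc, hΦp, ih, add_assoc]
  have hsurj : Function.Surjective Φ := by
    intro y
    obtain ⟨n, hn⟩ := exists_nat_ge |y - Φ 0|
    have h1 := hnat n 0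
    have h2 := hnat n (-n)
    rw [abs_le] at hn
    rw [neg_add_cancel] at h2
    exact mem_range_of_exists_le_of_exists_ge hcont ⟨-n, by linarith⟩ ⟨0 + n, by linarith⟩
  set e := hmono.orderIsoOfSurjective Φ hsurj with he
  have hee : ∀ x, e x = Φ x := fun _ => rfl
  have hleft : ∀ x, e.symm (Φ x) = x := fun x => by rw [← hee, e.symm_apply_apply]
  have hright : ∀ x, Φ (e.symm x) = x := fun x => by rw [← hee, e.apply_symm_apply]
  have hp : ∀ x, e.symm (x + 1) = e.symm x + 1 := fun x => by
    rw [← hleft (e.symm x + 1), hΦp, hright]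
  have hΦ'p : Function.Periodic Φ' 1 := periodic_of_hasDerivAt hΦ hΦp
  refine ⟨e.symm, fun x => -log (Φ' (e.symm x)), hleft, hright, fun x => ?_, fun x => ?_, hp,
    fun x => ?_, ?_⟩
  · rw [exp_neg, exp_log (hΦpos _)]
    exact HasDerivAt.of_local_left_inverse e.symm.continuous.continuousAt (hΦ _) (hΦpos _).ne'
      (Filter.Eventually.of_forall hright)
  · simp only [hleft]
  · simp only [hp, hΦ'p (e.symm x)]
  · exact ((hΦc.comp e.symm.continuous).log fun x => (hΦpos _).ne').neg

/-- The deviation of the logarithmic distortion of a secant of `ψ` under the translation by `t`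
from its trapezoidal approximation. -/
noncomputable def secantDistortion (ψ H : ℝ → ℝ) (t x y : ℝ) : ℝ :=
  log ((ψ (y + t) - ψ (x + t)) / (ψ y - ψ x)) - ((H (x + t) - H x) + (H (y + t) - H y)) / 2

theorem secantDistortion_comm (ψ H : ℝ → ℝ) (t x y : ℝ) :
    secantDistortion ψ H t x y = secantDistortion ψ H t y x := by
  unfold secantDistortion
  rw [← neg_sub (ψ (x + t)), ← neg_sub (ψ x), neg_div_neg_eq,
    add_comm (H (x + t) - H x)]

theorem secantDistortion_add {ψ : ℝ → ℝ} (hψ : Function.Injective ψ) (H : ℝ → ℝ) (s t : ℝ)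
    {x y : ℝ} (hxy : x ≠ y) :
    secantDistortion ψ H (s + t) x y
      = secantDistortion ψ H s x y + secantDistortion ψ H t (x + s) (y + s) := by
  have h : ∀ r, ψ (y + r) - ψ (x + r) ≠ 0 := fun r =>
    sub_ne_zero.2 fun e => hxy (by simpa using (hψ e).symm)
  have h0 : ψ y - ψ x ≠ 0 := by simpa using h 0
  have h1 := h (s + t)
  simp only [← add_assoc] at h1
  unfold secantDistortion
  rw [← add_assoc, ← add_assoc, log_div h1 h0, log_div (h s) h0, log_div h1 (h s)]
  ring

theorem abs_secantDistortion_nat_mul_le {ψ H : ℝ → ℝ} (hψ : Function.Injective ψ) {ρ x y e : ℝ}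
    (hxy : x ≠ y) (h : ∀ s, |secantDistortion ψ H ρ (x + s) (y + s)| ≤ e) (n : ℕ) :
    |secantDistortion ψ H (n * ρ) x y| ≤ n * e := by
  induction n with
  | zero =>
    have : ψ y - ψ x ≠ 0 := sub_ne_zero.2 fun e => hxy (hψ e).symm
    simp [secantDistortion, div_self this]
  | succ n ih =>
    have h1 := h (n * ρ)
    push_cast
    rw [add_mul, one_mul, secantDistortion_add hψ H _ _ hxy, add_mul, one_mul]
    exact (abs_add_le _ _).trans (add_le_add ih h1)

theorem secantDistortion_sub_nat {ψ H : ℝ → ℝ} (hψp : ∀ x, ψ (x + 1) = ψ x + 1)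
    (hHp : Function.Periodic H 1) (t x y : ℝ) (n : ℕ) :
    secantDistortion ψ H (t - n) x y = secantDistortion ψ H t x y := by
  have h1 : ∀ (n : ℕ) z, ψ (z - n) = ψ z - n := by
    intro n z
    induction n with
    | zero => simp
    | succ n ih =>
      have := hψp (z - (n + 1 : ℕ))
      rw [show z - ((n + 1 : ℕ) : ℝ) + 1 = z - n by push_cast; ring, ih] at this
      push_cast at this ⊢
      linarith
  have h2 : ∀ z, H (z - n) = H z := fun z => by simpa using hHp.sub_nat_mul_eq n (x := z)
  unfold secantDistortion
  rw [← add_sub_assoc, ← add_sub_assoc, h1, h1, h2, h2, sub_sub_sub_cancel_right]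

/-- The distortion of a single step of the dynamics. -/
theorem exists_abs_secantDistortion_le {w F F' F'' ψ H : ℝ → ℝ} {ρ B : ℝ} (hw : IsModulus w)
    (hFp : ∀ x, F (x + 1) = F x + 1)
    (hF' : ∀ x, HasDerivAt F (F' x) x) (hF'' : ∀ x, HasDerivAt F' (F'' x) x)
    (hF'pos : ∀ x, 0 < F' x) (hmod : ∀ x y : ℝ, x ≠ y → |F'' x - F'' y| ≤ w |x - y|)
    (hψp : ∀ x, ψ (x + 1) = ψ x + 1) (hψ : ∀ x, HasDerivAt ψ (exp (H x)) x)
    (hFψ : ∀ x, F (ψ x) = ψ (x + ρ)) (hHψ : ∀ x, log (F' (ψ x)) = H (x + ρ) - H x)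
    (hB : ∀ x, |H x| ≤ B) :
    ∃ K > 0, ∀ x y, x ≠ y → |x - y| ≤ 1 →
      |secantDistortion ψ H ρ x y| ≤ K * (|x - y| * w |x - y|) := by
  have hF'p : Function.Periodic F' 1 := periodic_of_hasDerivAt hF' hFp
  have hF''p : Function.Periodic F'' 1 :=
    periodic_of_hasDerivAt (c := 0) hF'' (fun x => by rw [hF'p x, add_zero])
  have hF'c : Continuous F' := continuous_iff_continuousAt.2 fun x => (hF'' x).continuousAt
  obtain ⟨m, hm, hmF⟩ := hF'p.exists_pos_le hF'c hF'pos
  obtain ⟨B', hB'⟩ := exists_abs_le_of_modulus hw hF''p hmod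
  obtain ⟨K, hK, hKF⟩ := exists_abs_log_slope_sub_le hw hF' hF'' hmod hm hmF hB'
  have hmono : StrictMono ψ := strictMono_of_hasDerivAt_pos hψ fun x => exp_pos _
  set L := exp B with hL
  have hLpos : 0 < L := exp_pos _
  have key : ∀ x y, x < y → y - x ≤ 1 →
      |secantDistortion ψ H ρ x y| ≤ K * L * (L + 1) * ((y - x) * w (y - x)) := by
    intro x y hxy hxy1
    have h0 : 0 < y - x := sub_pos.2 hxy
    have hψxy := sub_pos.2 (hmono hxy)
    have hψ1 : ψ y - ψ x ≤ 1 := by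
      have h1 := hmono.monotone (show y ≤ x + 1 by linarith)
      rw [hψp] at h1
      linarith
    have h1 := hKF _ _ (hmono hxy) hψ1
    have h2 : secantDistortion ψ H ρ x y = log ((F (ψ y) - F (ψ x)) / (ψ y - ψ x))
        - (log (F' (ψ x)) + log (F' (ψ y))) / 2 := by
      rw [secantDistortion, hFψ, hFψ, hHψ, hHψ]
    obtain ⟨t, -, ht⟩ := exists_slope_eq_exp hψ hxy.ne
    have h3 : ψ y - ψ x ≤ L * (y - x) := by
      rw [ht]
      exact mul_le_mul_of_nonneg_right (exp_le_exp.2 ((le_abs_self _).trans (hB t))) h0.le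
    have h4 : w (ψ y - ψ x) ≤ (L + 1) * w (y - x) :=
      (hw.mono hψxy h3).trans (hw.mul_le h0 hLpos)
    rw [h2]
    refine h1.trans ?_
    have h5 := hw.pos _ hψxy
    calc K * ((ψ y - ψ x) * w (ψ y - ψ x)) ≤ K * ((L * (y - x)) * ((L + 1) * w (y - x))) := by
          gcongr
      _ = _ := by ring
  refine ⟨K * L * (L + 1), by positivity, fun x y hxy h1 => ?_⟩
  rcases lt_or_gt_of_ne hxy with h | h
  · rw [abs_sub_comm, abs_of_pos (sub_pos.2 h)] at h1 ⊢
    exact key x y h h1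
  · rw [abs_of_pos (sub_pos.2 h)] at h1 ⊢
    rw [secantDistortion_comm]
    exact key y x h h1

theorem abs_secantDistortion_return_le {w ψ H : ℝ → ℝ} (hw : IsModulus w) {ρ K δ : ℝ}
    (hψ : Function.Injective ψ) (hψp : ∀ x, ψ (x + 1) = ψ x + 1) (hHp : Function.Periodic H 1)
    (hK : 0 ≤ K) (h : ∀ x y, x ≠ y → |x - y| ≤ 1 →
      |secantDistortion ψ H ρ x y| ≤ K * (|x - y| * w |x - y|))
    {p q : ℕ} (hδ : δ ≤ 1) (hq : q * δ ≤ 1) {x y : ℝ} (hxy : x ≠ y) (hxyδ : |x - y| ≤ δ) :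
    |secantDistortion ψ H (q * ρ - p) x y| ≤ K * w δ := by
  rw [secantDistortion_sub_nat hψp hHp]
  have h0 : 0 < |x - y| := abs_pos.2 (sub_ne_zero.2 hxy)
  have h1 := abs_secantDistortion_nat_mul_le hψ hxy (ρ := ρ) (e := K * (|x - y| * w |x - y|))
    (fun s => by
      have := h (x + s) (y + s) (by simpa using hxy) (by simpa using hxyδ.trans hδ)
      simpa using this) q
  refine h1.trans ?_
  have h2 := hw.mono h0 hxyδ
  have h3 := hw.pos _ h0
  have hδ0 := h0.trans_le hxyδ
  have h4 := hw.pos _ hδ0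
  calc (q : ℝ) * (K * (|x - y| * w |x - y|)) ≤ q * (K * (δ * w δ)) := by gcongr
    _ = K * w δ * (q * δ) := by ring
    _ ≤ K * w δ * 1 := by gcongr
    _ = K * w δ := mul_one _

/-- Regularity of `H` from the summability of the increments along closest returns. -/
theorem ConjugacyData.exists_abs_shift_le_modulus {w ψ H wt : ℝ → ℝ} {b κ : ℕ → ℝ} {lam B K : ℝ}
    (D : ConjugacyData w ψ H b lam B K) (hwt : IsModulus wt)
    (hκ : ∀ n, |b n| ≤ κ n * |b (n + 1)|) {M : ℝ}
    (hsum : ∀ n j, ∑ i ∈ Finset.range j,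
      (κ (n + i) + 1) * geomConv lam (fun j => w (lam ^ j)) (n + i + 1) ≤ M * wt |b (n + 1)|) :
    ∃ C > 0, ∀ x d, d ≠ 0 → |H (x + d) - H x| ≤ C * wt |d| := by
  obtain ⟨C, hC, hs⟩ := D.exists_abs_shift_le
  have hb0 := hwt.pos _ (D.abs_b_pos 0)
  have hwb : ∀ n, 0 < wt |b n| := fun n => hwt.pos _ (D.abs_b_pos n)
  have hM : 0 ≤ M := by
    have := hsum 0 0
    rw [Finset.range_zero, Finset.sum_empty] at this
    exact nonneg_of_mul_nonneg_left this (hwb _)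
  refine ⟨C * M + 2 * B / wt |b 0| + 1, by have := D.B_nonneg; positivity, fun x d hd => ?_⟩
  have hd0 : 0 < |d| := abs_pos.2 hd
  have hwd := hwt.pos _ hd0
  have hB := D.B_nonneg
  by_cases hbig : |b 0| < |d|
  · have h1 := hwt.mono (D.abs_b_pos 0) hbig.le
    calc |H (x + d) - H x| ≤ 2 * B := D.abs_shift_le x d
      _ = 2 * B / wt |b 0| * wt |b 0| := (div_mul_cancel₀ _ hb0.ne').symm
      _ ≤ 2 * B / wt |b 0| * wt |d| := by gcongr
      _ ≤ _ := by
        gcongr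
        have : 0 ≤ C * M := by positivity
        linarith
  · have hex : ∃ n, |b n| < |d| := by
      have h1 : Filter.Tendsto (fun n => |b n|) Filter.atTop (nhds 0) := by
        simpa using D.tendsto_b.abs
      exact (h1.eventually (gt_mem_nhds hd0)).exists
    classical
    obtain ⟨n, hn⟩ : ∃ n, Nat.find hex = n + 1 :=
      Nat.exists_eq_succ_of_ne_zero fun h => hbig (h ▸ Nat.find_spec hex)
    have h1 : |b (n + 1)| < |d| := hn ▸ Nat.find_spec hex
    have h2 : |d| ≤ |b n| := not_lt.1 (Nat.find_min hex (by omega))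
    have h3 : |H (x + d) - H x| ≤ C * (M * wt |b (n + 1)|) := by
      refine le_of_forall_pos_le_add fun ε hε => ?_
      obtain ⟨N, hN⟩ := D.eventually_small hε
      have h4 := abs_shift_le_sum D.b_ne hκ hs (ε := ε) N n d x h2
        fun x d hxd => (hN (n + N) (by omega)).1 x d hxd
      refine h4.trans (add_le_add_left ?_ _)
      calc ∑ i ∈ Finset.range N,
            (κ (n + i) + 1) * (C * geomConv lam (fun j => w (lam ^ j)) (n + i + 1))
          = C * ∑ i ∈ Finset.range N,
            (κ (n + i) + 1) * geomConv lam (fun j => w (lam ^ j)) (n + i + 1) := by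
            rw [Finset.mul_sum]
            exact Finset.sum_congr rfl fun i _ => by ring
        _ ≤ _ := mul_le_mul_of_nonneg_left (hsum n N) hC.le
    calc |H (x + d) - H x| ≤ C * (M * wt |b (n + 1)|) := h3
      _ ≤ C * (M * wt |d|) := by
        gcongr
        exact hwt.mono (D.abs_b_pos _) h1.le
      _ = C * M * wt |d| := by ring
      _ ≤ _ := by
        gcongr
        have : 0 ≤ 2 * B / wt |b 0| := by positivity
        linarith

end

/-- Higher regularity: under the hypotheses of the Main Theorem, if
`ϖ̃ = R ∘ Δ⁻¹` (with `R(t) = ∫₀^{λᵗ} φ(log_λ x) (∫ₓ¹ ϖ(y)/y² dy) dx` and `Δ` a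
continuous strictly decreasing interpolation of `Δₙ = |qₙρ − pₙ|`) is a modulus
of continuity, then any `C¹` conjugacy `Φ` of `T` to `R_ρ` is of class
`C_{1,ϖ̃}`. -/
theorem higher_regularity
    (w : ℝ → ℝ) (hw : IsModulus w)
    (φ : ℝ → ℝ) (hφmono : MonotoneOn φ (Set.Ici 0))
    (hφcont : ContinuousOn φ (Set.Ici 0)) (hφpos : ∀ x : ℝ, 0 ≤ x → 0 < φ x)
    (F F' F'' : ℝ → ℝ) (hF : StrictMono F) (hFp : ∀ x, F (x + 1) = F x + 1)
    (hF' : ∀ x, HasDerivAt F (F' x) x) (hF'' : ∀ x, HasDerivAt F' (F'' x) x)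
    (hF'pos : ∀ x, 0 < F' x)
    (hmod : ∀ x y : ℝ, x ≠ y → |F'' x - F'' y| ≤ w |x - y|)
    (ρ : ℝ) (hρ : ρ ∈ Set.Ioo (0:ℝ) 1) (hirr : Irrational ρ)
    (hrot : ∀ x : ℝ,
      Filter.Tendsto (fun n : ℕ => (F^[n] x - x) / (n : ℝ)) Filter.atTop (nhds ρ))
    (k p q : ℕ → ℕ) (hk : ∀ n, 1 ≤ k (n + 1))
    (hp0 : p 0 = 0) (hp1 : p 1 = 1) (hq0 : q 0 = 1) (hq1 : q 1 = k 1)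
    (hprec : ∀ n, p (n + 2) = k (n + 2) * p (n + 1) + p n)
    (hqrec : ∀ n, q (n + 2) = k (n + 2) * q (n + 1) + q n)
    (hconv : Filter.Tendsto (fun n => (p n : ℝ) / (q n : ℝ)) Filter.atTop (nhds ρ))
    (c : ℝ) (hc : 0 < c) (hkφ : ∀ n : ℕ, (k (n + 1) : ℝ) ≤ c * φ n)
    (lam : ℝ)
    (hlam : lam = 1 / Real.sqrt (1 + Real.exp (-(∫ x in (0:ℝ)..1, |F'' x / F' x|))))
    (hinner : MeasureTheory.IntegrableOn
      (fun x : ℝ => φ (Real.log x / Real.log lam)) (Set.Ioc 0 1))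
    (hint : MeasureTheory.IntegrableOn
      (fun y : ℝ =>
        (∫ x in Set.Ioc (0:ℝ) y, φ (Real.log x / Real.log lam)) * w y / y ^ 2)
      (Set.Ioc 0 1))
    -- `Δfun` interpolates `Δₙ = |qₙρ − pₙ|` continuously and strictly decreasingly,
    -- and `Δinv` is its inverse
    (Δfun : ℝ → ℝ) (hΔcont : ContinuousOn Δfun (Set.Ici 1))
    (hΔanti : StrictAntiOn Δfun (Set.Ici 1))
    (hΔmem : ∀ t ∈ Set.Ici (1:ℝ), Δfun t ∈ Set.Ioc (0:ℝ) 1)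
    (hΔval : ∀ n : ℕ, 1 ≤ n → Δfun n = |(q n : ℝ) * ρ - (p n : ℝ)|)
    (Δinv : ℝ → ℝ) (hΔinv : ∀ t ∈ Set.Ici (1:ℝ), Δinv (Δfun t) = t)
    -- `R(t) = ∫₀^{λᵗ} φ(log_λ x) (∫ₓ¹ ϖ(y)/y² dy) dx`
    (R : ℝ → ℝ)
    (hR : ∀ t : ℝ, 1 ≤ t → R t =
      ∫ x in Set.Ioc (0:ℝ) (lam ^ t),
        φ (Real.log x / Real.log lam) * ∫ y in Set.Ioc x (1:ℝ), w y / y ^ 2)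
    -- `ϖ̃ = R ∘ Δ⁻¹` is assumed to be a modulus of continuity
    (wt : ℝ → ℝ) (hwt : IsModulus wt)
    (hwtR : ∀ t : ℝ, 1 ≤ t → wt (Δfun t) = R t) :
    ∀ Φ Φ' : ℝ → ℝ,
      (∀ x, HasDerivAt Φ (Φ' x) x) → Continuous Φ' → (∀ x, 0 < Φ' x) →
      (∀ x, Φ (x + 1) = Φ x + 1) → (∀ x, Φ (F x) = Φ x + ρ) →
      ∃ C > 0, ∀ x y : ℝ, x ≠ y → |x - y| ≤ 1 →
        |Φ' x - Φ' y| ≤ C * wt |x - y| := by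
  intro Φ Φ' hΦ hΦc hΦpos hΦp hconj
  obtain ⟨hlam1, hlam7, hlam2⟩ := one_div_sqrt_one_add_exp_bounds
    (intervalIntegral.integral_nonneg zero_le_one fun _ _ => abs_nonneg _) hlam
  have hlam0 : 0 < lam := by linarith
  -- the closest returns
  set a : ℕ → ℝ := fun n => (q n : ℝ) * ρ - p n with ha
  have hrec : ∀ n, a (n + 2) = k (n + 2) * a (n + 1) + a n := fun n => by
    simp only [ha, hprec, hqrec]
    push_cast
    ring
  have hnat : ∀ n : ℕ, 1 ≤ n → (n : ℝ) ∈ Set.Ici (1 : ℝ) := fun n hn =>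
    Set.mem_Ici.2 (by exact_mod_cast hn)
  have haΔ : ∀ n, 1 ≤ n → |a n| = Δfun n := fun n hn => (hΔval n hn).symm
  have hanti : ∀ n, 1 ≤ n → |a (n + 1)| < |a n| := fun n hn => by
    rw [haΔ n hn, haΔ (n + 1) (by omega)]
    exact hΔanti (hnat n hn) (hnat _ (by omega)) (by exact_mod_cast n.lt_succ_self)
  have hdet : (q 1 : ℝ) * a 0 - q 0 * a 1 = 1 := by
    simp only [ha, hp0, hp1, hq0, hq1]
    push_cast
    ring
  have hk' : ∀ n, (1 : ℝ) ≤ k (n + 1) := fun n => by exact_mod_cast hk n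
  have habs : ∀ n, |a (n + 1)| = k (n + 3) * |a (n + 2)| + |a (n + 3)| := fun n =>
    abs_eq_of_recursion hrec hanti (by omega)
  -- the inverse conjugacy
  obtain ⟨ψ, H, hψΦ, hΦψ, hψ, hHΦ, hψp, hHp, hHc⟩ :=
    exists_inverse_hasDerivAt_exp hΦ hΦc hΦpos hΦp
  have hψinj : Function.Injective ψ := Function.LeftInverse.injective hΦψ
  obtain ⟨B, hB⟩ := hHp.exists_abs_le hHc
  have hFψ : ∀ x, F (ψ x) = ψ (x + ρ) := fun x => by
    rw [← hψΦ (F (ψ x)), hconj, hΦψ]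
  have hHψ : ∀ x, Real.log (F' (ψ x)) = H (x + ρ) - H x := fun x => by
    have h1 : HasDerivAt (fun y => Φ (F y)) (Φ' (ψ x)) (ψ x) := by
      simp only [hconj]
      exact (hΦ _).add_const ρ
    have h2 := ((hΦ (F (ψ x))).comp (ψ x) (hF' (ψ x))).unique h1
    have h3 := hHΦ (F (ψ x))
    have h4 := hHΦ (ψ x)
    rw [hconj, hΦψ] at h3
    rw [hΦψ, ← h2, Real.log_mul (hΦpos _).ne' (hF'pos _).ne'] at h4
    linarith
  obtain ⟨K, hK, hdist⟩ :=
    exists_abs_secantDistortion_le hw hFp hF' hF'' hF'pos hmod hψp hψ hFψ hHψ hB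
  have D : ConjugacyData w ψ H (fun n => a (n + 1)) lam B K :=
    { modulus := hw
      lam_lt := hlam1
      lam_ge := hlam7
      half_le := hlam2
      deriv := hψ
      bound := hB
      unif := hHp.uniformContinuous_of_continuous hHc
      b_mul_pos := fun n => by
        have h1 := mul_succ_neg_of_recursion hrec hanti (n := n + 1) (by omega)
        have h2 := mul_succ_neg_of_recursion hrec hanti (n := n + 2) (by omega)
        have h3 := mul_pos_of_neg_of_neg h1 h2
        rw [show a (n + 1) * a (n + 1 + 1) * (a (n + 2) * a (n + 2 + 1))
          = a (n + 1) * a (n + 2 + 1) * a (n + 2) ^ 2 by ring] at h3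
        exact pos_of_mul_pos_left h3 (sq_nonneg _)
      b_half := fun n => by
        have h1 := habs n
        have h2 := hk' (n + 2)
        have h3 := hanti (n + 2) (by omega)
        have h4 := abs_nonneg (a (n + 2))
        change |a (n + 3)| ≤ |a (n + 1)| / 2
        change |a (n + 3)| < |a (n + 2)| at h3
        change (1 : ℝ) ≤ k (n + 3) at h2
        nlinarith
      b_le := fun n => (hanti (n + 1) (by omega)).le
      b_zero := by
        rw [haΔ _ le_rfl]
        exact (hΔmem _ (hnat _ le_rfl)).2
      K_pos := hK
      distortion := fun n x y hxy hxyδ => by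
        have h1 : |a (n + 1)| ≤ 1 := by
          rw [haΔ _ (by omega)]
          exact (hΔmem _ (hnat _ (by omega))).2
        exact abs_secantDistortion_return_le hw hψinj hψp hHp hK.le hdist (p := p (n + 2)) h1
          (mul_abs_le_one_of_recursion hrec hqrec hanti hdet (by omega)) hxy hxyδ }
  -- comparison of the increments with `wt`
  obtain ⟨c₀, hc₀, hsum⟩ := hw.exists_sum_le_setIntegral hφmono hφpos hlam0 hlam1
  have hwR : ∀ n : ℕ, 1 ≤ n → wt |a n| = ∫ x in Set.Ioc 0 (lam ^ n),
      φ (Real.log x / Real.log lam) * ∫ y in Set.Ioc x (1 : ℝ), w y / y ^ 2 := fun n hn => by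
    rw [haΔ n hn, hwtR n (hnat n hn), hR n (hnat n hn), Real.rpow_natCast]
  have hwint : ∀ n : ℕ, 1 ≤ n → MeasureTheory.IntegrableOn (fun x =>
      φ (Real.log x / Real.log lam) * ∫ y in Set.Ioc x (1 : ℝ), w y / y ^ 2)
      (Set.Ioc 0 (lam ^ n)) := fun n hn => by
    by_contra h
    have h1 := hwR n hn
    rw [MeasureTheory.integral_undef h, haΔ n hn] at h1
    exact (hwt.pos _ (hΔmem _ (hnat n hn)).1).ne' h1
  set Y := geomConv lam (fun j => w (lam ^ j)) with hY
  obtain ⟨C, hC, hHC⟩ := D.exists_abs_shift_le_modulus hwt (κ := fun n => k (n + 3) + 1)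
    (M := 6 * c / c₀) (fun n => by
      have h1 := habs n
      have h3 := hanti (n + 2) (by omega)
      change |a (n + 3)| < |a (n + 2)| at h3
      change |a (n + 1)| ≤ (k (n + 3) + 1) * |a (n + 2)|
      linarith)
    (fun n j => by
      have h1 := hsum (n + 2) (by omega) (hwint _ (by omega)) j
      rw [← hwR (n + 2) (by omega)] at h1
      have h2 : ∑ i ∈ Finset.range j, ((k (n + i + 3) : ℝ) + 1 + 1) * Y (n + i + 1)
          ≤ 6 * c * ∑ i ∈ Finset.range j, φ ((n + 2 + i : ℕ) : ℝ) * Y (n + 2 + i) := by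
        rw [Finset.mul_sum]
        refine Finset.sum_le_sum fun i _ => ?_
        have h3 := hkφ (n + i + 2)
        have h4 : (1 : ℝ) ≤ k (n + i + 3) := hk' (n + i + 2)
        change (k (n + i + 3) : ℝ) ≤ _ at h3
        rw [show n + 2 + i = n + i + 2 by ring]
        have hYpos : ∀ m, 0 < Y m := fun m =>
          geomConv_pos hlam0 (fun j => hw.pos _ (pow_pos hlam0 j)) m
        have h5 : Y (n + i + 1) ≤ 2 * Y (n + i + 2) := by
          have e : Y (n + i + 2) = lam * Y (n + i + 1) + w (lam ^ (n + i + 2)) :=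
            geomConv_succ _ _ _
          have := hw.pos (lam ^ (n + i + 2)) (by positivity)
          have := hYpos (n + i + 1)
          nlinarith
        have h6 := hYpos (n + i + 1)
        have h7 : 0 < φ ((n + i + 2 : ℕ) : ℝ) := hφpos _ (Nat.cast_nonneg _)
        calc ((k (n + i + 3) : ℝ) + 1 + 1) * Y (n + i + 1)
            ≤ (3 * (c * φ ((n + i + 2 : ℕ) : ℝ))) * (2 * Y (n + i + 2)) := by
              gcongr
              linarith
          _ = _ := by ring
      change _ ≤ 6 * c / c₀ * wt |a (n + 2)|
      calc _ ≤ _ := h2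
        _ = 6 * c / c₀ * (c₀ * ∑ i ∈ Finset.range j,
            φ ((n + 2 + i : ℕ) : ℝ) * Y (n + 2 + i)) := by field_simp
        _ ≤ _ := mul_le_mul_of_nonneg_left h1 (by positivity))
  -- back to the original coordinate
  have hL := Real.exp_pos B
  refine ⟨Real.exp B * (C * (Real.exp B + 1)), by positivity, fun x y hxy _ => ?_⟩
  have hΦH : ∀ x, Φ' x = Real.exp (-H (Φ x)) := fun x => by
    rw [hHΦ, neg_neg, Real.exp_log (hΦpos x)]
  have hd : Φ x - Φ y ≠ 0 :=
    sub_ne_zero.2 fun h => hxy ((Function.LeftInverse.injective hψΦ) h)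
  have hxy0 : 0 < |x - y| := abs_pos.2 (sub_ne_zero.2 hxy)
  have hdle : |Φ x - Φ y| ≤ Real.exp B * |x - y| := by
    obtain ⟨t, -, ht⟩ := exists_slope_eq_exp hψ (x := Φ y) (y := Φ x) (sub_ne_zero.1 hd).symm
    rw [hψΦ, hψΦ] at ht
    rw [ht, abs_mul, Real.abs_exp, ← mul_assoc, ← Real.exp_add]
    refine le_mul_of_one_le_left (abs_nonneg _) (Real.one_le_exp ?_)
    linarith [(abs_le.1 (hB t)).1]
  have h1 := hHC (Φ y) (Φ x - Φ y) hd
  rw [add_sub_cancel] at h1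
  have h2 : wt |Φ x - Φ y| ≤ (Real.exp B + 1) * wt |x - y| :=
    (hwt.mono (abs_pos.2 hd) hdle).trans (hwt.mul_le hxy0 hL)
  have hneg : ∀ z, -H z ≤ B := fun z => by linarith [(abs_le.1 (hB z)).1]
  have h3 := abs_exp_sub_exp_le (hneg (Φ x)) (hneg (Φ y))
  rw [neg_sub_neg, abs_sub_comm (H (Φ y))] at h3
  rw [hΦH, hΦH]
  calc _ ≤ Real.exp B * |H (Φ x) - H (Φ y)| := h3
    _ ≤ Real.exp B * (C * ((Real.exp B + 1) * wt |x - y|)) := by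
      gcongr
      exact h1.trans (mul_le_mul_of_nonneg_left h2 hC.le)
    _ = _ := by ring
end
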